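/- arXiv:0908.2543 — 4 statements merged into one kernel-verified Lean document; each statement's English description precedes it below -/
import Mathlib

section
/- Let k ≥ 4 be an integer and let H be a finite k-uniform hypergraph (every hyperedge has exactly k vertices) in which every vertex lies in at most k hyperedges. Then H is 2-colorable: there is a function from the vertex set to {0,1} under which no hyperedge is monochromatic. -/
open Finset

/-- The degree of a vertex `v` in a hypergraph given as a finite family `H` of hyperedges:
the number of hyperedges containing `v`. -/
def hyperDegree {V : Type*} [DecidableEq V] (H : Finset (Finset V)) (v : V) : ℕ :=
  (H.filter (fun f => v ∈ f)).card

/-- A 2-coloring of the vertices under which no hyperedge of `H` is monochromatic. -/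
def IsProper2Coloring {V : Type*} (H : Finset (Finset V)) (c : V → Bool) : Prop :=
  ∀ f ∈ H, ∃ u ∈ f, ∃ w ∈ f, c u ≠ c w

set_option linter.unusedSectionVars false

namespace SignPattern

universe u

section Basic

variable {R C : Type u}

/-- Row `i` of `A`, weighted by `x`, has both a positive and a negative entry. -/
def Mixed (A : R → C → ℝ) (x : C → ℝ) (i : R) : Prop :=
  (∃ j, 0 < A i j * x j) ∧ ∃ j, A i j * x j < 0

/-- `σ` matches the rows in `P` injectively to columns in `Q` along nonzero entries of `A`. -/
structure IsMatching (A : R → C → ℝ) (P : Finset R) (Q : Finset C) (σ : R → C) : Prop where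
  mapsTo : ∀ i ∈ P, σ i ∈ Q
  injOn : ∀ i ∈ P, ∀ i' ∈ P, σ i = σ i' → i = i'
  ne_zero : ∀ i ∈ P, A i (σ i) ≠ 0

/-- The block of `A` with rows `P` and columns `Q` is sign-nonsingular or has no perfect
matching, expressed through sign vectors. -/
def SNSOn (A : R → C → ℝ) (P : Finset R) (Q : Finset C) : Prop :=
  ∀ σ : R → C, IsMatching A P Q σ → ∀ x : C → ℝ, (∀ j, j ∉ Q → x j = 0) → x ≠ 0 →
    ∃ i ∈ P, x (σ i) ≠ 0 ∧ ¬ Mixed A x i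

/-- Every entry of `D` is zero or has the same sign as the corresponding entry of `A`. -/
def Sub (D A : R → C → ℝ) : Prop := ∀ i j, D i j ≠ 0 → 0 < D i j * A i j

/-- Every zero block `S × T` of the block `P × Q` satisfies `|S| + |T| + d ≤ |P|`. -/
def ExpOn (d : ℕ) (A : R → C → ℝ) (P : Finset R) (Q : Finset C) : Prop :=
  ∀ S ⊆ P, ∀ T ⊆ Q, S.Nonempty → T.Nonempty → (∀ i ∈ S, ∀ j ∈ T, A i j = 0) →
    S.card + T.card + d ≤ P.card

/-- The number of nonzero entries of the block `P × Q`. -/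
noncomputable def edgesOn (A : R → C → ℝ) (P : Finset R) (Q : Finset C) : ℕ :=
  ((P ×ˢ Q).filter (fun p => A p.1 p.2 ≠ 0)).card

theorem Sub.mixed {D A : R → C → ℝ} (h : Sub D A) {x : C → ℝ} {i : R} (hm : Mixed D x i) :
    Mixed A x i := by
  obtain ⟨⟨j, hj⟩, j', hj'⟩ := hm
  refine ⟨⟨j, ?_⟩, j', ?_⟩
  · have h1 : D i j ≠ 0 := by rintro h0; simp [h0] at hj
    have h2 := h i j h1
    by_contra hc
    push Not at hc
    have : 0 < (D i j * A i j) * (D i j * x j) := mul_pos h2 hj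
    nlinarith [mul_nonpos_of_nonneg_of_nonpos (mul_self_nonneg (D i j)) hc]
  · have h1 : D i j' ≠ 0 := by rintro h0; simp [h0] at hj'
    have h2 := h i j' h1
    by_contra hc
    push Not at hc
    have : (D i j' * A i j') * (D i j' * x j') < 0 := mul_neg_of_pos_of_neg h2 hj'
    nlinarith [mul_nonneg (mul_self_nonneg (D i j')) hc]

theorem Sub.ne_zero {D A : R → C → ℝ} (h : Sub D A) {i : R} {j : C} (hd : D i j ≠ 0) :
    A i j ≠ 0 := by
  intro h0
  have := h i j hd
  simp [h0] at this

theorem Sub.trans {D B A : R → C → ℝ} (h : Sub D B) (h' : Sub B A) : Sub D A := by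
  intro i j hd
  have h1 := h i j hd
  have h2 := h' i j (h.ne_zero hd)
  have h3 : 0 < (D i j * A i j) * (B i j * B i j) := by nlinarith [mul_pos h1 h2]
  exact pos_of_mul_pos_left h3 (mul_self_nonneg _)

theorem IsMatching.mono {D A : R → C → ℝ} (h : Sub D A) {P : Finset R} {Q : Finset C} {σ : R → C}
    (hσ : IsMatching D P Q σ) : IsMatching A P Q σ :=
  ⟨hσ.mapsTo, hσ.injOn, fun i hi => h.ne_zero (hσ.ne_zero i hi)⟩

theorem SNSOn.mono {D A : R → C → ℝ} (h : Sub D A) {P : Finset R} {Q : Finset C}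
    (hA : SNSOn A P Q) : SNSOn D P Q := by
  intro σ hσ x hx hx0
  obtain ⟨i, hi, h1, h2⟩ := hA σ (hσ.mono h) x hx hx0
  exact ⟨i, hi, h1, fun hm => h2 (h.mixed hm)⟩

theorem IsMatching.injective [Fintype R] [Fintype C] {A : R → C → ℝ} {σ : R → C}
    (hσ : IsMatching A univ univ σ) : Function.Injective σ :=
  fun i i' h => hσ.injOn i (mem_univ _) i' (mem_univ _) h

theorem ExpOn.mono {d d' : ℕ} (hd : d' ≤ d) {A : R → C → ℝ} {P : Finset R} {Q : Finset C}
    (h : ExpOn d A P Q) : ExpOn d' A P Q := by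
  intro S hS T hT hSn hTn h0
  have := h S hS T hT hSn hTn h0
  omega

theorem ExpOn.transpose {d : ℕ} {A : R → C → ℝ} {P : Finset R} {Q : Finset C}
    (h : ExpOn d A P Q) (hPQ : P.card = Q.card) : ExpOn d (fun j i => A i j) Q P := by
  intro T hT S hS hTn hSn h0
  have := h S hS T hT hSn hTn (fun i hi j hj => h0 j hj i hi)
  omega

theorem exists_pos_weights {ι : Type*} [Fintype ι] [DecidableEq ι] (a : ι → ℝ) {j j' : ι}
    (hj : 0 < a j) (hj' : a j' < 0) : ∃ w : ι → ℝ, (∀ k, 0 < w k) ∧ ∑ k, w k * a k = 0 := by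
  have key : ∀ (l : ι) (t : ℝ), ∑ k, (1 + if k = l then t else 0) * a k
      = (∑ k, a k) + t * a l := by
    intro l t
    simp [add_mul, sum_add_distrib, ite_mul]
  rcases le_total (∑ k, a k) 0 with hT | hT
  · refine ⟨fun k => 1 + if k = j then -(∑ k, a k) / a j else 0, fun k => ?_, ?_⟩
    · have : 0 ≤ -(∑ k, a k) / a j := div_nonneg (by linarith) hj.le
      dsimp only
      split_ifs <;> linarith
    · rw [key, div_mul_cancel₀ _ hj.ne']; ring
  · refine ⟨fun k => 1 + if k = j' then -(∑ k, a k) / a j' else 0, fun k => ?_, ?_⟩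
    · have : 0 ≤ -(∑ k, a k) / a j' := div_nonneg_of_nonpos (by linarith) hj'.le
      dsimp only
      split_ifs <;> linarith
    · rw [key, div_mul_cancel₀ _ hj'.ne]; ring

theorem mixed_of_sum_eq_zero [Fintype C] {A : R → C → ℝ} {x : C → ℝ} {i : R}
    (h : ∑ j, A i j * x j = 0) {k : C} (hk : A i k * x k ≠ 0) : Mixed A x i := by
  constructor
  · by_contra hc
    push Not at hc
    exact hk ((sum_eq_zero_iff_of_nonpos (fun j _ => hc j)).1 h k (mem_univ _))
  · by_contra hc
    push Not at hc
    exact hk ((sum_eq_zero_iff_of_nonneg (fun j _ => hc j)).1 h k (mem_univ _))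

end Basic

section Square

variable {R C : Type u} [Fintype R] [Fintype C] [DecidableEq R] [DecidableEq C]

theorem SNSOn.eq_zero {A : R → C → ℝ} (hA : SNSOn A univ univ) {σ : R → C}
    (hσ : IsMatching A univ univ σ) (u : C → ℝ)
    (h : ∀ i, u (σ i) = 0 ∨ ∑ j, A i j * u j = 0) : u = 0 := by
  by_contra hu
  obtain ⟨i, -, h1, h2⟩ := hA σ hσ u (by simp) hu
  rcases h i with h3 | h3
  · exact h1 h3
  · exact h2 (mixed_of_sum_eq_zero h3 (mul_ne_zero (hσ.ne_zero i (mem_univ _)) h1))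

theorem SNSOn.exists_solution {A : R → C → ℝ} (hA : SNSOn A univ univ)
    (hRC : Fintype.card R = Fintype.card C) {σ : R → C}
    (hσ : IsMatching A univ univ σ) (v : R → ℝ) : ∃ y : C → ℝ, ∀ i, ∑ j, A i j * y j = v i := by
  let φ : (C → ℝ) →ₗ[ℝ] (R → ℝ) := Matrix.mulVecLin (Matrix.of A)
  have hφ : ∀ y i, φ y i = ∑ j, A i j * y j := fun y i => rfl
  have hinj : Function.Injective φ := by
    rw [← LinearMap.ker_eq_bot, LinearMap.ker_eq_bot']
    intro y hy
    refine hA.eq_zero hσ y fun i => Or.inr ?_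
    rw [← hφ, hy]; rfl
  have hsurj : Function.Surjective φ := by
    refine (LinearMap.injective_iff_surjective_of_finrank_eq_finrank ?_).1 hinj
    simp [hRC]
  obtain ⟨y, hy⟩ := hsurj v
  exact ⟨y, fun i => by rw [← hφ, hy]⟩

theorem SNSOn.transpose_univ {A : R → C → ℝ} (hA : SNSOn A univ univ)
    (hRC : Fintype.card R = Fintype.card C) :
    SNSOn (fun j i => A i j) (univ : Finset C) (univ : Finset R) := by
  classical
  intro τ hτ y _ hy0
  by_contra hcon
  push Not at hcon
  have hbij : Function.Bijective τ :=
    (Fintype.bijective_iff_injective_and_card τ).2 ⟨hτ.injective, hRC.symm⟩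
  have hw : ∀ j, ∃ w : R → ℝ, (∀ i, 0 ≤ w i) ∧ 0 < w (τ j) ∧ ∑ i, w i * (A i j * y i) = 0 := by
    intro j
    by_cases hj : y (τ j) = 0
    · refine ⟨fun i => if y i = 0 then 1 else 0, fun i => ?_, by simp [hj], ?_⟩
      · dsimp only; split_ifs <;> norm_num
      · refine sum_eq_zero fun i _ => ?_
        by_cases h : y i = 0 <;> simp [h]
    · obtain ⟨⟨i, hi⟩, i', hi'⟩ := hcon j (mem_univ _) hj
      obtain ⟨w, hw, hs⟩ := exists_pos_weights (fun i => A i j * y i) hi hi'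
      exact ⟨w, fun i => (hw i).le, hw _, hs⟩
  choose w hw0 hwp hws using hw
  set D : R → C → ℝ := fun i j => w j i * A i j with hD
  have hsub : Sub D A := by
    intro i j hd
    have h1 : w j i ≠ 0 := fun h => hd (by simp [hD, h])
    have h2 : A i j ≠ 0 := fun h => hd (by simp [hD, h])
    have h3 : 0 < w j i := lt_of_le_of_ne (hw0 j i) h1.symm
    have : D i j * A i j = w j i * (A i j * A i j) := by simp [hD]; ring
    rw [this]
    exact mul_pos h3 (mul_self_pos.2 h2)
  let e : C ≃ R := Equiv.ofBijective τ hbij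
  let M : Matrix C C ℝ := Matrix.of fun j j' => D (τ j) j'
  have hdet : M.det = 0 := by
    refine Matrix.exists_vecMul_eq_zero_iff.1 ⟨fun j => y (τ j), ?_, ?_⟩
    · intro h
      apply hy0
      funext i
      obtain ⟨j, rfl⟩ := hbij.2 i
      exact congrFun h j
    · funext j
      have : ∑ k, y (τ k) * D (τ k) j = ∑ i, y i * D i j := by
        exact Equiv.sum_comp e (fun i => y i * D i j)
      change ∑ k, y (τ k) * D (τ k) j = 0
      rw [this, ← hws j]
      refine sum_congr rfl fun i _ => ?_
      simp [hD]; ring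
  obtain ⟨x, hx0, hx⟩ := Matrix.exists_mulVec_eq_zero_iff.2 hdet
  have hσ : IsMatching D univ univ e.symm := by
    refine ⟨by simp, by simp, fun i _ => ?_⟩
    obtain ⟨j, rfl⟩ := hbij.2 i
    have : e.symm (τ j) = j := e.symm_apply_apply j
    rw [this]
    exact mul_ne_zero (hwp j).ne' (hτ.ne_zero j (mem_univ _))
  refine hx0 ((hA.mono hsub).eq_zero hσ x fun i => Or.inr ?_)
  obtain ⟨j, rfl⟩ := hbij.2 i
  exact congrFun hx j

/-- The block of `A` with rows `P` and columns `Q`, on subtypes. -/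
def block (A : R → C → ℝ) (P : Finset R) (Q : Finset C) : P → Q → ℝ := fun i j => A i j

theorem SNSOn.block {A : R → C → ℝ} {P : Finset R} {Q : Finset C} (hA : SNSOn A P Q) :
    SNSOn (block A P Q) univ univ := by
  intro σ hσ x _ hx0
  obtain ⟨j0, hj0⟩ := Function.ne_iff.1 hx0
  let σ' : R → C := fun i => if h : i ∈ P then σ ⟨i, h⟩ else j0
  let x' : C → ℝ := fun j => if h : j ∈ Q then x ⟨j, h⟩ else 0
  have hσ' : ∀ i (h : i ∈ P), σ' i = σ ⟨i, h⟩ := fun i h => by simp [σ', h]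
  have hx' : ∀ j : Q, x' j = x j := fun j => by simp [x']
  have hm : IsMatching A P Q σ' := by
    refine ⟨fun i hi => ?_, fun i hi i' hi' h => ?_, fun i hi => ?_⟩
    · rw [hσ' i hi]; exact (σ ⟨i, hi⟩).2
    · rw [hσ' i hi, hσ' i' hi'] at h
      exact congrArg Subtype.val (hσ.injective (Subtype.ext h))
    · rw [hσ' i hi]; exact hσ.ne_zero ⟨i, hi⟩ (mem_univ _)
  obtain ⟨i, hi, h1, h2⟩ := hA σ' hm x' (fun j hj => by simp [x', hj]) (by
    intro h
    apply hj0
    rw [← hx', h]; rfl)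
  refine ⟨⟨i, hi⟩, mem_univ _, ?_, ?_⟩
  · rw [hσ' i hi, hx'] at h1; exact h1
  · rintro ⟨⟨j, hj⟩, k, hk⟩
    refine h2 ⟨⟨j, ?_⟩, k, ?_⟩
    · rw [hx']; exact hj
    · rw [hx']; exact hk

theorem SNSOn.of_block {A : R → C → ℝ} {P : Finset R} {Q : Finset C}
    (hA : SNSOn (SignPattern.block A P Q) univ univ) : SNSOn A P Q := by
  intro σ hσ x hx hx0
  let σ' : P → Q := fun i => ⟨σ i, hσ.mapsTo i i.2⟩
  obtain ⟨i, -, h1, h2⟩ := hA σ'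
    ⟨by simp, fun i _ i' _ h => Subtype.ext (hσ.injOn i i.2 i' i'.2 (congrArg Subtype.val h)),
      fun i _ => hσ.ne_zero i i.2⟩ (fun j => x j) (by simp) (by
    intro h
    apply hx0
    funext j
    by_cases hj : j ∈ Q
    · exact congrFun h ⟨j, hj⟩
    · exact hx j hj)
  refine ⟨i, i.2, h1, ?_⟩
  rintro ⟨⟨j, hj⟩, k, hk⟩
  have hjQ : j ∈ Q := by by_contra hn; simp [hx j hn] at hj
  have hkQ : k ∈ Q := by by_contra hn; simp [hx k hn] at hk
  exact h2 ⟨⟨⟨j, hjQ⟩, hj⟩, ⟨k, hkQ⟩, hk⟩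

theorem SNSOn.transpose {A : R → C → ℝ} {P : Finset R} {Q : Finset C} (hA : SNSOn A P Q)
    (hPQ : P.card = Q.card) : SNSOn (fun j i => A i j) Q P :=
  SNSOn.of_block (hA.block.transpose_univ (by simpa using hPQ))

theorem ExpOn.block {d : ℕ} {A : R → C → ℝ} {P : Finset R} {Q : Finset C} (h : ExpOn d A P Q) :
    ExpOn d (SignPattern.block A P Q) univ univ := by
  intro S _ T _ hS hT h0
  have := h (S.map (Function.Embedding.subtype _)) (by intro i hi; simp at hi; exact hi.1)
    (T.map (Function.Embedding.subtype _)) (by intro i hi; simp at hi; exact hi.1)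
    (by simpa using hS) (by simpa using hT) (by
      intro i hi j hj
      simp only [mem_map, Function.Embedding.subtype_apply] at hi hj
      obtain ⟨i, hi, rfl⟩ := hi
      obtain ⟨j, hj, rfl⟩ := hj
      exact h0 i hi j hj)
  simpa using this

theorem edgesOn_block (A : R → C → ℝ) (P : Finset R) (Q : Finset C) :
    edgesOn (block A P Q) univ univ = edgesOn A P Q := by
  unfold edgesOn
  refine card_bij (fun p _ => (p.1.1, p.2.1)) ?_ ?_ ?_
  · intro p hp
    simp only [mem_filter, mem_product] at hp ⊢
    exact ⟨⟨p.1.2, p.2.2⟩, hp.2⟩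
  · intro p _ q _ h
    simp only [Prod.mk.injEq] at h
    exact Prod.ext (Subtype.ext h.1) (Subtype.ext h.2)
  · intro p hp
    simp only [mem_filter, mem_product] at hp
    exact ⟨(⟨p.1, hp.1.1⟩, ⟨p.2, hp.1.2⟩), by
      simp only [mem_filter, mem_product, mem_univ, true_and]; exact hp.2, rfl⟩

theorem edgesOn_transpose (A : R → C → ℝ) (P : Finset R) (Q : Finset C) :
    edgesOn (fun j i => A i j) Q P = edgesOn A P Q := by
  unfold edgesOn
  refine card_bij (fun p _ => (p.2, p.1)) ?_ ?_ ?_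
  · intro p hp
    simp only [mem_filter, mem_product] at hp ⊢
    exact ⟨hp.1.symm, hp.2⟩
  · intro p _ q _ h
    simp only [Prod.mk.injEq] at h
    exact Prod.ext h.2 h.1
  · intro p hp
    simp only [mem_filter, mem_product] at hp
    exact ⟨(p.2, p.1), by simpa using ⟨hp.1.symm, hp.2⟩, rfl⟩

/-- In a square matrix with expansion `d`, any matching of `d` rows extends to a perfect one. -/
theorem ExpOn.exists_matching {d : ℕ} {A : R → C → ℝ} (h : ExpOn d A univ univ)
    (hRC : Fintype.card R = Fintype.card C) (K : Finset R) (τ : R → C)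
    (hτ : IsMatching A K univ τ) (hK : K.card = d) :
    ∃ σ, IsMatching A univ univ σ ∧ ∀ i ∈ K, σ i = τ i := by
  classical
  let N : R → Finset C := fun i => if i ∈ K then {τ i} else
    (univ.filter fun j => A i j ≠ 0) \ K.image τ
  have hall : ∀ S : Finset R, S.card ≤ (S.biUnion N).card := by
    intro S
    let S1 := S.filter (· ∈ K)
    let S2 := S.filter (· ∉ K)
    have hS : S1.card + S2.card = S.card := card_filter_add_card_filter_not _
    have hinj : (S1.image τ).card = S1.card := by
      refine card_image_of_injOn fun i hi i' hi' hh => hτ.injOn i ?_ i' ?_ hh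
      · simp [S1] at hi; exact hi.2
      · simp [S1] at hi'; exact hi'.2
    let M : Finset C := univ.filter fun j => ∃ i ∈ S2, A i j ≠ 0
    have hM : S2.Nonempty → S2.card + d ≤ M.card := by
      intro hne
      by_cases hMc : Mᶜ.Nonempty
      · have := h S2 (subset_univ _) Mᶜ (subset_univ _) hne hMc (by
          intro i hi j hj
          by_contra hc
          simp only [M, mem_compl, mem_filter, mem_univ, true_and, not_exists, not_and] at hj
          exact hj i hi hc)
        rw [card_compl, card_univ] at this
        have h2 := card_le_univ M
        omega
      · have hMu : M = univ := by
          rw [not_nonempty_iff_eq_empty, compl_eq_empty_iff] at hMc; exact hMc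
        have : (S2 ∪ K).card = S2.card + K.card := by
          refine card_union_of_disjoint ?_
          rw [Finset.disjoint_left]
          intro i hi; simp [S2] at hi; exact hi.2
        have h2 := card_le_univ (S2 ∪ K)
        rw [hMu, card_univ]
        omega
    have hsub : (S1.image τ) ∪ (M \ K.image τ) ⊆ S.biUnion N := by
      intro j hj
      rw [mem_union] at hj
      rw [mem_biUnion]
      rcases hj with hj | hj
      · obtain ⟨i, hi, rfl⟩ := mem_image.1 hj
        simp only [S1, mem_filter] at hi
        exact ⟨i, hi.1, by simp [N, hi.2]⟩
      · simp only [M, mem_sdiff, mem_filter, mem_univ, true_and] at hj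
        obtain ⟨⟨i, hi, hA⟩, hjk⟩ := hj
        simp only [S2, mem_filter] at hi
        refine ⟨i, hi.1, ?_⟩
        simp only [N, hi.2, if_false, mem_sdiff, mem_filter, mem_univ, true_and]
        exact ⟨hA, hjk⟩
    have hdisj : Disjoint (S1.image τ) (M \ K.image τ) := by
      rw [Finset.disjoint_left]
      intro j hj hj'
      obtain ⟨i, hi, rfl⟩ := mem_image.1 hj
      simp only [S1, mem_filter] at hi
      exact (mem_sdiff.1 hj').2 (mem_image_of_mem τ hi.2)
    have h1 := card_le_card hsub
    rw [card_union_of_disjoint hdisj, hinj] at h1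
    have h2 : M.card - (K.image τ).card ≤ (M \ K.image τ).card := le_card_sdiff _ _
    have h3 : (K.image τ).card ≤ d := hK ▸ card_image_le
    by_cases hne : S2.Nonempty
    · have := hM hne; omega
    · rw [not_nonempty_iff_eq_empty] at hne
      rw [hne, card_empty] at hS; omega
  obtain ⟨σ, hinj, hσ⟩ := (all_card_le_biUnion_card_iff_exists_injective N).1 hall
  have hK' : ∀ i ∈ K, σ i = τ i := by
    intro i hi
    have := hσ i
    simpa [N, hi] using this
  refine ⟨σ, ⟨by simp, fun i _ i' _ hh => hinj hh, fun i _ => ?_⟩, hK'⟩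
  by_cases hi : i ∈ K
  · rw [hK' i hi]; exact hτ.ne_zero i hi
  · have := hσ i
    simp only [N, hi, if_false, mem_sdiff, mem_filter, mem_univ, true_and] at this
    exact this.1

theorem ExpOn.exists_matching_one {A : R → C → ℝ} (h : ExpOn 1 A univ univ)
    (hRC : Fintype.card R = Fintype.card C) {r : R} {c : C} (hrc : A r c ≠ 0) :
    ∃ σ, IsMatching A univ univ σ ∧ σ r = c := by
  obtain ⟨σ, h1, h2⟩ := h.exists_matching hRC {r} (fun _ => c)
    ⟨by simp, by simp, by simpa using hrc⟩ (by simp)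
  exact ⟨σ, h1, h2 r (by simp)⟩

theorem ExpOn.exists_matching_two {A : R → C → ℝ} (h : ExpOn 2 A univ univ)
    (hRC : Fintype.card R = Fintype.card C) {r r' : R} {c c' : C} (hrc : A r c ≠ 0)
    (hrc' : A r' c' ≠ 0) (hr : r ≠ r') (hc : c ≠ c') :
    ∃ σ, IsMatching A univ univ σ ∧ σ r = c ∧ σ r' = c' := by
  obtain ⟨σ, h1, h2⟩ := h.exists_matching hRC {r, r'} (fun i => if i = r then c else c')
    ⟨by simp, by
      intro i hi i' hi' hh
      simp only [mem_insert, mem_singleton] at hi hi'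
      rcases hi with rfl | rfl <;> rcases hi' with rfl | rfl <;> simp_all [hr.symm, hc.symm], by
      intro i hi
      simp only [mem_insert, mem_singleton] at hi
      rcases hi with rfl | rfl
      · simpa using hrc
      · simpa [hr.symm] using hrc'⟩ (card_pair hr)
  refine ⟨σ, h1, ?_, ?_⟩
  · simpa using h2 r (by simp)
  · simpa [hr.symm] using h2 r' (by simp)

end Square

section TwoChannel

variable {R C : Type u} [Fintype R] [Fintype C] [DecidableEq R] [DecidableEq C]

theorem nonneg_of_solution {A D : R → C → ℝ} {a : R} {b : C} (hA : SNSOn A univ univ)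
    (hab : A a b ≠ 0) (hD : Sub D A) (hDab : D a b = 0) {σ : R → C}
    (hσ : IsMatching D univ univ σ) {y : C → ℝ}
    (hy : ∀ i, ∑ j, D i j * y j = if i = a then 1 else 0) : 0 ≤ A a b * y b := by
  by_contra hneg
  push Not at hneg
  set t : ℝ := -1 / (A a b * y b) with ht
  have htpos : 0 < t := div_pos_of_neg_of_neg (by norm_num) hneg
  let D' : R → C → ℝ := fun i j => D i j + if j = b then (if i = a then t * A a b else 0) else 0
  have hD' : ∀ i j, ¬ (i = a ∧ j = b) → D' i j = D i j := by
    intro i j h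
    by_cases hj : j = b <;> by_cases hi : i = a <;> simp_all [D']
  have hsub : Sub D' A := by
    intro i j hd
    by_cases h : i = a ∧ j = b
    · obtain ⟨rfl, rfl⟩ := h
      have : D' i j * A i j = t * (A i j * A i j) := by simp [D', hDab]; ring
      rw [this]
      exact mul_pos htpos (mul_self_pos.2 hab)
    · rw [hD' i j h] at hd ⊢
      exact hD i j hd
  have hm : IsMatching D' univ univ σ := by
    refine ⟨by simp, hσ.injOn, fun i hi => ?_⟩
    have h0 := hσ.ne_zero i hi
    rw [hD']
    · exact h0
    · rintro ⟨rfl, h⟩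
      rw [h] at h0
      exact h0 hDab
  have hy0 : y = 0 := by
    refine (hA.mono hsub).eq_zero hm y fun i => Or.inr ?_
    simp only [D', add_mul, sum_add_distrib, ite_mul, zero_mul, sum_ite_eq', mem_univ, if_true, hy]
    split_ifs with h
    · have : t * (A a b * y b) = -1 := div_mul_cancel₀ _ hneg.ne
      linear_combination this
    · simp
  rw [hy0] at hneg
  simp at hneg

theorem sum_mul_sum_eq {D : R → C → ℝ} {g : R → ℝ} {s : C → ℝ}
    (hs : ∀ j, ∑ i, D i j * g i = s j) (u : C → ℝ) :
    ∑ i, g i * ∑ j, D i j * u j = ∑ j, s j * u j := by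
  simp only [mul_sum]
  rw [sum_comm]
  refine sum_congr rfl fun j _ => ?_
  rw [← hs, sum_mul]
  exact sum_congr rfl fun i _ => by ring

/-- The system `D y = v` where the rows `X` and `Xᶜ` communicate only through the two entries
`(r, n)` and `(r', c')`. -/
structure TwoChannel (D : R → C → ℝ) (a : R) (b : C) (X L : Finset R) (r r' : R) (c c' n : C)
    (f h : C → ℝ) (g g₂ : R → ℝ) (κ : ℝ) : Prop where
  row_mem : a ∈ X
  row₁ : r ∉ X ∪ L
  row₂ : r' ∉ X ∪ L
  row_ne : r ≠ r'
  kernel : ∀ u : C → ℝ, (∀ i ∈ X, ∑ j, D i j * u j = 0) →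
    ∃ l : ℝ, u c = l * f c ∧ u c' = l * f c'
  solution : ∀ u : C → ℝ, (∀ i ∈ X, ∑ j, D i j * u j = if i = a then 1 else 0) →
    ∃ l : ℝ, u c = h c + l * f c ∧ u c' = h c' + l * f c'
  transfer : ∀ u : C → ℝ, (∀ i ∈ L, i ≠ a → ∑ j, D i j * u j = 0) → u n = κ * u c
  supp : ∀ i ∈ X, g i = 0
  supp₂ : ∀ i ∈ X, g₂ i = 0
  sum : ∀ j, ∑ i, D i j * g i =
    (if j = n then D r n * g r else 0) + if j = c' then D r' c' * g r' else 0
  sum₂ : ∀ j, ∑ i, D i j * g₂ i =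
    (if j = n then D r n * g₂ r else 0) + (if j = c' then D r' c' * g₂ r' else 0) +
      if j = b then 1 else 0

variable {A D : R → C → ℝ} {a : R} {b : C} {X L : Finset R} {r r' : R} {c c' n : C}
    {f h : C → ℝ} {g g₂ : R → ℝ} {κ : ℝ}

theorem TwoChannel.pos (T : TwoChannel D a b X L r r' c c' n f h g g₂ κ)
    (hRC : Fintype.card R = Fintype.card C) (hA : SNSOn A univ univ)
    (hD : Sub D A) {σ : R → C}
    (hσ : IsMatching D univ univ σ)
    (h1 : D r n * g r * κ * f c ≠ 0) (h2 : D r' c' * g r' * f c' ≠ 0) :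
    0 < (D r n * g r * κ * f c) * (D r' c' * g r' * f c') := by
  by_contra hneg
  have hneg : (D r n * g r * κ * f c) * (D r' c' * g r' * f c') < 0 :=
    lt_of_le_of_ne (not_lt.1 hneg) (mul_ne_zero h1 h2)
  set P := D r n * g r * κ * f c with hP
  set P' := D r' c' * g r' * f c' with hP'
  set w : ℝ := -P' / P with hw
  have hwpos : 0 < w := by
    have : w = -(P * P') / (P * P) := by rw [hw]; field_simp
    rw [this]
    exact div_pos (by linarith) (mul_self_pos.2 h1)
  have hwP : w * P + P' = 0 := by rw [hw]; field_simp; ring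
  have hrX : r ∉ X := fun h => T.row₁ (mem_union_left _ h)
  have hrL : r ∉ L := fun h => T.row₁ (mem_union_right _ h)
  have hrX' : r' ∉ X := fun h => T.row₂ (mem_union_left _ h)
  have hrL' : r' ∉ L := fun h => T.row₂ (mem_union_right _ h)
  let E : R → C → ℝ := fun i j => D i j + if i = r then (if j = n then (w - 1) * D r n else 0) else 0
  have hE : ∀ i j, i ≠ r → E i j = D i j := fun i j hi => by simp [E, hi]
  have hE' : ∀ i j, ∃ m : ℝ, 0 < m ∧ E i j = m * D i j := by
    intro i j
    by_cases h : i = r ∧ j = n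
    · obtain ⟨rfl, rfl⟩ := h
      exact ⟨w, hwpos, by simp [E]; ring⟩
    · refine ⟨1, one_pos, ?_⟩
      by_cases hj : j = n <;> by_cases hi : i = r <;> simp_all [E]
  have hsub : Sub E A := by
    intro i j hd
    obtain ⟨m, hm, he⟩ := hE' i j
    rw [he] at hd ⊢
    rw [mul_assoc]
    exact mul_pos hm (hD i j (right_ne_zero_of_mul hd))
  have hm : IsMatching E univ univ σ := by
    refine ⟨by simp, hσ.injOn, fun i hi => ?_⟩
    obtain ⟨m, hm, he⟩ := hE' i (σ i)
    rw [he]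
    exact mul_ne_zero hm.ne' (hσ.ne_zero i hi)
  obtain ⟨y, hy⟩ := (hA.mono hsub).exists_solution hRC hm (fun i => if i = r' then 1 else 0)
  have hyD : ∀ i, i ≠ r → i ≠ r' → ∑ j, D i j * y j = 0 := by
    intro i hi hi'
    have := hy i
    simpa only [hE i _ hi, if_neg hi'] using this
  obtain ⟨l, hl, hl'⟩ := T.kernel y fun i hi =>
    hyD i (fun h => hrX (h ▸ hi)) (fun h => hrX' (h ▸ hi))
  have hk := T.transfer y fun i hi _ =>
    hyD i (fun h => hrL (h ▸ hi)) (fun h => hrL' (h ▸ hi))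
  have hs : ∀ j, ∑ i, E i j * g i =
      (if j = n then w * (D r n * g r) else 0) + if j = c' then D r' c' * g r' else 0 := by
    intro j
    simp only [E, add_mul, sum_add_distrib, T.sum, ite_mul, zero_mul, sum_ite_eq', mem_univ, if_true]
    by_cases hj : j = n <;> simp [hj]; ring
  have := sum_mul_sum_eq hs y
  simp only [hy, mul_ite, mul_one, mul_zero, sum_ite_eq', mem_univ, if_true, add_mul,
    sum_add_distrib, ite_mul, zero_mul] at this
  have hz : g r' = l * (w * P + P') := by
    rw [this, hk, hl, hl', hP, hP']; ring
  rw [hwP, mul_zero] at hz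
  exact h2 (by rw [hP', hz]; ring)

theorem TwoChannel.sign (T : TwoChannel D a b X L r r' c c' n f h g g₂ κ)
    (hRC : Fintype.card R = Fintype.card C) (hA : SNSOn A univ univ) (hab : A a b ≠ 0)
    (hD : Sub D A) (hDab : D a b = 0) {σ : R → C} (hσ : IsMatching D univ univ σ)
    (h1 : D r n * g r * κ * f c ≠ 0) (h2 : D r' c' * g r' * f c' ≠ 0) :
    A a b * (D r' c' * g r' * f c') * (g₂ r / g r - g₂ r' / g r') * (h c / f c - h c' / f c') ≤ 0 := by
  have hpos := T.pos hRC hA hD hσ h1 h2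
  obtain ⟨y, hy⟩ := (hA.mono hD).exists_solution hRC hσ (fun i => if i = a then 1 else 0)
  have hyb := nonneg_of_solution hA hab hD hDab hσ hy
  obtain ⟨l, hl, hl'⟩ := T.solution y fun i _ => hy i
  have hk := T.transfer y fun i _ hia => by rw [hy, if_neg hia]
  have e1 := sum_mul_sum_eq T.sum y
  have e2 := sum_mul_sum_eq T.sum₂ y
  simp only [hy, mul_ite, mul_one, mul_zero, sum_ite_eq', mem_univ, if_true, add_mul,
    sum_add_distrib, ite_mul, zero_mul, one_mul, T.supp a T.row_mem, T.supp₂ a T.row_mem] at e1 e2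
  have hgr : g r ≠ 0 := by rintro h; simp [h] at h1
  have hgr' : g r' ≠ 0 := by rintro h; simp [h] at h2
  have hfc : f c ≠ 0 := by rintro h; simp [h] at h1
  have hfc' : f c' ≠ 0 := by rintro h; simp [h] at h2
  set P := D r n * g r * κ * f c with hP
  set P' := D r' c' * g r' * f c' with hP'
  set G := g₂ r / g r - g₂ r' / g r' with hG
  set Hh := h c / f c - h c' / f c' with hHh
  have key : y b * (P + P') = - (P * P' * G * Hh) := by
    have hq : D r n * g₂ r = D r n * g r * (g₂ r / g r) := by field_simp
    have hq' : D r' c' * g₂ r' = D r' c' * g r' * (g₂ r' / g r') := by field_simp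
    have hh1 : h c = f c * (h c / f c) := by field_simp
    have hh2 : h c' = f c' * (h c' / f c') := by field_simp
    rw [hq, hq'] at e2
    rw [hk, hl, hl'] at e1 e2
    rw [hh1, hh2] at e1 e2
    generalize g₂ r / g r = γ at *
    generalize g₂ r' / g r' = γ' at *
    generalize h c / f c = η at *
    generalize h c' / f c' = η' at *
    have e1' : P * (η + l) + P' * (η' + l) = 0 := by rw [hP, hP']; linear_combination -e1
    have e2' : P * γ * (η + l) + P' * γ' * (η' + l) + y b = 0 := by
      rw [hP, hP']; linear_combination -e2
    rw [hG, hHh]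
    linear_combination (P + P') * e2' - (P * γ + P' * γ') * e1'
  have h3 : 0 < (P + P') * P' := by nlinarith [mul_self_nonneg P']
  have h4 : A a b * y b * ((P + P') * P') ≥ 0 := mul_nonneg hyb h3.le
  have h5 : A a b * y b * ((P + P') * P') = - ((P * P') * (A a b * P' * G * Hh)) := by
    linear_combination A a b * P' * key
  rw [h5] at h4
  by_contra hc
  push Not at hc
  have := mul_pos hpos hc
  linarith

end TwoChannel

section Cut

variable {R C : Type u} [Fintype R] [Fintype C] [DecidableEq R] [DecidableEq C]

/-- `B` arises from the sign-nonsingular, strongly connected square matrix `A` by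
deleting the entry `(a, b)`. -/
structure EdgeDeletion (A B : R → C → ℝ) (a : R) (b : C) : Prop where
  card_eq : Fintype.card R = Fintype.card C
  sns : SNSOn A univ univ
  exp : ExpOn 2 A univ univ
  ne_zero : A a b ≠ 0
  eq_ite : ∀ i j, B i j = if i = a ∧ j = b then 0 else A i j

/-- A zero block `X × Yᶜ` of size one less than the order of the square matrix `B`. -/
structure Tight (B : R → C → ℝ) (X : Finset R) (Y : Finset C) : Prop where
  nonempty : X.Nonempty
  compl_nonempty : Yᶜ.Nonempty
  card_eq : Y.card = X.card + 1
  eq_zero : ∀ i ∈ X, ∀ j, j ∉ Y → B i j = 0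

/-- `f` spans the kernel and `h` is a solution of the system `B u = e_a` on the block `X × Y`. -/
structure HalfVec (B : R → C → ℝ) (a : R) (X : Finset R) (Y : Finset C) (f h : C → ℝ) :
    Prop where
  f_supp : ∀ j, j ∉ Y → f j = 0
  f_ne_zero : f ≠ 0
  f_kernel : ∀ i ∈ X, ∑ j, B i j * f j = 0
  h_supp : ∀ j, j ∉ Y → h j = 0
  h_solution : ∀ i ∈ X, ∑ j, B i j * h j = if i = a then 1 else 0

variable {A B : R → C → ℝ} {a : R} {b : C}

theorem EdgeDeletion.symm (S : EdgeDeletion A B a b) :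
    EdgeDeletion (fun j i => A i j) (fun j i => B i j) b a where
  card_eq := S.card_eq.symm
  sns := S.sns.transpose (by simp [S.card_eq])
  exp := S.exp.transpose (by simp [S.card_eq])
  ne_zero := S.ne_zero
  eq_ite := fun j i => by simp only [S.eq_ite, and_comm]

theorem EdgeDeletion.eq_of_ne (S : EdgeDeletion A B a b) {i : R} {j : C} (h : B i j ≠ 0) :
    B i j = A i j := by
  rw [S.eq_ite] at h ⊢
  split_ifs at h ⊢
  · exact absurd rfl h
  · rfl

theorem EdgeDeletion.sub (S : EdgeDeletion A B a b) : Sub B A := by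
  intro i j h
  rw [← S.eq_of_ne h]
  exact mul_self_pos.2 h

theorem EdgeDeletion.snsB (S : EdgeDeletion A B a b) : SNSOn B univ univ := S.sns.mono S.sub

theorem EdgeDeletion.eq_of_row (S : EdgeDeletion A B a b) {i : R} (h : i ≠ a) (j : C) :
    B i j = A i j := by
  rw [S.eq_ite, if_neg (fun h' => h h'.1)]

theorem EdgeDeletion.eq_of_col (S : EdgeDeletion A B a b) {j : C} (h : j ≠ b) (i : R) :
    B i j = A i j := by
  rw [S.eq_ite, if_neg (fun h' => h h'.2)]

theorem EdgeDeletion.apply_self (S : EdgeDeletion A B a b) : B a b = 0 := by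
  rw [S.eq_ite, if_pos ⟨rfl, rfl⟩]

theorem EdgeDeletion.expB (S : EdgeDeletion A B a b) (hR : 3 ≤ Fintype.card R) :
    ExpOn 1 B univ univ := by
  intro P _ Q _ hP hQ h0
  rw [card_univ]
  by_cases hPa : (P.erase a).Nonempty
  · have := S.exp (P.erase a) (subset_univ _) Q (subset_univ _) hPa hQ (by
      intro i hi j hj
      rw [← S.eq_of_row (ne_of_mem_erase hi)]
      exact h0 i (mem_of_mem_erase hi) j hj)
    have h2 := P.pred_card_le_card_erase (a := a)
    rw [card_univ] at this
    omega
  by_cases hQb : (Q.erase b).Nonempty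
  · have := S.exp P (subset_univ _) (Q.erase b) (subset_univ _) hP hQb (by
      intro i hi j hj
      rw [← S.eq_of_col (ne_of_mem_erase hj)]
      exact h0 i hi j (mem_of_mem_erase hj))
    have h2 := Q.pred_card_le_card_erase (a := b)
    rw [card_univ] at this
    omega
  rw [not_nonempty_iff_eq_empty] at hPa hQb
  have h1 := P.pred_card_le_card_erase (a := a)
  have h2 := Q.pred_card_le_card_erase (a := b)
  rw [hPa, card_empty] at h1
  rw [hQb, card_empty] at h2
  omega

theorem Tight.symm {X : Finset R} {Y : Finset C} (T : Tight B X Y)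
    (hRC : Fintype.card R = Fintype.card C) : Tight (fun j i => B i j) Yᶜ Xᶜ where
  nonempty := T.compl_nonempty
  compl_nonempty := by rw [compl_compl]; exact T.nonempty
  card_eq := by
    have h1 := T.card_eq
    have h2 := card_le_univ Y
    rw [card_compl, card_compl]
    omega
  eq_zero := fun j hj i hi => by
    simp only [mem_compl, not_not] at hi hj
    exact T.eq_zero i hi j hj

theorem notMem_of_card_le {σ : R → C} (hσ : Function.Injective σ) {Z : Finset R} {Y : Finset C}
    (hZ : ∀ i ∈ Z, σ i ∈ Y) (hc : Y.card ≤ Z.card) {i : R} (hi : i ∉ Z) : σ i ∉ Y := by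
  have : Z.image σ = Y := by
    refine eq_of_subset_of_card_le (image_subset_iff.2 hZ) ?_
    rwa [card_image_of_injective _ hσ]
  rw [← this, mem_image]
  rintro ⟨i', hi', h⟩
  exact hi (hσ h ▸ hi')

theorem Tight.matching_mem {X : Finset R} {Y : Finset C} (T : Tight B X Y) {σ : R → C}
    (hσ : IsMatching B univ univ σ) {i : R} (hi : i ∈ X) : σ i ∈ Y := by
  by_contra h
  exact hσ.ne_zero i (mem_univ _) (T.eq_zero i hi _ h)

theorem Tight.matching_notMem {X : Finset R} {Y : Finset C} (T : Tight B X Y) {σ : R → C}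
    (hσ : IsMatching B univ univ σ) {r : R} (hr : r ∉ X) (hc : σ r ∈ Y) {i : R} (hi : i ∉ X)
    (hir : i ≠ r) : σ i ∉ Y := by
  refine notMem_of_card_le hσ.injective (Z := insert r X) ?_ ?_ ?_
  · intro i hi
    rw [mem_insert] at hi
    rcases hi with rfl | hi
    · exact hc
    · exact T.matching_mem hσ hi
  · rw [card_insert_of_notMem hr, T.card_eq]
  · simp [hi, hir]

theorem Tight.mem (S : EdgeDeletion A B a b) {X : Finset R} {Y : Finset C} (T : Tight B X Y) :
    a ∈ X ∧ b ∉ Y := by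
  have h : ¬ ∀ i ∈ X, ∀ j ∈ Yᶜ, A i j = 0 := by
    intro h0
    have := S.exp X (subset_univ _) Yᶜ (subset_univ _) T.nonempty T.compl_nonempty h0
    have h1 := T.card_eq
    have h2 := card_le_univ Y
    have h3 := S.card_eq
    rw [card_univ, card_compl] at this
    omega
  push Not at h
  obtain ⟨i, hi, j, hj, hij⟩ := h
  rw [mem_compl] at hj
  have h0 := T.eq_zero i hi j hj
  rw [S.eq_ite] at h0
  split_ifs at h0 with h1
  · rw [← h1.1, ← h1.2]; exact ⟨hi, hj⟩
  · exact absurd h0 hij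

theorem exists_halfVec (hB : SNSOn B univ univ) (hE : ExpOn 1 B univ univ)
    (hRC : Fintype.card R = Fintype.card C) {X : Finset R} {Y : Finset C} (T : Tight B X Y) (a : R) :
    ∃ f h, HalfVec B a X Y f h := by
  obtain ⟨σ, hσ, -⟩ := (hE.mono (Nat.zero_le 1)).exists_matching hRC ∅ (fun i => T.compl_nonempty.choose)
    ⟨by simp, by simp, by simp⟩ rfl
  obtain ⟨y, hy⟩ := hB.exists_solution hRC hσ (fun i => if i = a then 1 else 0)
  have hext : ∀ (x : C → ℝ) i, i ∈ X → ∑ j, B i j * (if j ∈ Y then x j else 0) = ∑ j, B i j * x j := by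
    intro x i hi
    refine sum_congr rfl fun j _ => ?_
    split_ifs with hj
    · rfl
    · rw [T.eq_zero i hi j hj]; simp
  let φ : (Y → ℝ) →ₗ[ℝ] (X → ℝ) := Matrix.mulVecLin (Matrix.of (block B X Y))
  have hker : LinearMap.ker φ ≠ ⊥ := by
    refine LinearMap.ker_ne_bot_of_finrank_lt ?_
    simp [T.card_eq]
  obtain ⟨x, hx, hx0⟩ := (Submodule.ne_bot_iff _).1 hker
  obtain ⟨j0, hj0⟩ := Function.ne_iff.1 hx0
  refine ⟨fun j => if h : j ∈ Y then x ⟨j, h⟩ else 0, fun j => if j ∈ Y then y j else 0,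
    fun j hj => by simp [hj], ?_, ?_, fun j hj => by simp [hj], ?_⟩
  · intro h
    apply hj0
    have := congrFun h j0
    simpa using this
  · intro i hi
    have h1 : ∑ j : Y, B i j * x j = 0 := congrFun (LinearMap.mem_ker.1 hx) ⟨i, hi⟩
    rw [← sum_subset (subset_univ Y) (fun j _ hj => by simp [hj]), ← sum_coe_sort Y, ← h1]
    exact sum_congr rfl fun j _ => by simp
  · intro i hi
    rw [hext y i hi, hy]

theorem sum_eq_of_supp {X : Finset R} {Y : Finset C} (T : Tight B X Y) {u v : C → ℝ}
    (huv : ∀ j ∈ Y, u j = v j) {i : R} (hi : i ∈ X) : ∑ j, B i j * u j = ∑ j, B i j * v j := by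
  refine sum_congr rfl fun j _ => ?_
  by_cases hj : j ∈ Y
  · rw [huv j hj]
  · rw [T.eq_zero i hi j hj, zero_mul, zero_mul]

theorem Tight.eq_zero_of_kernel (hB : SNSOn B univ univ) (hE : ExpOn 1 B univ univ)
    (hRC : Fintype.card R = Fintype.card C) {X : Finset R} {Y : Finset C} (T : Tight B X Y)
    {u : C → ℝ} (hu : ∀ j, j ∉ Y → u j = 0) (hu0 : ∀ i ∈ X, ∑ j, B i j * u j = 0)
    {r : R} {c : C} (hr : r ∉ X) (hc : c ∈ Y) (hrc : B r c ≠ 0) (huc : u c = 0) : u = 0 := by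
  obtain ⟨σ, hσ, hσr⟩ := hE.exists_matching_one hRC hrc
  refine hB.eq_zero hσ u fun i => ?_
  by_cases hi : i ∈ X
  · exact Or.inr (hu0 i hi)
  left
  by_cases hir : i = r
  · rw [hir, hσr, huc]
  · exact hu _ (T.matching_notMem hσ hr (hσr.symm ▸ hc) hi hir)

theorem Tight.eq_zero_of_kernel_erase (S : EdgeDeletion A B a b) {X : Finset R} {Y : Finset C}
    (T : Tight B X Y) {u : C → ℝ} (hu : ∀ j, j ∉ Y → u j = 0)
    (hu0 : ∀ i ∈ X, i ≠ a → ∑ j, B i j * u j = 0)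
    {r r' : R} {c c' : C} (hr : r ∉ X) (hc : c ∈ Y) (hrc : B r c ≠ 0) (huc : u c = 0)
    (hr' : r' ∉ X) (hc' : c' ∈ Y) (hrc' : B r' c' ≠ 0) (huc' : u c' = 0)
    (hrr : r ≠ r') (hcc : c ≠ c') : u = 0 := by
  obtain ⟨ha, hb⟩ := T.mem S
  obtain ⟨σ, hσ, hσr, hσr'⟩ := S.exp.exists_matching_two S.card_eq (S.sub.ne_zero hrc)
    (S.sub.ne_zero hrc') hrr hcc
  refine S.sns.eq_zero hσ u fun i => ?_
  by_cases hi : i ∈ X ∧ i ≠ a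
  · right
    rw [← hu0 i hi.1 hi.2]
    exact sum_congr rfl fun j _ => by rw [S.eq_of_row hi.2]
  left
  by_cases hir : i = r
  · rw [hir, hσr, huc]
  by_cases hir' : i = r'
  · rw [hir', hσr', huc']
  refine hu _ (notMem_of_card_le hσ.injective (Z := insert r (insert r' (X.erase a))) ?_ ?_ ?_)
  · intro i hi
    simp only [mem_insert] at hi
    rcases hi with rfl | rfl | hi
    · rwa [hσr]
    · rwa [hσr']
    · by_contra h
      have := T.eq_zero i (mem_of_mem_erase hi) _ h
      rw [S.eq_of_row (ne_of_mem_erase hi)] at this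
      exact hσ.ne_zero i (mem_univ _) this
  · rw [card_insert_of_notMem, card_insert_of_notMem, card_erase_of_mem ha, T.card_eq]
    · have := card_pos.2 T.nonempty; omega
    · simp [hr']
    · simp [hr, hrr]
  · simp only [mem_insert, mem_erase, not_or, not_and]
    exact ⟨hir, hir', fun h h' => hi ⟨h', h⟩⟩

section Half

variable {X : Finset R} {Y : Finset C} {f h : C → ℝ}

theorem HalfVec.f_ne_zero_of_edge (V : HalfVec B a X Y f h) (hB : SNSOn B univ univ)
    (hE : ExpOn 1 B univ univ) (hRC : Fintype.card R = Fintype.card C) (T : Tight B X Y)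
    {r : R} {c : C} (hr : r ∉ X) (hc : c ∈ Y) (hrc : B r c ≠ 0) : f c ≠ 0 := fun h0 =>
  V.f_ne_zero (T.eq_zero_of_kernel hB hE hRC V.f_supp V.f_kernel hr hc hrc h0)

theorem HalfVec.kernel (V : HalfVec B a X Y f h) (hB : SNSOn B univ univ)
    (hE : ExpOn 1 B univ univ) (hRC : Fintype.card R = Fintype.card C) (T : Tight B X Y)
    {r : R} {c : C} (hr : r ∉ X) (hc : c ∈ Y) (hrc : B r c ≠ 0) {u : C → ℝ}
    (hu : ∀ i ∈ X, ∑ j, B i j * u j = 0) : ∀ j ∈ Y, u j = u c / f c * f j := by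
  have hfc := V.f_ne_zero_of_edge hB hE hRC T hr hc hrc
  have := T.eq_zero_of_kernel hB hE hRC
    (u := fun j => (if j ∈ Y then u j else 0) - u c / f c * f j) ?_ ?_ hr hc hrc ?_
  · intro j hj
    have := congrFun this j
    simp only [hj, if_true, Pi.zero_apply] at this
    linarith
  · intro j hj
    simp [hj, V.f_supp j hj]
  · intro i hi
    simp only [mul_sub, sum_sub_distrib]
    have h1 : ∑ j, B i j * (if j ∈ Y then u j else 0) = 0 := by
      rw [← hu i hi]
      exact sum_eq_of_supp T (fun j hj => by simp [hj]) hi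
    have h2 : ∑ j, B i j * (u c / f c * f j) = u c / f c * ∑ j, B i j * f j := by
      rw [mul_sum]; exact sum_congr rfl fun j _ => by ring
    rw [h1, h2, V.f_kernel i hi]; simp
  · simp [hc, hfc]

theorem HalfVec.strict (V : HalfVec B a X Y f h) (S : EdgeDeletion A B a b)
    (hE : ExpOn 1 B univ univ) (T : Tight B X Y)
    {r r' : R} {c c' : C} (hr : r ∉ X) (hc : c ∈ Y) (hrc : B r c ≠ 0)
    (hr' : r' ∉ X) (hc' : c' ∈ Y) (hrc' : B r' c' ≠ 0)
    (hrr : r ≠ r') (hcc : c ≠ c') : h c / f c ≠ h c' / f c' := by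
  intro heq
  have hfc := V.f_ne_zero_of_edge S.snsB hE S.card_eq T hr hc hrc
  have hfc' := V.f_ne_zero_of_edge S.snsB hE S.card_eq T hr' hc' hrc'
  have hsum : ∀ i ∈ X, ∑ j, B i j * (h j - h c / f c * f j) = if i = a then 1 else 0 := by
    intro i hi
    simp only [mul_sub, sum_sub_distrib]
    have h2 : ∑ j, B i j * (h c / f c * f j) = h c / f c * ∑ j, B i j * f j := by
      rw [mul_sum]; exact sum_congr rfl fun j _ => by ring
    rw [h2, V.f_kernel i hi, V.h_solution i hi]; simp
  have := T.eq_zero_of_kernel_erase S (u := fun j => h j - h c / f c * f j) ?_ ?_ hr hc hrc ?_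
    hr' hc' hrc' ?_ hrr hcc
  · have h1 := hsum a (T.mem S).1
    simp only [if_true] at h1
    have h2 : ∀ j, h j - h c / f c * f j = 0 := fun j => congrFun this j
    simp [h2] at h1
  · intro j hj
    simp [V.f_supp j hj, V.h_supp j hj]
  · intro i hi hia
    rw [hsum i hi, if_neg hia]
  · rw [div_mul_cancel₀ _ hfc, sub_self]
  · rw [heq, div_mul_cancel₀ _ hfc', sub_self]

end Half

end Cut

section Channel

variable {R C : Type u} [Fintype R] [Fintype C] [DecidableEq R] [DecidableEq C]
variable {A B D : R → C → ℝ} {a : R} {b : C}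

theorem sum_channel {X : Finset R} {Y : Finset C} {r r' : R} {c n : C}
    (hD₁ : ∀ i, i ∉ X → ∀ j, j ∉ Y → D i j = B i j)
    (hD₂ : ∀ i, i ∉ X → ∀ j ∈ Y, ¬ (i = r ∧ j = n) → ¬ (i = r' ∧ j = c) → D i j = 0)
    (hrr : r ≠ r') (hn : n ∈ Y) (hc : c ∈ Y) {g : R → ℝ}
    (hg : ∀ i ∈ X, g i = 0) {s : C → ℝ} (hs : ∀ j, j ∉ Y → ∑ i, B i j * g i = s j)
    (hs' : ∀ j ∈ Y, s j = 0) (j : C) :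
    ∑ i, D i j * g i = (if j = n then D r n * g r else 0) +
      (if j = c then D r' c * g r' else 0) + s j := by
  by_cases hj : j ∈ Y
  · rw [hs' j hj, add_zero]
    have : ∀ i, D i j * g i = (if i = r then if j = n then D r n * g r else 0 else 0) +
        if i = r' then if j = c then D r' c * g r' else 0 else 0 := by
      intro i
      by_cases hi : i ∈ X
      · have hgi := hg i hi
        rw [hgi, mul_zero]
        by_cases h1 : i = r
        · have h2 : i ≠ r' := fun h => hrr (h1.symm.trans h)
          simp [h1 ▸ hgi, h2]
        · by_cases h2 : i = r'
          · simp [h1, h2 ▸ hgi]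
          · simp [h1, h2]
      · by_cases h1 : i = r
        · have h2 : i ≠ r' := fun h => hrr (h1.symm.trans h)
          by_cases h3 : j = n
          · simp [h1, h3, hrr]
          · have := hD₂ i hi j hj (fun h => h3 h.2) (fun h => h2 h.1)
            rw [this]; simp [h2, h3]
        · by_cases h2 : i = r'
          · by_cases h3 : j = c
            · simp [h2, h3, hrr.symm]
            · have := hD₂ i hi j hj (fun h => h1 h.1) (fun h => h3 h.2)
              rw [this]; simp [h1, h3]
          · have := hD₂ i hi j hj (fun h => h1 h.1) (fun h => h2 h.1)
            rw [this]; simp [h1, h2]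
    rw [sum_congr rfl fun i _ => this i, sum_add_distrib]
    simp
  · have h1 : j ≠ n := fun h => hj (h ▸ hn)
    have h2 : j ≠ c := fun h => hj (h ▸ hc)
    rw [if_neg h1, if_neg h2, zero_add, zero_add, ← hs j hj]
    refine sum_congr rfl fun i _ => ?_
    by_cases hi : i ∈ X
    · rw [hg i hi, mul_zero, mul_zero]
    · rw [hD₁ i hi j hj]

theorem twoChannel_of_halfVec (S : EdgeDeletion A B a b) (hE : ExpOn 1 B univ univ)
    {X X' : Finset R} {Y Y' : Finset C} {f h : C → ℝ} {g g₂ : R → ℝ}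
    (T : Tight B X Y) (T' : Tight B X' Y') (V : HalfVec B a X Y f h)
    (W : HalfVec (fun j i => B i j) b Y'ᶜ X'ᶜ g g₂) (hXX : X ⊆ X')
    (hDX : ∀ i ∈ X, ∀ j, D i j = B i j)
    {r r' ρ : R} {c c' n : C}
    (hD₁ : ∀ i, i ∉ X' → ∀ j, j ∉ Y' → D i j = B i j)
    (hD₂ : ∀ i, i ∉ X' → ∀ j ∈ Y', ¬ (i = r ∧ j = n) → ¬ (i = r' ∧ j = c') → D i j = 0)
    (hr : r ∉ X') (hr' : r' ∉ X') (hrr : r ≠ r') (hn : n ∈ Y') (hcY' : c' ∈ Y')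
    (hρ : ρ ∉ X) (hc : c ∈ Y) (hc' : c' ∈ Y) (hρc : B ρ c ≠ 0) {κ : ℝ}
    (hκ : ∀ u : C → ℝ, (∀ i ∈ X' \ X, i ≠ a → ∑ j, D i j * u j = 0) → u n = κ * u c) :
    TwoChannel D a b X (X' \ X) r r' c c' n f h g g₂ κ := by
  have hfc := V.f_ne_zero_of_edge S.snsB hE S.card_eq T hρ hc hρc
  have hgX : ∀ i ∈ X', g i = 0 := fun i hi => W.f_supp i (by simpa using hi)
  have hgX₂ : ∀ i ∈ X', g₂ i = 0 := fun i hi => W.h_supp i (by simpa using hi)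
  have hbY : b ∉ Y' := (T'.mem S).2
  refine ⟨(T.mem S).1, ?_, ?_, hrr, fun u hu => ?_, fun u hu => ?_, hκ,
    fun i hi => hgX i (hXX hi), fun i hi => hgX₂ i (hXX hi), fun j => ?_, fun j => ?_⟩
  · rwa [union_sdiff_of_subset hXX]
  · rwa [union_sdiff_of_subset hXX]
  · have := V.kernel S.snsB hE S.card_eq T hρ hc hρc (u := u) fun i hi => by
      rw [← hu i hi]; exact sum_congr rfl fun j _ => by rw [hDX i hi]
    exact ⟨_, this c hc, this c' hc'⟩
  · have := V.kernel S.snsB hE S.card_eq T hρ hc hρc (u := fun j => u j - h j) fun i hi => by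
      simp only [mul_sub, sum_sub_distrib]
      rw [V.h_solution i hi, ← hu i hi, sub_eq_zero]
      exact sum_congr rfl fun j _ => by rw [hDX i hi]
    exact ⟨(u c - h c) / f c, by linear_combination this c hc, by linear_combination this c' hc'⟩
  · have := sum_channel (s := fun _ => 0) hD₁ hD₂ hrr hn hcY' hgX
      (fun j hj => W.f_kernel j (by simpa using hj)) (fun _ _ => rfl) j
    rw [this, add_zero]
  · exact sum_channel (s := fun j => if j = b then 1 else 0) hD₁ hD₂ hrr hn hcY' hgX₂
      (fun j hj => W.h_solution j (by simpa using hj))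
      (fun j hj => if_neg (ne_of_mem_of_not_mem hj hbY)) j

/-- The submatrix of `B` that keeps exactly the entries satisfying `p`. -/
noncomputable def keep (B : R → C → ℝ) (p : R → C → Prop) : R → C → ℝ := by
  classical exact fun i j => if p i j then B i j else 0

theorem keep_of {p : R → C → Prop} {i : R} {j : C} (h : p i j) : keep B p i j = B i j := by
  simp [keep, h]

theorem keep_of_not {p : R → C → Prop} {i : R} {j : C} (h : ¬ p i j) : keep B p i j = 0 := by
  simp [keep, h]

theorem sub_keep (p : R → C → Prop) : Sub (keep B p) B := by
  intro i j h
  by_cases hp : p i j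
  · rw [keep_of hp] at h ⊢; exact mul_self_pos.2 h
  · exact absurd (keep_of_not hp) h

variable {X : Finset R} {Y : Finset C} {f h : C → ℝ} {g g₂ : R → ℝ}

theorem cut_sign_of_ne (S : EdgeDeletion A B a b) (hE : ExpOn 1 B univ univ)
    (T : Tight B X Y) (V : HalfVec B a X Y f h)
    (W : HalfVec (fun j i => B i j) b Yᶜ Xᶜ g g₂) {r r' : R} {c c' : C}
    (hr : r ∉ X) (hc : c ∈ Y) (hrc : B r c ≠ 0) (hr' : r' ∉ X) (hc' : c' ∈ Y)
    (hrc' : B r' c' ≠ 0) (hrr : r ≠ r') :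
    0 < (B r c * g r * f c) * (B r' c' * g r' * f c') ∧
    A a b * (B r' c' * g r' * f c') * (g₂ r / g r - g₂ r' / g r') * (h c / f c - h c' / f c') ≤ 0 := by
  have hfc := V.f_ne_zero_of_edge S.snsB hE S.card_eq T hr hc hrc
  have hfc' := V.f_ne_zero_of_edge S.snsB hE S.card_eq T hr' hc' hrc'
  have hEt := hE.transpose (by simp [S.card_eq])
  have hgr := W.f_ne_zero_of_edge S.symm.snsB hEt S.symm.card_eq (T.symm S.card_eq)
    (r := c) (c := r) (by simpa using hc) (by simpa using hr) hrc
  have hgr' := W.f_ne_zero_of_edge S.symm.snsB hEt S.symm.card_eq (T.symm S.card_eq)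
    (r := c') (c := r') (by simpa using hc') (by simpa using hr') hrc'
  set p : R → C → Prop := fun i j => i ∈ X ∨ j ∉ Y ∨ (i = r ∧ j = c) ∨ (i = r' ∧ j = c') with hp
  have hDr : keep B p r c = B r c := keep_of (by simp [hp])
  have hDr' : keep B p r' c' = B r' c' := keep_of (by simp [hp])
  have TC : TwoChannel (keep B p) a b X (X \ X) r r' c c' c f h g g₂ 1 := by
    refine twoChannel_of_halfVec S hE T T V W (Subset.refl _) ?_ ?_ ?_ hr hr' hrr hc hc' hr hc hc'
      hrc (by simp)
    · exact fun i hi j => keep_of (by simp [hp, hi])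
    · exact fun i hi j hj => keep_of (by simp [hp, hj])
    · intro i hi j hj h1 h2
      exact keep_of_not (by simp only [hp, hi, hj, h1, h2]; tauto)
  obtain ⟨σ, hσ, hσr⟩ := hE.exists_matching_one S.card_eq hrc
  have hσD : IsMatching (keep B p) univ univ σ := by
    refine ⟨by simp, hσ.injOn, fun i hi => ?_⟩
    rw [keep_of]
    · exact hσ.ne_zero i hi
    · by_cases hiX : i ∈ X
      · exact Or.inl hiX
      by_cases hir : i = r
      · exact Or.inr (Or.inr (Or.inl ⟨hir, hir ▸ hσr⟩))
      · exact Or.inr (Or.inl (T.matching_notMem hσ hr (hσr.symm ▸ hc) hiX hir))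
  have hsub := (sub_keep (B := B) p).trans S.sub
  have h1 : keep B p r c * g r * 1 * f c ≠ 0 := by
    rw [hDr]; exact mul_ne_zero (mul_ne_zero (mul_ne_zero hrc hgr) one_ne_zero) hfc
  have h2 : keep B p r' c' * g r' * f c' ≠ 0 := by
    rw [hDr']; exact mul_ne_zero (mul_ne_zero hrc' hgr') hfc'
  have hab : keep B p a b = 0 := by
    by_contra hne
    exact (sub_keep p).ne_zero hne S.apply_self
  have r1 := TC.pos S.card_eq S.sns hsub hσD h1 h2
  have r2 := TC.sign S.card_eq S.sns S.ne_zero hsub hab hσD h1 h2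
  rw [hDr, hDr', mul_one] at r1
  rw [hDr'] at r2
  exact ⟨r1, r2⟩

theorem cut_sign (S : EdgeDeletion A B a b) (hE : ExpOn 1 B univ univ)
    (T : Tight B X Y) (V : HalfVec B a X Y f h)
    (W : HalfVec (fun j i => B i j) b Yᶜ Xᶜ g g₂) {r r' : R} {c c' : C}
    (hr : r ∉ X) (hc : c ∈ Y) (hrc : B r c ≠ 0) (hr' : r' ∉ X) (hc' : c' ∈ Y)
    (hrc' : B r' c' ≠ 0) :
    0 < (B r c * g r * f c) * (B r' c' * g r' * f c') := by
  by_cases hrr : r = r'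
  · by_cases hcc : c = c'
    · subst hrr hcc
      have hfc := V.f_ne_zero_of_edge S.snsB hE S.card_eq T hr hc hrc
      have hEt := hE.transpose (by simp [S.card_eq])
      have hgr := W.f_ne_zero_of_edge S.symm.snsB hEt S.symm.card_eq (T.symm S.card_eq)
        (r := c) (c := r) (by simpa using hc) (by simpa using hr) hrc
      exact mul_self_pos.2 (mul_ne_zero (mul_ne_zero hrc hgr) hfc)
    · have hEt := hE.transpose (by simp [S.card_eq])
      have V' : HalfVec (fun i j => B i j) a Xᶜᶜ Yᶜᶜ f h := by simpa using V
      have := (cut_sign_of_ne S.symm hEt (T.symm S.card_eq) W V' (r := c) (r' := c') (c := r)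
        (c' := r') (by simpa using hc) (by simpa using hr) hrc (by simpa using hc')
        (by simpa using hr') hrc' hcc).1
      calc (0:ℝ) < _ := this
        _ = _ := by ring
  · exact (cut_sign_of_ne S hE T V W hr hc hrc hr' hc' hrc' hrr).1

theorem cut_order (S : EdgeDeletion A B a b) (hE : ExpOn 1 B univ univ) (T : Tight B X Y) :
    ∃ (γ : R → ℝ) (η : C → ℝ), ∀ r r' c c', r ∉ X → c ∈ Y → B r c ≠ 0 → r' ∉ X → c' ∈ Y →
      B r' c' ≠ 0 → r ≠ r' → c ≠ c' → 0 < (γ r - γ r') * (η c - η c') := by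
  by_cases hex : ∃ r c, r ∉ X ∧ c ∈ Y ∧ B r c ≠ 0
  swap
  · push Not at hex
    exact ⟨fun _ => 0, fun _ => 0, fun r r' c c' h1 h2 h3 => absurd (hex r c h1 h2) h3⟩
  obtain ⟨r₀, c₀, h₀r, h₀c, h₀⟩ := hex
  have hEt := hE.transpose (by simp [S.card_eq])
  obtain ⟨f, h, V⟩ := exists_halfVec S.snsB hE S.card_eq T a
  obtain ⟨g, g₂, W⟩ := exists_halfVec S.symm.snsB hEt S.symm.card_eq (T.symm S.card_eq) b
  refine ⟨fun r => - (A a b * (B r₀ c₀ * g r₀ * f c₀)) * (g₂ r / g r), fun c => h c / f c, ?_⟩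
  intro r r' c c' hr hc hrc hr' hc' hrc' hrr hcc
  have h1 := (cut_sign_of_ne S hE T V W hr hc hrc hr' hc' hrc' hrr).2
  have h2 := cut_sign S hE T V W h₀r h₀c h₀ hr' hc' hrc'
  have h3 := V.strict S hE T hr hc hrc hr' hc' hrc' hrr hcc
  have h4 := W.strict S.symm hEt (T.symm S.card_eq) (r := c) (r' := c') (c := r) (c' := r')
    (by simpa using hc) (by simpa using hr) hrc (by simpa using hc') (by simpa using hr') hrc'
    hcc hrr
  have h5 := S.ne_zero
  beta_reduce
  generalize B r₀ c₀ * g r₀ * f c₀ = P at *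
  generalize B r' c' * g r' * f c' = P' at *
  generalize g₂ r / g r = γ at *
  generalize g₂ r' / g r' = γ' at *
  generalize h c / f c = η at *
  generalize h c' / f c' = η' at *
  have hP' : P' ≠ 0 := by rintro rfl; simp at h2
  have h6 : A a b * P' * (γ - γ') * (η - η') < 0 :=
    lt_of_le_of_ne h1 (mul_ne_zero (mul_ne_zero (mul_ne_zero h5 hP') (sub_ne_zero.2 h4))
      (sub_ne_zero.2 h3))
  have h7 : 0 < (P * P') * -(A a b * P' * (γ - γ') * (η - η')) := mul_pos h2 (by linarith)
  have h8 : (P * P') * -(A a b * P' * (γ - γ') * (η - η')) =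
      (-(A a b * P) * γ - -(A a b * P) * γ') * (η - η') * (P' * P') := by ring
  rw [h8] at h7
  exact pos_of_mul_pos_left h7 (mul_self_nonneg _)

theorem card_add_one_le_of_order {γ : R → ℝ} {η : C → ℝ} (F : Finset (R × C)) :
    F.Nonempty →
    (∀ p ∈ F, ∀ q ∈ F, p.1 ≠ q.1 → p.2 ≠ q.2 → 0 < (γ p.1 - γ q.1) * (η p.2 - η q.2)) →
    F.card + 1 ≤ (F.image Prod.fst).card + (F.image Prod.snd).card := by
  induction F using Finset.strongInduction with
  | H F ih =>
    intro hne hF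
    obtain ⟨p, hp, hmin⟩ := F.exists_min_image (fun p => γ p.1 + η p.2) hne
    by_cases hF1 : (F.erase p).Nonempty
    swap
    · rw [not_nonempty_iff_eq_empty] at hF1
      have h1 : F = {p} := by
        rw [← insert_erase hp, hF1]; rfl
      rw [h1]; simp
    have h1 := ih (F.erase p) (erase_ssubset hp) hF1
      (fun q hq q' hq' => hF q (mem_of_mem_erase hq) q' (mem_of_mem_erase hq'))
    have h2 := card_erase_of_mem hp
    have h3 := card_pos.2 hne
    have h4 : (((F.erase p).image Prod.fst)).card ≤ (F.image Prod.fst).card :=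
      card_le_card (image_subset_image (erase_subset _ _))
    have h5 : (((F.erase p).image Prod.snd)).card ≤ (F.image Prod.snd).card :=
      card_le_card (image_subset_image (erase_subset _ _))
    by_cases h6 : p.1 ∈ (F.erase p).image Prod.fst
    · by_cases h7 : p.2 ∈ (F.erase p).image Prod.snd
      · exfalso
        obtain ⟨q, hq, hqp⟩ := mem_image.1 h6
        obtain ⟨q', hq', hqp'⟩ := mem_image.1 h7
        have hqF := mem_of_mem_erase hq
        have hqF' := mem_of_mem_erase hq'
        have hne1 : q.2 ≠ p.2 := fun h => ne_of_mem_erase hq (Prod.ext hqp h)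
        have hne2 : q'.1 ≠ p.1 := fun h => ne_of_mem_erase hq' (Prod.ext h hqp')
        have h8 := hF q hqF q' hqF' (by rw [hqp]; exact hne2.symm) (by rw [hqp']; exact hne1)
        have h9 := hmin q hqF
        have h10 := hmin q' hqF'
        rw [hqp] at h8 h9
        rw [hqp'] at h8 h10
        nlinarith
      · have : (((F.erase p).image Prod.snd)).card < (F.image Prod.snd).card :=
          card_lt_card ⟨image_subset_image (erase_subset _ _),
            fun h => h7 (h (mem_image_of_mem _ hp))⟩
        omega
    · have : (((F.erase p).image Prod.fst)).card < (F.image Prod.fst).card :=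
        card_lt_card ⟨image_subset_image (erase_subset _ _),
          fun h => h6 (h (mem_image_of_mem _ hp))⟩
      omega

end Channel

section Overlap

variable {R C : Type u} [Fintype R] [Fintype C] [DecidableEq R] [DecidableEq C]
variable {A B : R → C → ℝ} {a : R} {b : C} {X X' : Finset R} {Y Y' : Finset C}

theorem Tight.exists_row (hE : ExpOn 1 B univ univ) (hRC : Fintype.card R = Fintype.card C)
    (T : Tight B X Y) {j : C} (hj : j ∈ Y) : ∃ i ∈ X, B i j ≠ 0 := by
  by_contra hcon
  push Not at hcon
  have := hE X (subset_univ _) (insert j Yᶜ) (subset_univ _) T.nonempty (insert_nonempty _ _) (by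
    intro i hi k hk
    rw [mem_insert, mem_compl] at hk
    rcases hk with rfl | hk
    · exact hcon i hi
    · exact T.eq_zero i hi k hk)
  rw [card_insert_of_notMem (by simpa using hj), card_compl, card_univ] at this
  have h1 := T.card_eq
  have h2 := card_le_univ Y
  omega

theorem Tight.subset (hE : ExpOn 1 B univ univ) (hRC : Fintype.card R = Fintype.card C)
    (T : Tight B X Y) (T' : Tight B X' Y') (h : X ⊆ X') : Y ⊆ Y' := by
  intro j hj
  obtain ⟨i, hi, hij⟩ := T.exists_row hE hRC hj
  by_contra hj'
  exact hij (T'.eq_zero i (h hi) j hj')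

/-- `X'` is a minimal tight row set above `X`. -/
def IsNext (B : R → C → ℝ) (X X' : Finset R) : Prop :=
  X ⊂ X' ∧ ∀ X'' Y'', Tight B X'' Y'' → X ⊂ X'' → X'' ⊆ X' → X'' = X'

theorem Tight.expOn_between (hE : ExpOn 1 B univ univ) (hRC : Fintype.card R = Fintype.card C)
    (T : Tight B X Y) (T' : Tight B X' Y') (hX : IsNext B X X') :
    ExpOn 1 B (X' \ X) (Y' \ Y) := by
  intro P hP Q hQ hPn hQn h0
  by_contra hlt
  have hYY := T.subset hE hRC T' hX.1.1
  have hdXP : Disjoint X P := Finset.disjoint_left.2 fun i hi hi' => (mem_sdiff.1 (hP hi')).2 hi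
  have hdYQ : Disjoint Y'ᶜ Q := Finset.disjoint_left.2 fun i hi hi' =>
    (mem_compl.1 hi) (mem_sdiff.1 (hQ hi')).1
  have hz : ∀ i ∈ X ∪ P, ∀ j ∈ Y'ᶜ ∪ Q, B i j = 0 := by
    intro i hi j hj
    rw [mem_union] at hi hj
    rcases hi with hi | hi
    · refine T.eq_zero i hi j ?_
      rcases hj with hj | hj
      · exact fun h => (mem_compl.1 hj) (hYY h)
      · exact (mem_sdiff.1 (hQ hj)).2
    · rcases hj with hj | hj
      · exact T'.eq_zero i (mem_sdiff.1 (hP hi)).1 j (mem_compl.1 hj)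
      · exact h0 i hi j hj
  have h1 := hE (X ∪ P) (subset_univ _) (Y'ᶜ ∪ Q) (subset_univ _) (T.nonempty.mono subset_union_left)
    (T'.compl_nonempty.mono subset_union_left) hz
  rw [card_union_of_disjoint hdXP, card_union_of_disjoint hdYQ, card_compl, card_univ] at h1
  have h2 := T.card_eq
  have h3 := T'.card_eq
  have h4 := card_le_univ Y'
  have h5 := card_sdiff_add_card_eq_card hX.1.1
  have h6 := card_pos.2 hPn
  have h7 := card_pos.2 hQn
  have hQY : Q ⊆ Y' := fun j hj => (mem_sdiff.1 (hQ hj)).1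
  have h8 := card_sdiff_add_card_eq_card hQY
  have hT : Tight B (X ∪ P) (Y' \ Q) := by
    refine ⟨T.nonempty.mono subset_union_left, T'.compl_nonempty.mono ?_, ?_, ?_⟩
    · exact compl_subset_compl.2 sdiff_subset
    · rw [card_union_of_disjoint hdXP]; omega
    · intro i hi j hj
      refine hz i hi j ?_
      simp only [mem_sdiff, not_and, not_not] at hj
      rw [mem_union, mem_compl]
      tauto
  have h9 := hX.2 _ _ hT
    ⟨subset_union_left, fun h => by
      obtain ⟨i, hi⟩ := hPn
      exact (mem_sdiff.1 (hP hi)).2 (h (mem_union_right _ hi))⟩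
    (union_subset hX.1.1 fun i hi => (mem_sdiff.1 (hP hi)).1)
  have h10 := card_union_of_disjoint hdXP
  rw [h9] at h10
  omega

theorem exists_minor_matching {P : Finset R} {Q : Finset C} (h : ExpOn 1 B P Q)
    (hPQ : P.card = Q.card) {ρ : R} {n : C} (hρ : ρ ∈ P) (hn : n ∈ Q) :
    ∃ τ : R → C, (∀ i ∈ P, i ≠ ρ → τ i ∈ Q ∧ τ i ≠ n ∧ B i (τ i) ≠ 0) ∧
      ∀ i ∈ P, ∀ i' ∈ P, τ i = τ i' → i = i' := by
  let B' : R → C → ℝ := fun i j => if i = ρ ∧ j = n then 1 else B i j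
  have h' : ExpOn 1 B' P Q := by
    intro S hS T hT hSn hTn h0
    refine h S hS T hT hSn hTn fun i hi j hj => ?_
    have := h0 i hi j hj
    simp only [B'] at this
    split_ifs at this
    · exact absurd this one_ne_zero
    · exact this
  obtain ⟨σ, hσ, hσρ⟩ := h'.block.exists_matching_one (by simpa using hPQ) (r := ⟨ρ, hρ⟩)
    (c := ⟨n, hn⟩) (by simp [block, B'])
  refine ⟨fun i => if h : i ∈ P then σ ⟨i, h⟩ else n, fun i hi hne => ?_, fun i hi i' hi' hh => ?_⟩
  · have h1 : σ ⟨i, hi⟩ ≠ ⟨n, hn⟩ := fun hh => by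
      have := hσ.injective (hh.trans hσρ.symm)
      exact hne (congrArg Subtype.val this)
    have h2 := hσ.ne_zero ⟨i, hi⟩ (mem_univ _)
    simp only [hi, dif_pos]
    refine ⟨(σ ⟨i, hi⟩).2, fun hh => h1 (Subtype.ext hh), ?_⟩
    simpa [block, B', hne] using h2
  · simp only [hi, hi', dif_pos] at hh
    exact congrArg Subtype.val (hσ.injective (Subtype.ext hh))

/-- The entries kept to isolate two channels across a pair of nested cuts. -/
def OverlapKept (X X' : Finset R) (Y Y' : Finset C) (r r' ρ : R) (c c' n : C) (i : R) (j : C) :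
    Prop :=
  i ∈ X ∨ (i ∈ X' ∧ i ∉ X ∧ (j ∉ Y ∨ (i = ρ ∧ j = c))) ∨
    (i ∉ X' ∧ (j ∉ Y' ∨ (i = r ∧ j = n) ∨ (i = r' ∧ j = c')))

variable {r r' ρ : R} {c c' n : C}

theorem overlap_matching (T : Tight B X Y) (T' : Tight B X' Y') (hXX : X ⊆ X') (hYY : Y ⊆ Y')
    (hr' : r' ∉ X') (hc' : c' ∈ Y) {σ : R → C} (hσ : IsMatching B univ univ σ) (hσr : σ r' = c') :
    IsMatching (keep B (OverlapKept X X' Y Y' r r' ρ c c' n)) univ univ σ ∧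
      (∀ i ∈ X, σ i ∈ Y) ∧ (∀ i, i ∉ X' → i ≠ r' → σ i ∉ Y') := by
  have h1 : ∀ i ∈ X, σ i ∈ Y := fun i hi => T.matching_mem hσ hi
  have h2 : ∀ i, i ∉ X' → i ≠ r' → σ i ∉ Y' := fun i hi hir =>
    T'.matching_notMem hσ hr' (by rw [hσr]; exact hYY hc') hi hir
  refine ⟨⟨by simp, hσ.injOn, fun i hi => ?_⟩, h1, h2⟩
  rw [keep_of]
  · exact hσ.ne_zero i hi
  · by_cases hiX : i ∈ X
    · exact Or.inl hiX
    by_cases hiX' : i ∈ X'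
    · refine Or.inr (Or.inl ⟨hiX', hiX, Or.inl ?_⟩)
      exact T.matching_notMem hσ (fun h => hr' (hXX h)) (by rw [hσr]; exact hc') hiX
        (fun h => hr' (h ▸ hiX'))
    · by_cases hir : i = r'
      · exact Or.inr (Or.inr ⟨hiX', Or.inr (Or.inr ⟨hir, hir ▸ hσr⟩)⟩)
      · exact Or.inr (Or.inr ⟨hiX', Or.inl (h2 i hiX' hir)⟩)

theorem exists_transfer (hB : SNSOn B univ univ) (hE : ExpOn 1 B univ univ)
    (hRC : Fintype.card R = Fintype.card C) (T : Tight B X Y) (T' : Tight B X' Y')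
    (hX : IsNext B X X') (hr : r ∉ X') (hn : n ∈ Y' \ Y) (hrn : B r n ≠ 0)
    (hr' : r' ∉ X') (hc' : c' ∈ Y) (hrc' : B r' c' ≠ 0) (hρ : ρ ∈ X' \ X) (hc : c ∈ Y)
    (hρc : B ρ c ≠ 0) :
    ∃ κ : ℝ, κ ≠ 0 ∧ ∀ u : C → ℝ, (∀ i ∈ X' \ X,
      ∑ j, keep B (OverlapKept X X' Y Y' r r' ρ c c' n) i j * u j = 0) → u n = κ * u c := by
  set D := keep B (OverlapKept X X' Y Y' r r' ρ c c' n) with hD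
  have hDs : SNSOn D univ univ := hB.mono (sub_keep _)
  have hYY := T.subset hE hRC T' hX.1.1
  have hDL : ∀ i ∈ X' \ X, ∀ j, D i j ≠ 0 → j ∈ Y' \ Y ∨ j = c := by
    intro i hi j hij
    rw [mem_sdiff] at hi
    have hBij := (sub_keep _).ne_zero hij
    have h1 : OverlapKept X X' Y Y' r r' ρ c c' n i j := by
      by_contra h; exact hij (keep_of_not h)
    have h2 : j ∈ Y' := by
      by_contra h; exact hBij (T'.eq_zero i hi.1 j h)
    simp only [OverlapKept, hi.1, hi.2, not_true, not_false_iff, false_or, true_and, false_and,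
      or_false] at h1
    rw [mem_sdiff]
    tauto
  have claim₁ : ∀ u : C → ℝ, (∀ i ∈ X' \ X, ∑ j, D i j * u j = 0) → u c = 0 → u n = 0 := by
    intro u hu huc
    obtain ⟨σ, hσ, hσr⟩ := hE.exists_matching_one hRC hrc'
    obtain ⟨h1, h2, h3⟩ := overlap_matching (r := r) (ρ := ρ) (c := c) (n := n) T T' hX.1.1 hYY
      hr' hc' hσ hσr
    have := hDs.eq_zero h1 (fun j => if j ∈ Y' \ Y then u j else 0) fun i => ?_
    · have := congrFun this n
      rwa [if_pos hn] at this
    by_cases hiX : i ∈ X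
    · left; exact if_neg fun h => (mem_sdiff.1 h).2 (h2 i hiX)
    by_cases hiX' : i ∈ X'
    · right
      have hi : i ∈ X' \ X := mem_sdiff.2 ⟨hiX', hiX⟩
      refine Eq.trans (sum_congr rfl fun j _ => ?_) (hu i hi)
      by_cases hj : D i j = 0
      · rw [hj, zero_mul, zero_mul]
      rcases hDL i hi j hj with hj | rfl
      · rw [if_pos hj]
      · rw [if_neg (fun h => (mem_sdiff.1 h).2 hc), huc]
    · left
      by_cases hir : i = r'
      · exact if_neg fun h => (mem_sdiff.1 h).2 (by rw [hir, hσr]; exact hc')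
      · exact if_neg fun h => h3 i hiX' hir (mem_sdiff.1 h).1
  have claim₂ : ∀ u : C → ℝ, (∀ i ∈ X' \ X, ∑ j, D i j * u j = 0) → u n = 0 → u c = 0 := by
    intro u hu hun
    have hρ' := mem_sdiff.1 hρ
    have hn' := mem_sdiff.1 hn
    obtain ⟨σ, hσ, hσρ⟩ := hE.exists_matching_one hRC hρc
    obtain ⟨σ', hσ', hσr⟩ := hE.exists_matching_one hRC hrn
    obtain ⟨τ, hτ, hτinj⟩ := exists_minor_matching (T.expOn_between hE hRC T' hX) (by
      rw [card_sdiff_of_subset hX.1.1, card_sdiff_of_subset hYY, T.card_eq, T'.card_eq]; omega) hρ hn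
    have hσX : ∀ i ∈ X, σ i ∈ Y ∧ σ i ≠ c := fun i hi => ⟨T.matching_mem hσ hi, fun h =>
      hρ'.2 (hσ.injective (h.trans hσρ.symm) ▸ hi)⟩
    have hσo : ∀ i, i ∉ X' → i ≠ r → σ' i ∉ Y' := fun i hi hir =>
      T'.matching_notMem hσ' hr (by rw [hσr]; exact hn'.1) hi hir
    let φ : R → C := fun i => if i ∈ X then σ i else if i ∈ X' then (if i = ρ then c else τ i)
      else σ' i
    have hφX : ∀ i ∈ X, φ i = σ i := fun i hi => by simp [φ, hi]
    have hφρ : φ ρ = c := by simp [φ, hρ'.1, hρ'.2]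
    have hφL : ∀ i ∈ X' \ X, i ≠ ρ → φ i = τ i := fun i hi hne => by
      rw [mem_sdiff] at hi; simp [φ, hi.1, hi.2, hne]
    have hφo : ∀ i, i ∉ X' → φ i = σ' i := fun i hi => by
      have : i ∉ X := fun h => hi (hX.1.1 h)
      simp [φ, hi, this]
    have hσ'Y : ∀ i, i ∉ X' → σ' i ∉ Y := fun i hi h => by
      by_cases hir : i = r
      · rw [hir, hσr] at h; exact hn'.2 h
      · exact hσo i hi hir (hYY h)
    have hσ'n : ∀ i, i ∉ X' → σ' i ∈ Y' → σ' i = n := fun i hi h => by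
      by_cases hir : i = r
      · rw [hir, hσr]
      · exact absurd h (hσo i hi hir)
    have hcases : ∀ i, i ∈ X ∨ i = ρ ∨ (i ∈ X' \ X ∧ i ≠ ρ) ∨ i ∉ X' := by
      intro i; rw [mem_sdiff]; tauto
    have hφm : IsMatching D univ univ φ := by
      refine ⟨by simp, ?_, ?_⟩
      · have key : ∀ i i', φ i = φ i' → (i ∈ X → i = i') ∧ (i = ρ → i = i') ∧
            ((i ∈ X' \ X ∧ i ≠ ρ) → (i' ∈ X' \ X ∧ i' ≠ ρ) ∨ i' ∉ X' → i = i') := by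
          intro i i' hh
          refine ⟨fun hi => ?_, fun hi => ?_, fun hi hi' => ?_⟩
          · rw [hφX i hi] at hh
            have h1 := hσX i hi
            rw [hh] at h1
            rcases hcases i' with hi' | rfl | hi' | hi'
            · rw [hφX i' hi'] at hh; exact hσ.injective hh
            · exact absurd hφρ h1.2
            · rw [hφL i' hi'.1 hi'.2] at h1
              exact absurd h1.1 (mem_sdiff.1 (hτ i' hi'.1 hi'.2).1).2
            · rw [hφo i' hi'] at h1
              exact absurd h1.1 (hσ'Y i' hi')
          · subst hi
            rw [hφρ] at hh
            rcases hcases i' with hi' | rfl | hi' | hi'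
            · rw [hφX i' hi'] at hh
              exact absurd hh.symm (hσX i' hi').2
            · rfl
            · rw [hφL i' hi'.1 hi'.2] at hh
              have := (mem_sdiff.1 (hτ i' hi'.1 hi'.2).1).2
              exact absurd (hh ▸ hc) this
            · rw [hφo i' hi'] at hh
              exact absurd (hh ▸ hc) (hσ'Y i' hi')
          · rw [hφL i hi.1 hi.2] at hh
            have h1 := hτ i hi.1 hi.2
            rcases hi' with hi' | hi'
            · rw [hφL i' hi'.1 hi'.2] at hh
              exact hτinj i hi.1 i' hi'.1 hh
            · rw [hφo i' hi'] at hh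
              have := hσ'n i' hi' (hh ▸ (mem_sdiff.1 h1.1).1)
              exact absurd (hh.trans this) h1.2.1
        intro i _ i' _ hh
        obtain ⟨k1, k2, k3⟩ := key i i' hh
        obtain ⟨l1, l2, l3⟩ := key i' i hh.symm
        rcases hcases i with hi | hi | hi | hi
        · exact k1 hi
        · exact k2 hi
        · rcases hcases i' with hi' | hi' | hi' | hi'
          · exact (l1 hi').symm
          · exact (l2 hi').symm
          · exact k3 hi (Or.inl hi')
          · exact k3 hi (Or.inr hi')
        · rcases hcases i' with hi' | hi' | hi' | hi'
          · exact (l1 hi').symm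
          · exact (l2 hi').symm
          · exact (l3 hi' (Or.inr hi)).symm
          · rw [hφo i hi, hφo i' hi'] at hh
            exact hσ'.injective hh
      · intro i _
        rcases hcases i with hi | rfl | hi | hi
        · rw [hφX i hi, hD, keep_of (p := OverlapKept X X' Y Y' r r' _ c c' n) (Or.inl hi)]
          exact hσ.ne_zero i (mem_univ _)
        · rw [hφρ, hD, keep_of (p := OverlapKept X X' Y Y' r r' _ c c' n) (Or.inr (Or.inl ⟨hρ'.1, hρ'.2, Or.inr ⟨rfl, rfl⟩⟩))]
          exact hρc
        · have h1 := hτ i hi.1 hi.2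
          have h2 := mem_sdiff.1 hi.1
          rw [hφL i hi.1 hi.2, hD,
            keep_of (p := OverlapKept X X' Y Y' r r' _ c c' n) (Or.inr (Or.inl ⟨h2.1, h2.2, Or.inl (mem_sdiff.1 h1.1).2⟩))]
          exact h1.2.2
        · rw [hφo i hi, hD, keep_of]
          · exact hσ'.ne_zero i (mem_univ _)
          · refine Or.inr (Or.inr ⟨hi, ?_⟩)
            by_cases hir : i = r
            · exact Or.inr (Or.inl ⟨hir, hir ▸ hσr⟩)
            · exact Or.inl (hσo i hi hir)
    have := hDs.eq_zero hφm (fun j => if j ∈ Y' \ Y ∨ j = c then u j else 0) fun i => ?_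
    · have := congrFun this c
      simpa using this
    rcases hcases i with hi | rfl | hi | hi
    · left
      rw [hφX i hi]
      have := hσX i hi
      exact if_neg fun h => h.elim (fun h => (mem_sdiff.1 h).2 this.1) this.2
    · right
      refine Eq.trans (sum_congr rfl fun j _ => ?_) (hu i hρ)
      by_cases hj : D i j = 0
      · rw [hj, zero_mul, zero_mul]
      · rw [if_pos (hDL i hρ j hj)]
    · right
      refine Eq.trans (sum_congr rfl fun j _ => ?_) (hu i hi.1)
      by_cases hj : D i j = 0
      · rw [hj, zero_mul, zero_mul]
      · rw [if_pos (hDL i hi.1 j hj)]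
    · left
      rw [hφo i hi]
      split_ifs with h
      · rw [hσ'n i hi (h.elim (fun h => (mem_sdiff.1 h).1) (fun h => h ▸ hYY hc)), hun]
      · rfl
  by_cases hex : ∃ u : C → ℝ, (∀ i ∈ X' \ X, ∑ j, D i j * u j = 0) ∧ u c ≠ 0
  · obtain ⟨v, hv, hvc⟩ := hex
    refine ⟨v n / v c, div_ne_zero (fun h => hvc (claim₂ v hv h)) hvc, fun u hu => ?_⟩
    have := claim₁ (fun j => u j - u c / v c * v j) (fun i hi => by
      simp only [mul_sub, sum_sub_distrib]
      have h2 : ∑ j, D i j * (u c / v c * v j) = u c / v c * ∑ j, D i j * v j := by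
        rw [mul_sum]; exact sum_congr rfl fun j _ => by ring
      rw [h2, hu i hi, hv i hi]; simp) (by rw [div_mul_cancel₀ _ hvc, sub_self])
    rw [sub_eq_zero] at this
    rw [this]; ring
  · push Not at hex
    refine ⟨1, one_ne_zero, fun u hu => ?_⟩
    rw [claim₁ u hu (hex u hu), hex u hu, mul_zero]

theorem overlap_sign (S : EdgeDeletion A B a b) (hE : ExpOn 1 B univ univ)
    (T : Tight B X Y) (T' : Tight B X' Y') (hX : IsNext B X X') {f h : C → ℝ} {g g₂ : R → ℝ}
    (V : HalfVec B a X Y f h) (W : HalfVec (fun j i => B i j) b Y'ᶜ X'ᶜ g g₂)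
    (hr : r ∉ X') (hn : n ∈ Y' \ Y) (hrn : B r n ≠ 0) (hrr : r ≠ r')
    (hr' : r' ∉ X') (hc' : c' ∈ Y) (hrc' : B r' c' ≠ 0) (hρ : ρ ∈ X' \ X) (hc : c ∈ Y)
    (hρc : B ρ c ≠ 0) :
    A a b * (B r' c' * g r' * f c') * (g₂ r / g r - g₂ r' / g r') * (h c / f c - h c' / f c') ≤ 0 := by
  have hRC := S.card_eq
  have hYY := T.subset hE hRC T' hX.1.1
  obtain ⟨hn', hnY⟩ := mem_sdiff.1 hn
  obtain ⟨hρ', hρX⟩ := mem_sdiff.1 hρ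
  have hr'X : r' ∉ X := fun h => hr' (hX.1.1 h)
  have hrX : r ∉ X := fun h => hr (hX.1.1 h)
  have hfc := V.f_ne_zero_of_edge S.snsB hE hRC T hρX hc hρc
  have hfc' := V.f_ne_zero_of_edge S.snsB hE hRC T hr'X hc' hrc'
  have hEt := hE.transpose (by simp [hRC])
  have hgr := W.f_ne_zero_of_edge S.symm.snsB hEt hRC.symm (T'.symm hRC)
    (r := n) (c := r) (by simpa using hn') (by simpa using hr) hrn
  have hgr' := W.f_ne_zero_of_edge S.symm.snsB hEt hRC.symm (T'.symm hRC)
    (r := c') (c := r') (by simpa using hYY hc') (by simpa using hr') hrc'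
  obtain ⟨κ, hκ0, hκ⟩ := exists_transfer S.snsB hE hRC T T' hX hr hn hrn hr' hc' hrc' hρ hc hρc
  have ha := (T.mem S).1
  set p := OverlapKept X X' Y Y' r r' ρ c c' n with hp
  have hDr : keep B p r n = B r n := keep_of (Or.inr (Or.inr ⟨hr, Or.inr (Or.inl ⟨rfl, rfl⟩)⟩))
  have hDr' : keep B p r' c' = B r' c' :=
    keep_of (Or.inr (Or.inr ⟨hr', Or.inr (Or.inr ⟨rfl, rfl⟩)⟩))
  have TC : TwoChannel (keep B p) a b X (X' \ X) r r' c c' n f h g g₂ κ := by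
    refine twoChannel_of_halfVec S hE T T' V W hX.1.1 ?_ ?_ ?_ hr hr' hrr hn' (hYY hc') hρX hc hc'
      hρc ?_
    · exact fun i hi j => keep_of (Or.inl hi)
    · exact fun i hi j hj => keep_of (Or.inr (Or.inr ⟨hi, Or.inl hj⟩))
    · intro i hi j hj h1 h2
      have hiX : i ∉ X := fun h => hi (hX.1.1 h)
      refine keep_of_not ?_
      rintro (h3 | h3 | h3)
      · exact hiX h3
      · exact hi h3.1
      · tauto
    · intro u hu
      exact hκ u fun i hi => hu i hi fun h => (mem_sdiff.1 hi).2 (h ▸ ha)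
  obtain ⟨σ, hσ, hσr⟩ := hE.exists_matching_one hRC hrc'
  have hσD := (overlap_matching (r := r) (ρ := ρ) (c := c) (n := n) T T' hX.1.1 hYY hr' hc' hσ
    hσr).1
  have r2 := TC.sign hRC S.sns S.ne_zero ((sub_keep p).trans S.sub) ?_ hσD ?_ ?_
  · rwa [hDr'] at r2
  · by_contra hne
    exact (sub_keep p).ne_zero hne S.apply_self
  · rw [hDr]; exact mul_ne_zero (mul_ne_zero (mul_ne_zero hrn hgr) hκ0) hfc
  · rw [hDr']; exact mul_ne_zero (mul_ne_zero hrc' hgr') hfc'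

theorem false_of_three_overlaps (S : EdgeDeletion A B a b) (hE : ExpOn 1 B univ univ)
    (T : Tight B X Y) (T' : Tight B X' Y') (hX : IsNext B X X') {g g₂ : R → ℝ}
    (W : HalfVec (fun j i => B i j) b Y'ᶜ X'ᶜ g g₂) {r₁ r₂ r₃ : R} {n₁ c₂ n₃ : C}
    (hr₁ : r₁ ∉ X') (hr₂ : r₂ ∉ X') (hr₃ : r₃ ∉ X') (hn₁ : n₁ ∈ Y' \ Y) (hc₂ : c₂ ∈ Y)
    (hn₃ : n₃ ∈ Y' \ Y) (h₁ : B r₁ n₁ ≠ 0) (h₂ : B r₂ c₂ ≠ 0) (h₃ : B r₃ n₃ ≠ 0)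
    (h₁₂ : g₂ r₁ / g r₁ < g₂ r₂ / g r₂) (h₂₃ : g₂ r₂ / g r₂ < g₂ r₃ / g r₃) : False := by
  have hRC := S.card_eq
  have hYY := T.subset hE hRC T' hX.1.1
  have ha := (T.mem S).1
  obtain ⟨f, h, V⟩ := exists_halfVec S.snsB hE hRC T a
  have hr₂X : r₂ ∉ X := fun h => hr₂ (hX.1.1 h)
  have hfc := V.f_ne_zero_of_edge S.snsB hE hRC T hr₂X hc₂ h₂
  have hEt := hE.transpose (by simp [hRC])
  have hgr := W.f_ne_zero_of_edge S.symm.snsB hEt hRC.symm (T'.symm hRC)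
    (r := c₂) (c := r₂) (by simpa using hYY hc₂) (by simpa using hr₂) h₂
  have key : ∀ ρ ∈ X' \ X, ∀ c ∈ Y, B ρ c ≠ 0 → c = c₂ := by
    intro ρ hρ c hc hρc
    by_contra hcc
    have k1 := overlap_sign S hE T T' hX V W hr₁ hn₁ h₁ (fun h => by rw [h] at h₁₂; exact h₁₂.false)
      hr₂ hc₂ h₂ hρ hc hρc
    have k2 := overlap_sign S hE T T' hX V W hr₃ hn₃ h₃ (fun h => by rw [h] at h₂₃; exact h₂₃.false)
      hr₂ hc₂ h₂ hρ hc hρc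
    have hρX := mem_sdiff.1 hρ
    have k3 := V.strict S hE T hρX.2 hc hρc hr₂X hc₂ h₂ (fun h => hr₂ (h ▸ hρX.1)) hcc
    have k4 : A a b * (B r₂ c₂ * g r₂ * f c₂) * (h c / f c - h c₂ / f c₂) ≠ 0 :=
      mul_ne_zero (mul_ne_zero S.ne_zero (mul_ne_zero (mul_ne_zero h₂ hgr) hfc)) (sub_ne_zero.2 k3)
    rcases lt_or_gt_of_ne k4 with k4 | k4 <;> nlinarith
  have hLne : (X' \ X).Nonempty := sdiff_nonempty.2 hX.1.2
  have hd : Disjoint Y'ᶜ (Y.erase c₂) := Finset.disjoint_left.2 fun j hj hj' =>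
    (mem_compl.1 hj) (hYY (mem_of_mem_erase hj'))
  have := S.exp (X' \ X) (subset_univ _) (Y'ᶜ ∪ Y.erase c₂) (subset_univ _) hLne
    (T'.compl_nonempty.mono subset_union_left) (by
      intro i hi j hj
      have hi' := mem_sdiff.1 hi
      have hia : i ≠ a := fun h => hi'.2 (h ▸ ha)
      rw [← S.eq_of_row hia]
      rw [mem_union] at hj
      rcases hj with hj | hj
      · exact T'.eq_zero i hi'.1 j (mem_compl.1 hj)
      · by_contra hij
        exact ne_of_mem_erase hj (key i hi j (mem_of_mem_erase hj) hij))
  rw [card_union_of_disjoint hd, card_compl, card_univ, card_erase_of_mem hc₂,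
    card_sdiff_of_subset hX.1.1] at this
  have e1 := T.card_eq
  have e2 := T'.card_eq
  have e3 := card_le_univ Y'
  have e4 := card_lt_card hX.1
  omega

open Classical in
theorem card_overlap_le_two (S : EdgeDeletion A B a b) (hE : ExpOn 1 B univ univ)
    (T : Tight B X Y) (T' : Tight B X' Y') (hX : IsNext B X X') :
    (univ.filter fun r => r ∉ X' ∧ (∃ c ∈ Y, B r c ≠ 0) ∧ ∃ n ∈ Y' \ Y, B r n ≠ 0).card ≤ 2 := by
  by_contra hlt
  obtain ⟨r₁, r₂, r₃, h₁, h₂, h₃, h₁₂, h₁₃, h₂₃⟩ := two_lt_card_iff.1 (not_le.1 hlt)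
  simp only [mem_filter, mem_univ, true_and] at h₁ h₂ h₃
  have hRC := S.card_eq
  have hYY := T.subset hE hRC T' hX.1.1
  have hEt := hE.transpose (by simp [hRC])
  obtain ⟨g, g₂, W⟩ := exists_halfVec S.symm.snsB hEt hRC.symm (T'.symm hRC) b
  have hne : ∀ r r', (r ∉ X' ∧ (∃ c ∈ Y, B r c ≠ 0) ∧ ∃ n ∈ Y' \ Y, B r n ≠ 0) →
      (r' ∉ X' ∧ (∃ c ∈ Y, B r' c ≠ 0) ∧ ∃ n ∈ Y' \ Y, B r' n ≠ 0) → r ≠ r' →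
      g₂ r / g r ≠ g₂ r' / g r' := by
    rintro r r' ⟨hr, ⟨c, hc, hrc⟩, -⟩ ⟨hr', -, n, hn, hrn⟩ hrr
    obtain ⟨hn', hnY⟩ := mem_sdiff.1 hn
    exact W.strict S.symm hEt (T'.symm hRC) (r := c) (r' := n) (c := r) (c' := r')
      (by simpa using hYY hc) (by simpa using hr) hrc (by simpa using hn') (by simpa using hr') hrn
      (fun h => hnY (h ▸ hc)) hrr
  have main : ∀ r r' r'', (r ∉ X' ∧ (∃ c ∈ Y, B r c ≠ 0) ∧ ∃ n ∈ Y' \ Y, B r n ≠ 0) →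
      (r' ∉ X' ∧ (∃ c ∈ Y, B r' c ≠ 0) ∧ ∃ n ∈ Y' \ Y, B r' n ≠ 0) →
      (r'' ∉ X' ∧ (∃ c ∈ Y, B r'' c ≠ 0) ∧ ∃ n ∈ Y' \ Y, B r'' n ≠ 0) →
      g₂ r / g r < g₂ r' / g r' → g₂ r' / g r' < g₂ r'' / g r'' → False := by
    rintro r r' r'' ⟨hr, -, n, hn, hrn⟩ ⟨hr', ⟨c, hc, hrc⟩, -⟩ ⟨hr'', -, n'', hn'', hrn''⟩ hl hl'
    exact false_of_three_overlaps S hE T T' hX W hr hr' hr'' hn hc hn'' hrn hrc hrn'' hl hl'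
  rcases lt_or_gt_of_ne (hne _ _ h₁ h₂ h₁₂) with k1 | k1 <;>
  rcases lt_or_gt_of_ne (hne _ _ h₁ h₃ h₁₃) with k2 | k2 <;>
  rcases lt_or_gt_of_ne (hne _ _ h₂ h₃ h₂₃) with k3 | k3
  · exact main _ _ _ h₁ h₂ h₃ k1 k3
  · exact main _ _ _ h₁ h₃ h₂ k2 k3
  · exact (k1.trans k3).not_gt k2
  · exact main _ _ _ h₃ h₁ h₂ k2 k1
  · exact main _ _ _ h₂ h₁ h₃ k1 k2
  · exact (k3.trans k1).not_gt k2
  · exact main _ _ _ h₂ h₃ h₁ k3 k2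
  · exact main _ _ _ h₃ h₂ h₁ k3 k1

end Overlap

section Contract

variable {R C : Type u} [Fintype R] [Fintype C] [DecidableEq R] [DecidableEq C]

/-- Replace column `s` of `A` by the combination of all columns with weights `f`. -/
def colHub (A : R → C → ℝ) (s : C) (f : C → ℝ) : R → C → ℝ :=
  fun i j => if j = s then ∑ c, A i c * f c else A i j

/-- Replace row `t` of `A` by the combination of all rows with weights `g`. -/
def rowHub (A : R → C → ℝ) (t : R) (g : R → ℝ) : R → C → ℝ :=
  fun i j => if i = t then ∑ r, A r j * g r else A i j

theorem SNSOn.colHub {A : R → C → ℝ} {P X : Finset R} {Q Y : Finset C} (hA : SNSOn A P Q)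
    (hY : Y ⊆ Q) (hz : ∀ i ∈ X, ∀ j ∈ Q, j ∉ Y → A i j = 0)
    {f : C → ℝ} (hf : ∀ j, j ∉ Y → f j = 0) (hf0 : f ≠ 0)
    (hfk : ∀ i ∈ X, ∑ j, A i j * f j = 0)
    (hm₀ : ∃ τ, IsMatching A X Y τ)
    (hm : ∀ r ∈ P \ X, ∀ c ∈ Y, A r c ≠ 0 → ∃ τ, IsMatching A X Y τ ∧ ∀ i ∈ X, τ i ≠ c)
    {s : C} (hs : s ∈ Y) : SNSOn (SignPattern.colHub A s f) (P \ X) (insert s (Q \ Y)) := by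
  intro σ' hσ' x' hx' hx0'
  have hs' : s ∉ Q \ Y := fun h => (mem_sdiff.1 h).2 hs
  set x : C → ℝ := fun j => if j ∈ Y then x' s * f j else x' j with hx
  have hxY : ∀ j ∈ Y, x j = x' s * f j := fun j hj => by simp [hx, hj]
  have hxn : ∀ j, j ∉ Y → x j = x' j := fun j hj => by simp [hx, hj]
  obtain ⟨c, τ, hτ, hcY, hτc, hc⟩ : ∃ c τ, IsMatching A X Y τ ∧ c ∈ Y ∧
      ((∃ r ∈ P \ X, σ' r = s) → ∀ i ∈ X, τ i ≠ c) ∧ ∀ r ∈ P \ X, σ' r = s → A r c ≠ 0 := by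
    by_cases hr : ∃ r ∈ P \ X, σ' r = s
    · obtain ⟨r, hr, hrs⟩ := hr
      have h1 := hσ'.ne_zero r hr
      rw [hrs, SignPattern.colHub, if_pos rfl] at h1
      obtain ⟨c, -, hc⟩ := exists_ne_zero_of_sum_ne_zero h1
      have hcY : c ∈ Y := by
        by_contra h; rw [hf c h, mul_zero] at hc; exact hc rfl
      obtain ⟨τ, hτ, hτc⟩ := hm r hr c hcY (left_ne_zero_of_mul hc)
      refine ⟨c, τ, hτ, hcY, fun _ => hτc, fun r' hr' hrs' => ?_⟩
      rw [hσ'.injOn r' hr' r hr (hrs'.trans hrs.symm)]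
      exact left_ne_zero_of_mul hc
    · obtain ⟨τ, hτ⟩ := hm₀
      exact ⟨s, τ, hτ, hs, fun h => absurd h hr, fun r hr' hrs => absurd ⟨r, hr', hrs⟩ hr⟩
  let σ : R → C := fun i => if i ∈ X then τ i else if σ' i = s then c else σ' i
  have hσX : ∀ i ∈ X, σ i = τ i := fun i hi => by simp [σ, hi]
  have hσs : ∀ i, i ∉ X → σ' i = s → σ i = c := fun i hi h => by simp [σ, hi, h]
  have hσo : ∀ i, i ∉ X → σ' i ≠ s → σ i = σ' i := fun i hi h => by simp [σ, hi, h]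
  have hσ'Q : ∀ i ∈ P \ X, σ' i ≠ s → σ' i ∈ Q \ Y := fun i hi h =>
    (mem_insert.1 (hσ'.mapsTo i hi)).resolve_left h
  have hσm : IsMatching A P Q σ := by
    refine ⟨fun i hi => ?_, fun i hi i' hi' hh => ?_, fun i hi => ?_⟩
    · by_cases hiX : i ∈ X
      · rw [hσX i hiX]; exact hY (hτ.mapsTo i hiX)
      by_cases h : σ' i = s
      · rw [hσs i hiX h]; exact hY hcY
      · rw [hσo i hiX h]; exact (mem_sdiff.1 (hσ'Q i (mem_sdiff.2 ⟨hi, hiX⟩) h)).1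
    · have key : ∀ i ∈ P, ∀ i' ∈ P, i ∈ X → i' ∉ X → σ i ≠ σ i' := by
        intro i hi i' hi' hiX hiX' hh
        rw [hσX i hiX] at hh
        by_cases h : σ' i' = s
        · rw [hσs i' hiX' h] at hh
          exact hτc ⟨i', mem_sdiff.2 ⟨hi', hiX'⟩, h⟩ i hiX hh
        · rw [hσo i' hiX' h] at hh
          have := (mem_sdiff.1 (hσ'Q i' (mem_sdiff.2 ⟨hi', hiX'⟩) h)).2
          exact this (hh ▸ hτ.mapsTo i hiX)
      have key2 : ∀ i ∈ P, ∀ i' ∈ P, i ∉ X → i' ∉ X → σ' i = s → σ' i' ≠ s → σ i ≠ σ i' := by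
        intro i hi i' hi' hiX hiX' h h' hh
        rw [hσs i hiX h, hσo i' hiX' h'] at hh
        exact (mem_sdiff.1 (hσ'Q i' (mem_sdiff.2 ⟨hi', hiX'⟩) h')).2 (hh ▸ hcY)
      by_cases hiX : i ∈ X <;> by_cases hiX' : i' ∈ X
      · rw [hσX i hiX, hσX i' hiX'] at hh
        exact hτ.injOn i hiX i' hiX' hh
      · exact absurd hh (key i hi i' hi' hiX hiX')
      · exact absurd hh.symm (key i' hi' i hi hiX' hiX)
      · have e : i ∈ P \ X := mem_sdiff.2 ⟨hi, hiX⟩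
        have e' : i' ∈ P \ X := mem_sdiff.2 ⟨hi', hiX'⟩
        by_cases h : σ' i = s <;> by_cases h' : σ' i' = s
        · exact hσ'.injOn i e i' e' (h.trans h'.symm)
        · exact absurd hh (key2 i hi i' hi' hiX hiX' h h')
        · exact absurd hh.symm (key2 i' hi' i hi hiX' hiX h' h)
        · rw [hσo i hiX h, hσo i' hiX' h'] at hh
          exact hσ'.injOn i e i' e' hh
    · by_cases hiX : i ∈ X
      · rw [hσX i hiX]; exact hτ.ne_zero i hiX
      have e : i ∈ P \ X := mem_sdiff.2 ⟨hi, hiX⟩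
      by_cases h : σ' i = s
      · rw [hσs i hiX h]; exact hc i e h
      · rw [hσo i hiX h]
        have := hσ'.ne_zero i e
        rwa [SignPattern.colHub, if_neg h] at this
  have hx0 : x ≠ 0 := by
    intro h
    apply hx0'
    have hs0 : x' s = 0 := by
      obtain ⟨j, hj⟩ := Function.ne_iff.1 hf0
      have hjY : j ∈ Y := by by_contra h'; exact hj (hf j h')
      have := congrFun h j
      rw [hxY j hjY] at this
      exact (mul_eq_zero.1 this).resolve_right hj
    funext j
    by_cases hj : j ∈ Y
    · by_cases hjs : j = s
      · rw [hjs, hs0]; rfl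
      · exact hx' j (by simp [hjs, hj])
    · rw [← hxn j hj, h]
  obtain ⟨i, hi, h1, h2⟩ := hA σ hσm x (fun j hj => by
    rw [hxn j fun h => hj (hY h)]
    refine hx' j ?_
    have : j ≠ s := fun h => hj (h ▸ hY hs)
    simp [this, hj]) hx0
  by_cases hiX : i ∈ X
  · refine absurd (mixed_of_sum_eq_zero ?_ (mul_ne_zero (hσm.ne_zero i hi) h1)) h2
    have : ∀ j, A i j * x j = x' s * (A i j * f j) := by
      intro j
      by_cases hj : j ∈ Y
      · rw [hxY j hj]; ring
      · rw [hf j hj, hxn j hj]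
        by_cases hjQ : j ∈ Q
        · rw [hz i hiX j hjQ hj]; ring
        · rw [hx' j]
          · ring
          · have : j ≠ s := fun h => hj (h ▸ hs)
            simp [this, hjQ]
    rw [sum_congr rfl fun j _ => this j, ← mul_sum, hfk i hiX, mul_zero]
  refine ⟨i, mem_sdiff.2 ⟨hi, hiX⟩, ?_, fun hmix => h2 ?_⟩
  · by_cases h : σ' i = s
    · rw [hσs i hiX h, hxY c hcY] at h1
      rw [h]
      exact left_ne_zero_of_mul h1
    · rw [hσo i hiX h, hxn _ (mem_sdiff.1 (hσ'Q i (mem_sdiff.2 ⟨hi, hiX⟩) h)).2] at h1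
      exact h1
  · have hnY : ∀ j, j ≠ s → x' j ≠ 0 → j ∉ Y := fun j hj h hY' =>
      h (hx' j (by simp [hj, hY']))
    have hsum : (∑ c, A i c * f c) * x' s = ∑ c, A i c * (x' s * f c) := by
      rw [sum_mul]; exact sum_congr rfl fun c _ => by ring
    obtain ⟨⟨j, hj⟩, k, hk⟩ := hmix
    constructor
    · by_cases hjs : j = s
      · rw [SignPattern.colHub, if_pos hjs, hjs, hsum] at hj
        obtain ⟨c', -, hc'⟩ := exists_lt_of_sum_lt (s := univ) (f := fun _ => (0 : ℝ))
          (g := fun c => A i c * (x' s * f c)) (by simpa using hj)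
        refine ⟨c', ?_⟩
        rw [hxY]
        · exact hc'
        · by_contra h; simp [hf c' h] at hc'
      · rw [SignPattern.colHub, if_neg hjs] at hj
        refine ⟨j, ?_⟩
        rwa [hxn j (hnY j hjs (right_ne_zero_of_mul hj.ne'))]
    · by_cases hks : k = s
      · rw [SignPattern.colHub, if_pos hks, hks, hsum] at hk
        obtain ⟨c', -, hc'⟩ := exists_lt_of_sum_lt (s := univ) (g := fun _ => (0 : ℝ))
          (f := fun c => A i c * (x' s * f c)) (by simpa using hk)
        refine ⟨c', ?_⟩
        rw [hxY]
        · exact hc'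
        · by_contra h; simp [hf c' h] at hc'
      · rw [SignPattern.colHub, if_neg hks] at hk
        refine ⟨k, ?_⟩
        rwa [hxn k (hnY k hks (right_ne_zero_of_mul hk.ne))]

theorem SNSOn.rowHub {A : R → C → ℝ} {P Y : Finset R} {Q X : Finset C} (hA : SNSOn A P Q)
    (hPQ : P.card = Q.card) (hYX : Y.card = X.card + 1)
    (hX : X ⊆ Q) (hY : Y ⊆ P) (hz : ∀ j ∈ X, ∀ i ∈ P, i ∉ Y → A i j = 0)
    {g : R → ℝ} (hg : ∀ i, i ∉ Y → g i = 0) (hg0 : g ≠ 0)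
    (hgk : ∀ j ∈ X, ∑ i, A i j * g i = 0)
    (hm₀ : ∃ τ, IsMatching (fun j i => A i j) X Y τ)
    (hm : ∀ c ∈ Q \ X, ∀ r ∈ Y, A r c ≠ 0 →
      ∃ τ, IsMatching (fun j i => A i j) X Y τ ∧ ∀ j ∈ X, τ j ≠ r)
    {t : R} (ht : t ∈ Y) : SNSOn (SignPattern.rowHub A t g) (insert t (P \ Y)) (Q \ X) := by
  refine SNSOn.transpose ((hA.transpose hPQ).colHub hY hz hg hg0 hgk hm₀ hm ht) ?_
  rw [card_insert_of_notMem (fun h => (mem_sdiff.1 h).2 ht), card_sdiff_of_subset hX,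
    card_sdiff_of_subset hY]
  have := card_le_card hY
  omega

end Contract

section Count

variable {R C : Type u} [Fintype R] [Fintype C] [DecidableEq R] [DecidableEq C]

theorem edgesOn_congr {A B : R → C → ℝ} {P : Finset R} {Q : Finset C}
    (h : ∀ i ∈ P, ∀ j ∈ Q, A i j ≠ 0 ↔ B i j ≠ 0) : edgesOn A P Q = edgesOn B P Q := by
  unfold edgesOn
  congr 1
  refine filter_congr fun p hp => ?_
  rw [mem_product] at hp
  exact h _ hp.1 _ hp.2

theorem edgesOn_union_left (A : R → C → ℝ) {P P' : Finset R} (Q : Finset C) (h : Disjoint P P') :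
    edgesOn A (P ∪ P') Q = edgesOn A P Q + edgesOn A P' Q := by
  unfold edgesOn
  rw [union_product, filter_union, card_union_of_disjoint]
  exact disjoint_filter_filter (disjoint_product.2 (Or.inl h))

theorem edgesOn_union_right (A : R → C → ℝ) (P : Finset R) {Q Q' : Finset C} (h : Disjoint Q Q') :
    edgesOn A P (Q ∪ Q') = edgesOn A P Q + edgesOn A P Q' := by
  unfold edgesOn
  rw [product_union, filter_union, card_union_of_disjoint]
  exact disjoint_filter_filter (disjoint_product.2 (Or.inr h))

theorem edgesOn_singleton_right (A : R → C → ℝ) (P : Finset R) (s : C) :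
    edgesOn A P {s} = (P.filter fun i => A i s ≠ 0).card := by
  unfold edgesOn
  refine (card_bij (fun i _ => (i, s)) ?_ ?_ ?_).symm
  · intro i hi
    simpa using hi
  · intro i _ i' _ h
    exact (Prod.mk.injEq _ _ _ _ ▸ h).1
  · rintro ⟨i, j⟩ hp
    simp only [mem_filter, mem_product, mem_singleton] at hp
    obtain ⟨⟨h1, rfl⟩, h2⟩ := hp
    exact ⟨i, by simp [h1, h2], rfl⟩

theorem edgesOn_singleton_left (A : R → C → ℝ) (Q : Finset C) (t : R) :
    edgesOn A {t} Q = (Q.filter fun j => A t j ≠ 0).card := by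
  rw [← edgesOn_transpose, edgesOn_singleton_right]

theorem edgesOn_eq_zero {A : R → C → ℝ} {P : Finset R} {Q : Finset C}
    (h : ∀ i ∈ P, ∀ j ∈ Q, A i j = 0) : edgesOn A P Q = 0 := by
  unfold edgesOn
  rw [card_eq_zero, filter_eq_empty_iff]
  intro p hp
  rw [mem_product] at hp
  simpa using h _ hp.1 _ hp.2

end Count

/-- Every sign-nonsingular square matrix of order `N` with expansion `2` has at most `4 N - 4`
nonzero entries. -/
def EdgeBound (N : ℕ) : Prop :=
  ∀ (R C : Type u) [Fintype R] [Fintype C] [DecidableEq R] [DecidableEq C] (A : R → C → ℝ),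
    Fintype.card R = N → Fintype.card C = N → 2 ≤ N → SNSOn A univ univ → ExpOn 2 A univ univ →
      edgesOn A univ univ + 4 ≤ 4 * N

section Pieces

variable {R C : Type u} [Fintype R] [Fintype C] [DecidableEq R] [DecidableEq C]

theorem EdgeBound.edgesOn_le {A : R → C → ℝ} {P : Finset R} {Q : Finset C}
    (h : EdgeBound.{u} P.card) (hPQ : P.card = Q.card) (h2 : 2 ≤ P.card) (hA : SNSOn A P Q)
    (hE : ExpOn 2 A P Q) : edgesOn A P Q + 4 ≤ 4 * P.card := by
  rw [← edgesOn_block]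
  exact h P Q (block A P Q) (by simp) (by simp [hPQ]) h2 hA.block hE.block

variable {A B : R → C → ℝ} {a : R} {b : C} {X X' : Finset R} {Y Y' : Finset C}

theorem Tight.of_zero_block (hE : ExpOn 1 B univ univ) (hRC : Fintype.card R = Fintype.card C)
    {S : Finset R} {D : Finset C} (hS : S.Nonempty) (hD : D.Nonempty)
    (h0 : ∀ i ∈ S, ∀ j ∈ D, B i j = 0) (hc : Fintype.card R ≤ S.card + D.card + 1) :
    Tight B S Dᶜ where
  nonempty := hS
  compl_nonempty := by rwa [compl_compl]
  card_eq := by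
    have h1 := hE S (subset_univ _) D (subset_univ _) hS hD h0
    rw [card_univ] at h1
    have := card_le_univ D
    rw [card_compl]
    omega
  eq_zero := fun i hi j hj => h0 i hi j (by simpa using hj)

theorem Tight.card_add_two_le (hRC : Fintype.card R = Fintype.card C) (T : Tight B X Y) :
    X.card + 2 ≤ Fintype.card R := by
  have h1 := T.card_eq
  have h2 := card_pos.2 T.compl_nonempty
  rw [card_compl] at h2
  omega

theorem Tight.exists_matching (hE : ExpOn 1 B univ univ) (hRC : Fintype.card R = Fintype.card C)
    (T : Tight B X Y) : ∃ τ, IsMatching B X Y τ := by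
  obtain ⟨σ, hσ, -⟩ := (hE.mono (Nat.zero_le 1)).exists_matching hRC ∅
    (fun i => T.compl_nonempty.choose) ⟨by simp, by simp, by simp⟩ rfl
  exact ⟨σ, fun i hi => T.matching_mem hσ hi, fun i _ i' _ h => hσ.injective h,
    fun i _ => hσ.ne_zero i (mem_univ _)⟩

theorem Tight.exists_matching_avoiding (hE : ExpOn 1 B univ univ)
    (hRC : Fintype.card R = Fintype.card C) (T : Tight B X Y) {r : R} {c : C} (hr : r ∉ X)
    (hrc : B r c ≠ 0) : ∃ τ, IsMatching B X Y τ ∧ ∀ i ∈ X, τ i ≠ c := by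
  obtain ⟨σ, hσ, hσr⟩ := hE.exists_matching_one hRC hrc
  refine ⟨σ, ⟨fun i hi => T.matching_mem hσ hi, fun i _ i' _ h => hσ.injective h,
    fun i _ => hσ.ne_zero i (mem_univ _)⟩, fun i hi h => hr ?_⟩
  rw [← hσr] at h
  exact hσ.injective h ▸ hi

theorem Tight.sum_ne_zero (hB : SNSOn B univ univ) (hE : ExpOn 1 B univ univ)
    (hRC : Fintype.card R = Fintype.card C) (T : Tight B X Y) {f : C → ℝ}
    (hf : ∀ j, j ∉ Y → f j = 0) (hf0 : f ≠ 0) (hfk : ∀ i ∈ X, ∑ j, B i j * f j = 0)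
    {r : R} {c : C} (hr : r ∉ X) (hc : c ∈ Y) (hrc : B r c ≠ 0) : ∑ j, B r j * f j ≠ 0 := by
  intro h0
  obtain ⟨σ, hσ, hσr⟩ := hE.exists_matching_one hRC hrc
  refine hf0 (hB.eq_zero hσ f fun i => ?_)
  by_cases hi : i ∈ X
  · exact Or.inr (hfk i hi)
  by_cases hir : i = r
  · exact Or.inr (hir ▸ h0)
  · exact Or.inl (hf _ (T.matching_notMem hσ hr (hσr.symm ▸ hc) hi hir))

theorem exists_of_sum_ne_zero {f : C → ℝ} (hf : ∀ j, j ∉ Y → f j = 0) {r : R}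
    (h : ∑ j, B r j * f j ≠ 0) : ∃ c ∈ Y, B r c ≠ 0 := by
  obtain ⟨c, -, hc⟩ := exists_ne_zero_of_sum_ne_zero h
  refine ⟨c, ?_, left_ne_zero_of_mul hc⟩
  by_contra h
  rw [hf c h, mul_zero] at hc
  exact hc rfl

theorem colHub_apply_of_ne (B : R → C → ℝ) {s j : C} (f : C → ℝ) (i : R) (h : j ≠ s) :
    colHub B s f i j = B i j := if_neg h

theorem colHub_apply_self (B : R → C → ℝ) (s : C) (f : C → ℝ) (i : R) :
    colHub B s f i s = ∑ c, B i c * f c := if_pos rfl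

theorem rowHub_apply_of_ne (B : R → C → ℝ) {t i : R} (g : R → ℝ) (j : C) (h : i ≠ t) :
    rowHub B t g i j = B i j := if_neg h

theorem rowHub_apply_self (B : R → C → ℝ) (t : R) (g : R → ℝ) (j : C) :
    rowHub B t g t j = ∑ r, B r j * g r := if_pos rfl

theorem Tight.colHub_sns (hB : SNSOn B univ univ) (hE : ExpOn 1 B univ univ)
    (hRC : Fintype.card R = Fintype.card C) (T : Tight B X Y) {f : C → ℝ}
    (hf : ∀ j, j ∉ Y → f j = 0) (hf0 : f ≠ 0) (hfk : ∀ i ∈ X, ∑ j, B i j * f j = 0)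
    {s : C} (hs : s ∈ Y) : SNSOn (colHub B s f) Xᶜ (insert s Yᶜ) := by
  rw [compl_eq_univ_sdiff, compl_eq_univ_sdiff]
  exact hB.colHub (subset_univ _) (fun i hi j _ hj => T.eq_zero i hi j hj) hf hf0 hfk
    (T.exists_matching hE hRC)
    (fun r hr c _ hrc => T.exists_matching_avoiding hE hRC (mem_sdiff.1 hr).2 hrc) hs

theorem Tight.rowHub_colHub_sns (hB : SNSOn B univ univ) (hE : ExpOn 1 B univ univ)
    (hRC : Fintype.card R = Fintype.card C) (T : Tight B X Y) (T' : Tight B X' Y') (hXX : X ⊆ X')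
    {f : C → ℝ} (hf : ∀ j, j ∉ Y → f j = 0) (hf0 : f ≠ 0)
    (hfk : ∀ i ∈ X, ∑ j, B i j * f j = 0) {g : R → ℝ} (hg : ∀ i, i ∉ X'ᶜ → g i = 0) (hg0 : g ≠ 0)
    (hgk : ∀ j ∈ Y'ᶜ, ∑ i, B i j * g i = 0) {s : C} (hs : s ∈ Y) {t : R} (ht : t ∉ X') :
    SNSOn (rowHub (colHub B s f) t g) (insert t (X' \ X)) (insert s (Y' \ Y)) := by
  have hYY := T.subset hE hRC T' hXX
  have hEt := hE.transpose (by simp [hRC])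
  have T't := T'.symm hRC
  have hsY : ∀ j ∈ Y'ᶜ, j ≠ s := fun j hj h => (mem_compl.1 hj) (hYY (h ▸ hs))
  have e1 : insert t (X' \ X) = insert t (Xᶜ \ X'ᶜ) := by
    ext i; simp only [mem_insert, mem_sdiff, mem_compl]; tauto
  have e2 : insert s (Y' \ Y) = insert s Yᶜ \ Y'ᶜ := by
    ext j
    have := hYY hs
    simp only [mem_insert, mem_sdiff, mem_compl]
    constructor
    · rintro (rfl | h) <;> tauto
    · tauto
  have hcard : Xᶜ.card = (insert s Yᶜ).card := by
    rw [card_insert_of_notMem (by simpa using hs), card_compl, card_compl]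
    have := T.card_add_two_le hRC
    have := T.card_eq
    omega
  have hmt : ∀ τ : C → R, IsMatching (fun j i => B i j) Y'ᶜ X'ᶜ τ →
      IsMatching (fun j i => colHub B s f i j) Y'ᶜ X'ᶜ τ := fun τ hτ =>
    ⟨hτ.mapsTo, hτ.injOn, fun j hj => by
      rw [colHub_apply_of_ne _ _ _ (hsY j hj)]; exact hτ.ne_zero j hj⟩
  rw [e1, e2]
  refine (T.colHub_sns hB hE hRC hf hf0 hfk hs).rowHub hcard T't.card_eq ?_ ?_ ?_ hg hg0 ?_ ?_ ?_
    (mem_compl.2 ht)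
  · intro j hj
    rw [mem_compl] at hj
    exact mem_insert_of_mem (mem_compl.2 fun h => hj (hYY h))
  · exact compl_subset_compl.2 hXX
  · intro j hj i _ hi
    rw [colHub_apply_of_ne _ _ _ (hsY j hj)]
    exact T't.eq_zero j hj i hi
  · intro j hj
    simp only [colHub_apply_of_ne _ _ _ (hsY j hj)]
    exact hgk j hj
  · obtain ⟨τ, hτ⟩ := T't.exists_matching hEt hRC.symm
    exact ⟨τ, hmt τ hτ⟩
  · intro c hc r hr hrc
    obtain ⟨c', hc', hrc'⟩ : ∃ c' ∈ Y', B r c' ≠ 0 := by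
      by_cases h : c = s
      · rw [h, colHub_apply_self] at hrc
        obtain ⟨c', h1, h2⟩ := exists_of_sum_ne_zero hf hrc
        exact ⟨c', hYY h1, h2⟩
      · rw [colHub_apply_of_ne _ _ _ h] at hrc
        exact ⟨c, by simpa using (mem_sdiff.1 hc).2, hrc⟩
    obtain ⟨τ, hτ, hτr⟩ := T't.exists_matching_avoiding hEt hRC.symm (r := c') (c := r)
      (by simpa using hc') hrc'
    exact ⟨τ, hmt τ hτ, hτr⟩

theorem Tight.colHub_expOn (S : EdgeDeletion A B a b) (hB : SNSOn B univ univ)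
    (hE : ExpOn 1 B univ univ) (T : Tight B X Y)
    (hmax : ∀ X' Y', Tight B X' Y' → ¬ X ⊂ X') {f : C → ℝ}
    (hf : ∀ j, j ∉ Y → f j = 0) (hf0 : f ≠ 0) (hfk : ∀ i ∈ X, ∑ j, B i j * f j = 0)
    {s : C} (hs : s ∈ Y) : ExpOn 2 (colHub B s f) Xᶜ (insert s Yᶜ) := by
  have hRC := S.card_eq
  intro P hP Q hQ hPn hQn h0
  by_contra hlt
  have hdXP : Disjoint X P := Finset.disjoint_left.2 fun i hi hi' => (mem_compl.1 (hP hi')) hi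
  rw [card_compl] at hlt
  have hc1 := T.card_add_two_le hRC
  have hc2 := T.card_eq
  by_cases hsQ : s ∈ Q
  · have hdYQ : Disjoint (Q.erase s) Y := Finset.disjoint_left.2 fun j hj hj' => by
      have h1 := hQ (mem_of_mem_erase hj)
      rw [mem_insert, mem_compl] at h1
      exact h1.elim (ne_of_mem_erase hj) (fun h => h hj')
    have := Tight.of_zero_block hE hRC hPn (D := Q.erase s ∪ Y) ⟨s, mem_union_right _ hs⟩ (by
      intro i hi j hj
      rw [mem_union] at hj
      rcases hj with hj | hj
      · rw [← colHub_apply_of_ne B f i (ne_of_mem_erase hj)]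
        exact h0 i hi j (mem_of_mem_erase hj)
      · by_contra hij
        refine T.sum_ne_zero hB hE hRC hf hf0 hfk (mem_compl.1 (hP hi)) hj hij ?_
        rw [← colHub_apply_self B s]
        exact h0 i hi s hsQ) (by
      rw [card_union_of_disjoint hdYQ, card_erase_of_mem hsQ]
      omega)
    exact Finset.disjoint_left.1 hdXP (T.mem S).1 (this.mem S).1
  · have hsn : ∀ j ∈ Q, j ≠ s := fun j hj h => hsQ (h ▸ hj)
    have := Tight.of_zero_block hE hRC (S := X ∪ P) (D := Q) (hPn.mono subset_union_right) hQn (by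
      intro i hi j hj
      rw [mem_union] at hi
      rcases hi with hi | hi
      · have := mem_compl.1 ((mem_insert.1 (hQ hj)).resolve_left (hsn j hj))
        exact T.eq_zero i hi j this
      · rw [← colHub_apply_of_ne B f i (hsn j hj)]
        exact h0 i hi j hj) (by
      rw [card_union_of_disjoint hdXP]
      omega)
    refine hmax _ _ this (Finset.ssubset_iff_subset_ne.2 ⟨subset_union_left, fun h => ?_⟩)
    obtain ⟨i, hi⟩ := hPn
    exact Finset.disjoint_left.1 hdXP (h ▸ mem_union_right _ hi) hi

theorem Tight.sum_sum_ne_zero (S : EdgeDeletion A B a b) (hE : ExpOn 1 B univ univ)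
    (T : Tight B X Y) (T' : Tight B X' Y') (hXX : X ⊆ X')
    {f : C → ℝ} (hf : ∀ j, j ∉ Y → f j = 0) (hf0 : f ≠ 0)
    (hfk : ∀ i ∈ X, ∑ j, B i j * f j = 0) {g : R → ℝ} (hg : ∀ i, i ∉ X'ᶜ → g i = 0) (hg0 : g ≠ 0)
    (hgk : ∀ j ∈ Y'ᶜ, ∑ i, B i j * g i = 0) {r : R} {c : C} (hr : r ∉ X') (hc : c ∈ Y)
    (hrc : B r c ≠ 0) : ∑ i, (∑ j, B i j * f j) * g i ≠ 0 := by
  intro h0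
  have hYY := T.subset hE S.card_eq T' hXX
  obtain ⟨f', h', V'⟩ := exists_halfVec S.snsB hE S.card_eq T' a
  obtain ⟨f₁, h₁, V₁⟩ := exists_halfVec S.snsB hE S.card_eq T a
  have V : HalfVec B a X Y f h₁ := ⟨hf, hf0, hfk, V₁.h_supp, V₁.h_solution⟩
  obtain ⟨g₁, g₂, W₁⟩ := exists_halfVec S.symm.snsB (hE.transpose (by simp [S.card_eq]))
    S.symm.card_eq (T'.symm S.card_eq) b
  have W : HalfVec (fun j i => B i j) b Y'ᶜ X'ᶜ g g₂ := ⟨hg, hg0, hgk, W₁.h_supp, W₁.h_solution⟩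
  have hk := V.kernel S.snsB hE S.card_eq T (fun h => hr (hXX h)) hc hrc
    (fun i hi => V'.f_kernel i (hXX hi))
  set l := f' c / f c
  set p := B r c * g r * f' c with hp
  have hs := fun {r' : R} {c' : C} => cut_sign (r' := r') (c' := c') S hE T' V' W hr (hYY hc) hrc
  have key : ∀ i j, l * p * (B i j * f j * g i) = if j ∈ Y then p * (B i j * g i * f' j) else 0 := by
    intro i j
    split_ifs with hj
    · rw [hk j hj]; ring
    · rw [hf j hj]; ring
  have hnn : ∀ i j, 0 ≤ l * p * (B i j * f j * g i) := by
    intro i j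
    rw [key]
    split_ifs with hj
    · by_cases hij : B i j = 0
      · simp [hij]
      by_cases hi : i ∈ X'
      · simp [hg i (by simpa using hi)]
      · exact (hs hi (hYY hj) hij).le
    · exact le_rfl
  have hpos : 0 < l * p * (B r c * f c * g r) := by
    rw [key, if_pos hc]
    exact hs hr (hYY hc) hrc
  have : 0 < ∑ i, ∑ j, l * p * (B i j * f j * g i) :=
    sum_pos' (fun i _ => sum_nonneg fun j _ => hnn i j)
      ⟨r, mem_univ _, sum_pos' (fun j _ => hnn r j) ⟨c, mem_univ _, hpos⟩⟩
  simp only [← mul_sum, ← sum_mul] at this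
  rw [h0, mul_zero] at this
  exact lt_irrefl _ this

theorem Tight.rowHub_colHub_expOn (S : EdgeDeletion A B a b) (hB : SNSOn B univ univ)
    (hE : ExpOn 1 B univ univ) (T : Tight B X Y) (T' : Tight B X' Y') (hX : IsNext B X X')
    {f : C → ℝ} (hf : ∀ j, j ∉ Y → f j = 0) (hf0 : f ≠ 0)
    (hfk : ∀ i ∈ X, ∑ j, B i j * f j = 0) {g : R → ℝ} (hg : ∀ i, i ∉ X'ᶜ → g i = 0) (hg0 : g ≠ 0)
    (hgk : ∀ j ∈ Y'ᶜ, ∑ i, B i j * g i = 0) {s : C} (hs : s ∈ Y) {t : R} (ht : t ∉ X') :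
    ExpOn 2 (rowHub (colHub B s f) t g) (insert t (X' \ X)) (insert s (Y' \ Y)) := by
  have hRC := S.card_eq
  have hXX := hX.1.1
  have hYY := T.subset hE hRC T' hXX
  have hEt := hE.transpose (by simp [hRC])
  have hBt := hB.transpose (by simp [hRC])
  have T't := T'.symm hRC
  have hBet := T.expOn_between hE hRC T' hX
  have htn : t ∉ X' \ X := fun h => ht (mem_sdiff.1 h).1
  have hc1 := T.card_add_two_le hRC
  have hc2 := T.card_eq
  have hc3 := T'.card_add_two_le hRC
  have hc4 := T'.card_eq
  have hc5 := card_sdiff_of_subset hXX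
  have hc6 := card_le_card hXX
  intro P hP Q hQ hPn hQn h0
  rw [card_insert_of_notMem htn]
  by_contra hlt
  have hPt : P.erase t ⊆ X' \ X := fun i hi =>
    (mem_insert.1 (hP (mem_of_mem_erase hi))).resolve_left (ne_of_mem_erase hi)
  have hQs : Q.erase s ⊆ Y' \ Y := fun j hj =>
    (mem_insert.1 (hQ (mem_of_mem_erase hj))).resolve_left (ne_of_mem_erase hj)
  have hd1 : Disjoint X (P.erase t) :=
    Finset.disjoint_left.2 fun i hi hi' => (mem_sdiff.1 (hPt hi')).2 hi
  have hd2 : Disjoint X'ᶜ (P.erase t) :=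
    Finset.disjoint_left.2 fun i hi hi' => (mem_compl.1 hi) (mem_sdiff.1 (hPt hi')).1
  have hd3 : Disjoint Y (Q.erase s) :=
    Finset.disjoint_left.2 fun i hi hi' => (mem_sdiff.1 (hQs hi')).2 hi
  have hd4 : Disjoint Y'ᶜ (Q.erase s) :=
    Finset.disjoint_left.2 fun i hi hi' => (mem_compl.1 hi) (mem_sdiff.1 (hQs hi')).1
  have hd5 : Disjoint X X'ᶜ :=
    Finset.disjoint_left.2 fun i hi hi' => (mem_compl.1 hi') (hXX hi)
  have hd6 : Disjoint Y Y'ᶜ :=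
    Finset.disjoint_left.2 fun i hi hi' => (mem_compl.1 hi') (hYY hi)
  have hLM : ∀ i ∈ P.erase t, ∀ j ∈ Q.erase s, B i j = 0 := by
    intro i hi j hj
    rw [← colHub_apply_of_ne B f i (ne_of_mem_erase hj),
      ← rowHub_apply_of_ne (colHub B s f) g j (ne_of_mem_erase hi)]
    exact h0 i (mem_of_mem_erase hi) j (mem_of_mem_erase hj)
  have hLY : s ∈ Q → ∀ i ∈ P.erase t, ∀ j ∈ Y, B i j = 0 := by
    intro hsQ i hi j hj
    by_contra hij
    refine T.sum_ne_zero hB hE hRC hf hf0 hfk (mem_sdiff.1 (hPt hi)).2 hj hij ?_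
    rw [← colHub_apply_self B s, ← rowHub_apply_of_ne (colHub B s f) g s (ne_of_mem_erase hi)]
    exact h0 i (mem_of_mem_erase hi) s hsQ
  have hMX : t ∈ P → ∀ i ∈ X'ᶜ, ∀ j ∈ Q.erase s, B i j = 0 := by
    intro htP i hi j hj
    by_contra hij
    refine T't.sum_ne_zero hBt hEt hRC.symm hg hg0 hgk (r := j) (c := i) ?_ hi hij ?_
    · simpa using (mem_sdiff.1 (hQs hj)).1
    · have := h0 t htP j (mem_of_mem_erase hj)
      rw [rowHub_apply_self] at this
      simpa only [colHub_apply_of_ne B f _ (ne_of_mem_erase hj)] using this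
  have ha := (T.mem S).1
  have hb := (T'.mem S).2
  have haP : a ∉ P.erase t := fun h => Finset.disjoint_left.1 hd1 ha h
  have hbQ : b ∉ Q.erase s := fun h => hb (mem_sdiff.1 (hQs h)).1
  have hX'c : X'ᶜ.card + X'.card = Fintype.card R := by rw [card_compl]; omega
  have hY'c : Y'ᶜ.card + Y'.card = Fintype.card R := by rw [card_compl]; omega
  by_cases htP : t ∈ P <;> by_cases hsQ : s ∈ Q
  · have e1 := card_erase_of_mem htP
    have e2 := card_erase_of_mem hsQ
    have e3 := card_pos.2 hPn
    have e4 := card_pos.2 hQn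
    have hXY : ∀ i ∈ X'ᶜ, ∀ j ∈ Y, B i j = 0 := by
      intro i hi j hj
      by_contra hij
      refine T.sum_sum_ne_zero S hE T' hXX hf hf0 hfk hg hg0 hgk (mem_compl.1 hi) hj hij ?_
      have := h0 t htP s hsQ
      rw [rowHub_apply_self] at this
      simpa only [colHub_apply_self] using this
    have := Tight.of_zero_block hE hRC (S := X'ᶜ ∪ P.erase t) (D := Y ∪ Q.erase s)
      ⟨t, mem_union_left _ (mem_compl.2 ht)⟩ ⟨s, mem_union_left _ hs⟩ (by
        intro i hi j hj
        rw [mem_union] at hi hj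
        rcases hi with hi | hi <;> rcases hj with hj | hj
        · exact hXY i hi j hj
        · exact hMX htP i hi j hj
        · exact hLY hsQ i hi j hj
        · exact hLM i hi j hj) (by
      rw [card_union_of_disjoint hd2, card_union_of_disjoint hd3]
      omega)
    have h1 := (this.mem S).1
    rw [mem_union, mem_compl] at h1
    exact h1.elim (fun h => h (hXX ha)) haP
  · have e1 := card_erase_of_mem htP
    have e2 := erase_eq_of_notMem hsQ
    have e3 := card_pos.2 hPn
    rw [← e2] at hQn
    have := Tight.of_zero_block hE hRC (S := (X ∪ X'ᶜ) ∪ P.erase t) (D := Q.erase s)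
      ⟨a, mem_union_left _ (mem_union_left _ ha)⟩ hQn (by
        intro i hi j hj
        rw [mem_union, mem_union] at hi
        rcases hi with (hi | hi) | hi
        · exact T.eq_zero i hi j (mem_sdiff.1 (hQs hj)).2
        · exact hMX htP i hi j hj
        · exact hLM i hi j hj) (by
      rw [card_union_of_disjoint (disjoint_union_left.2 ⟨hd1, hd2⟩), card_union_of_disjoint hd5, e2]
      omega)
    have h1 := (this.mem S).2
    rw [mem_compl, not_not] at h1
    exact hbQ h1
  · have e1 := erase_eq_of_notMem htP
    have e2 := card_erase_of_mem hsQ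
    have e3 := card_pos.2 hQn
    rw [← e1] at hPn
    have := Tight.of_zero_block hE hRC (S := P.erase t) (D := (Y ∪ Y'ᶜ) ∪ Q.erase s)
      hPn ⟨s, mem_union_left _ (mem_union_left _ hs)⟩ (by
        intro i hi j hj
        rw [mem_union, mem_union] at hj
        rcases hj with (hj | hj) | hj
        · exact hLY hsQ i hi j hj
        · exact T'.eq_zero i (mem_sdiff.1 (hPt hi)).1 j (mem_compl.1 hj)
        · exact hLM i hi j hj) (by
      rw [card_union_of_disjoint (disjoint_union_left.2 ⟨hd3, hd4⟩), card_union_of_disjoint hd6, e1]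
      omega)
    exact haP (this.mem S).1
  · have e1 := erase_eq_of_notMem htP
    have e2 := erase_eq_of_notMem hsQ
    rw [e1] at hLM hPt
    rw [e2] at hLM hQs
    have := hBet P hPt Q hQs hPn hQn hLM
    omega

end Pieces

section Counting

variable {R C : Type u} [Fintype R] [Fintype C] [DecidableEq R] [DecidableEq C]

open Classical in
/-- The rows of `P` having a nonzero entry in some column of `Y`. -/
noncomputable def touching {R C : Type u} (B : R → C → ℝ) (P : Finset R) (Y : Finset C) :
    Finset R :=
  P.filter fun r => ∃ c ∈ Y, B r c ≠ 0

variable {A B : R → C → ℝ} {a : R} {b : C} {X X' : Finset R} {Y Y' : Finset C}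

theorem mem_touching {P : Finset R} {r : R} :
    r ∈ touching B P Y ↔ r ∈ P ∧ ∃ c ∈ Y, B r c ≠ 0 := by
  simp [touching]

theorem touching_union_left (B : R → C → ℝ) (P P' : Finset R) (Y : Finset C) :
    touching B (P ∪ P') Y = touching B P Y ∪ touching B P' Y := by
  ext r
  simp only [mem_union, mem_touching, or_and_right]

theorem touching_union_right (B : R → C → ℝ) (P : Finset R) (Y Y' : Finset C) :
    touching B P (Y ∪ Y') = touching B P Y ∪ touching B P Y' := by
  ext r
  simp only [mem_union, mem_touching, or_and_right, exists_or, and_or_left]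

theorem edgesOn_insert_left (B : R → C → ℝ) {t : R} {P : Finset R} (Q : Finset C) (ht : t ∉ P) :
    edgesOn B (insert t P) Q = (Q.filter fun j => B t j ≠ 0).card + edgesOn B P Q := by
  rw [insert_eq, edgesOn_union_left _ _ (by simpa using ht), edgesOn_singleton_left]

theorem edgesOn_insert_right (B : R → C → ℝ) (P : Finset R) {s : C} {Q : Finset C} (hs : s ∉ Q) :
    edgesOn B P (insert s Q) = (P.filter fun i => B i s ≠ 0).card + edgesOn B P Q := by
  rw [insert_eq, edgesOn_union_right _ _ (by simpa using hs), edgesOn_singleton_right]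

theorem Tight.residual_le_of_maximal (S : EdgeDeletion A B a b) (hE : ExpOn 1 B univ univ)
    (T : Tight B X Y) (hmax : ∀ X' Y', Tight B X' Y' → ¬ X ⊂ X') (hN : EdgeBound.{u} Xᶜ.card) :
    edgesOn B Xᶜ Yᶜ + (touching B Xᶜ Y).card + 4 ≤ 4 * Xᶜ.card := by
  have hRC := S.card_eq
  have hB := S.snsB
  obtain ⟨f, h, V⟩ := exists_halfVec hB hE hRC T a
  obtain ⟨s, hs⟩ : Y.Nonempty := by rw [← card_pos, T.card_eq]; omega
  have hc1 := T.card_add_two_le hRC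
  have hc2 := T.card_eq
  have hsY : s ∉ Yᶜ := by simpa using hs
  have := hN.edgesOn_le (by rw [card_insert_of_notMem hsY, card_compl, card_compl]; omega)
    (by rw [card_compl]; omega) (T.colHub_sns hB hE hRC V.f_supp V.f_ne_zero V.f_kernel hs)
    (T.colHub_expOn S hB hE hmax V.f_supp V.f_ne_zero V.f_kernel hs)
  rw [edgesOn_insert_right _ _ hsY] at this
  have h1 : edgesOn (colHub B s f) Xᶜ Yᶜ = edgesOn B Xᶜ Yᶜ := edgesOn_congr fun i _ j hj => by
    rw [colHub_apply_of_ne _ _ _ (ne_of_mem_of_not_mem hj hsY)]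
  have h2 : (touching B Xᶜ Y).card ≤ (Xᶜ.filter fun i => colHub B s f i s ≠ 0).card := by
    refine card_le_card fun r hr => ?_
    obtain ⟨hr, c, hc, hrc⟩ := mem_touching.1 hr
    rw [mem_filter, colHub_apply_self]
    exact ⟨hr, T.sum_ne_zero hB hE hRC V.f_supp V.f_ne_zero V.f_kernel (mem_compl.1 hr) hc hrc⟩
  omega

theorem Tight.between_le (S : EdgeDeletion A B a b) (hE : ExpOn 1 B univ univ)
    (T : Tight B X Y) (T' : Tight B X' Y') (hX : IsNext B X X')
    (hN : EdgeBound.{u} ((X' \ X).card + 1)) :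
    edgesOn B (X' \ X) (Y' \ Y) + (touching B (X' \ X) Y).card +
      (touching (fun j i => B i j) (Y' \ Y) X'ᶜ).card + min 1 (touching B X'ᶜ Y).card ≤
        4 * (X' \ X).card := by
  have hRC := S.card_eq
  have hB := S.snsB
  have hBt := S.symm.snsB
  have hEt := hE.transpose (by simp [hRC])
  have hXX := hX.1.1
  have hYY := T.subset hE hRC T' hXX
  have T't := T'.symm hRC
  obtain ⟨f, h, V⟩ := exists_halfVec hB hE hRC T a
  obtain ⟨g, g₂, W⟩ := exists_halfVec hBt hEt hRC.symm T't b
  obtain ⟨s, hs⟩ : Y.Nonempty := by rw [← card_pos, T.card_eq]; omega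
  obtain ⟨t, ht⟩ : X'ᶜ.Nonempty := by rw [← card_pos, T't.card_eq]; omega
  rw [mem_compl] at ht
  have hsM : s ∉ Y' \ Y := fun h => (mem_sdiff.1 h).2 hs
  have htL : t ∉ X' \ X := fun h => ht (mem_sdiff.1 h).1
  have hc1 := T.card_eq
  have hc2 := T'.card_eq
  have hc3 := card_sdiff_of_subset hXX
  have hc4 := card_sdiff_of_subset hYY
  have hc5 := card_lt_card hX.1
  rw [← card_insert_of_notMem htL] at hN
  have := hN.edgesOn_le (Q := insert s (Y' \ Y))
    (by rw [card_insert_of_notMem hsM, card_insert_of_notMem htL]; omega)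
    (by rw [card_insert_of_notMem htL]; omega)
    (T.rowHub_colHub_sns hB hE hRC T' hXX V.f_supp V.f_ne_zero V.f_kernel W.f_supp W.f_ne_zero
      W.f_kernel hs ht)
    (T.rowHub_colHub_expOn S hB hE T' hX V.f_supp V.f_ne_zero V.f_kernel W.f_supp W.f_ne_zero
      W.f_kernel hs ht)
  rw [edgesOn_insert_left _ _ htL, edgesOn_insert_right _ _ hsM, card_insert_of_notMem htL,
    filter_insert] at this
  have hti : ∀ i ∈ X' \ X, i ≠ t := fun i hi h => htL (h ▸ hi)
  have hsj : ∀ j ∈ Y' \ Y, j ≠ s := fun j hj h => hsM (h ▸ hj)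
  have h1 : edgesOn (rowHub (colHub B s f) t g) (X' \ X) (Y' \ Y) = edgesOn B (X' \ X) (Y' \ Y) :=
    edgesOn_congr fun i hi j hj => by
      rw [rowHub_apply_of_ne _ _ _ (hti i hi), colHub_apply_of_ne _ _ _ (hsj j hj)]
  have h2 : (touching B (X' \ X) Y).card ≤
      ((X' \ X).filter fun i => rowHub (colHub B s f) t g i s ≠ 0).card := by
    refine card_le_card fun r hr => ?_
    obtain ⟨hr, c, hc, hrc⟩ := mem_touching.1 hr
    rw [mem_filter, rowHub_apply_of_ne _ _ _ (hti r hr), colHub_apply_self]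
    exact ⟨hr, T.sum_ne_zero hB hE hRC V.f_supp V.f_ne_zero V.f_kernel (mem_sdiff.1 hr).2 hc hrc⟩
  have h3 : (touching (fun j i => B i j) (Y' \ Y) X'ᶜ).card ≤
      ((Y' \ Y).filter fun j => rowHub (colHub B s f) t g t j ≠ 0).card := by
    refine card_le_card fun c hc => ?_
    obtain ⟨hc, r, hr, hrc⟩ := mem_touching.1 hc
    rw [mem_filter, rowHub_apply_self]
    simp only [colHub_apply_of_ne _ _ _ (hsj c hc)]
    exact ⟨hc, T't.sum_ne_zero hBt hEt hRC.symm W.f_supp W.f_ne_zero W.f_kernel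
      (by simpa using (mem_sdiff.1 hc).1) hr hrc⟩
  have h4 : rowHub (colHub B s f) t g t s = 0 → (touching B X'ᶜ Y).card = 0 := by
    intro h0
    rw [card_eq_zero, eq_empty_iff_forall_notMem]
    intro r hr
    obtain ⟨hr, c, hc, hrc⟩ := mem_touching.1 hr
    refine T.sum_sum_ne_zero S hE T' hXX V.f_supp V.f_ne_zero V.f_kernel W.f_supp W.f_ne_zero
      W.f_kernel (mem_compl.1 hr) hc hrc ?_
    rw [rowHub_apply_self] at h0
    simpa only [colHub_apply_self] using h0
  split_ifs at this with h
  · rw [card_insert_of_notMem (by simp [hs])] at this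
    omega
  · rw [h4 (by simpa using h)]
    omega

theorem Tight.edgesOn_add_one_le (S : EdgeDeletion A B a b) (hE : ExpOn 1 B univ univ)
    (T : Tight B X Y) {P : Finset R} {Q : Finset C} (hP : P ⊆ Xᶜ) (hQ : Q ⊆ Y)
    (h0 : edgesOn B P Q ≠ 0) : edgesOn B P Q + 1 ≤
      (touching B P Q).card + (touching (fun j i => B i j) Q P).card := by
  obtain ⟨γ, η, h⟩ := cut_order S hE T
  have := card_add_one_le_of_order (γ := γ) (η := η) ((P ×ˢ Q).filter (fun p => B p.1 p.2 ≠ 0))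
    (card_ne_zero.1 h0) (by
      intro p hp q hq h1 h2
      simp only [mem_filter, mem_product] at hp hq
      exact h _ _ _ _ (mem_compl.1 (hP hp.1.1)) (hQ hp.1.2) hp.2 (mem_compl.1 (hP hq.1.1))
        (hQ hq.1.2) hq.2 h1 h2)
  refine this.trans (Nat.add_le_add (card_le_card ?_) (card_le_card ?_))
  · intro r hr
    simp only [mem_image, mem_filter, mem_product] at hr
    obtain ⟨p, ⟨⟨h1, h2⟩, h3⟩, rfl⟩ := hr
    exact mem_touching.2 ⟨h1, _, h2, h3⟩
  · intro r hr
    simp only [mem_image, mem_filter, mem_product] at hr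
    obtain ⟨p, ⟨⟨h1, h2⟩, h3⟩, rfl⟩ := hr
    exact mem_touching.2 ⟨h2, _, h1, h3⟩

theorem Tight.residual_le (S : EdgeDeletion A B a b) (hE : ExpOn 1 B univ univ)
    (hN : ∀ M < Fintype.card R, EdgeBound.{u} M) (T : Tight B X Y) :
    edgesOn B Xᶜ Yᶜ + (touching B Xᶜ Y).card + 4 ≤ 4 * Xᶜ.card := by
  have hRC := S.card_eq
  induction hn : Xᶜ.card using Nat.strong_induction_on generalizing X Y with
  | _ n ih =>
  subst hn
  have hXpos := card_pos.2 T.nonempty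
  have hXc : Xᶜ.card + X.card = Fintype.card R := by
    rw [card_compl]; have := card_le_univ X; omega
  by_cases hmax : ∀ X' Y', Tight B X' Y' → ¬ X ⊂ X'
  · exact T.residual_le_of_maximal S hE hmax (hN _ (by omega))
  push Not at hmax
  obtain ⟨X', Y', T', hX', hmin⟩ : ∃ X' Y', Tight B X' Y' ∧ X ⊂ X' ∧
      ∀ X'' Y'', Tight B X'' Y'' → X ⊂ X'' → X'.card ≤ X''.card := by
    classical
    have hne : (univ.filter fun Z : Finset R => X ⊂ Z ∧ ∃ W, Tight B Z W).Nonempty := by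
      obtain ⟨Z, W, h1, h2⟩ := hmax
      exact ⟨Z, by simpa using ⟨h2, W, h1⟩⟩
    obtain ⟨Z, hZ, hmin⟩ := exists_min_image _ card hne
    simp only [mem_filter, mem_univ, true_and] at hZ hmin
    obtain ⟨hZ, W, hW⟩ := hZ
    exact ⟨Z, W, hW, hZ, fun X'' Y'' h1 h2 => hmin X'' ⟨h2, Y'', h1⟩⟩
  have hnext : IsNext B X X' :=
    ⟨hX', fun X'' Y'' h1 h2 h3 => eq_of_subset_of_card_le h3 (hmin X'' Y'' h1 h2)⟩
  have hXX := hX'.1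
  have hYY := T.subset hE hRC T' hXX
  have hX'c : X'ᶜ.card + X'.card = Fintype.card R := by
    rw [card_compl]; have := card_le_univ X'; omega
  have hL := card_sdiff_of_subset hXX
  have hlt := card_lt_card hX'
  have hT'c := T'.card_add_two_le hRC
  have e1 := T.between_le S hE T' hnext (hN _ (by omega))
  have e2 := ih X'ᶜ.card (by omega) T' rfl
  have hXu : Xᶜ = X' \ X ∪ X'ᶜ := by
    ext i; have := @hXX i; simp only [mem_compl, mem_union, mem_sdiff]; tauto
  have hYu : Yᶜ = Y' \ Y ∪ Y'ᶜ := by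
    ext i; have := @hYY i; simp only [mem_compl, mem_union, mem_sdiff]; tauto
  have hY'u : Y' = Y ∪ Y' \ Y := (union_sdiff_of_subset hYY).symm
  have hdX : Disjoint (X' \ X) X'ᶜ := Finset.disjoint_left.2 fun i hi hi' =>
    (mem_compl.1 hi') (mem_sdiff.1 hi).1
  have hdY : Disjoint (Y' \ Y) Y'ᶜ := Finset.disjoint_left.2 fun i hi hi' =>
    (mem_compl.1 hi') (mem_sdiff.1 hi).1
  have e3 : edgesOn B Xᶜ Yᶜ = edgesOn B (X' \ X) (Y' \ Y) + edgesOn B X'ᶜ (Y' \ Y) +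
      edgesOn B X'ᶜ Y'ᶜ := by
    rw [hXu, hYu, edgesOn_union_left _ _ hdX, edgesOn_union_right _ _ hdY,
      edgesOn_union_right _ _ hdY, edgesOn_eq_zero (P := X' \ X) (Q := Y'ᶜ)]
    · ring
    · intro i hi j hj
      exact T'.eq_zero i (mem_sdiff.1 hi).1 j (mem_compl.1 hj)
  have e4 : (touching B Xᶜ Y).card ≤ (touching B (X' \ X) Y).card + (touching B X'ᶜ Y).card := by
    rw [hXu, touching_union_left]
    exact card_union_le _ _
  have e5 : (touching B X'ᶜ Y').card + (touching B X'ᶜ Y ∩ touching B X'ᶜ (Y' \ Y)).card =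
      (touching B X'ᶜ Y).card + (touching B X'ᶜ (Y' \ Y)).card := by
    rw [← card_union_add_card_inter (touching B X'ᶜ Y), ← touching_union_right, ← hY'u]
  have e6 : (touching B X'ᶜ Y ∩ touching B X'ᶜ (Y' \ Y)).card ≤ 2 := by
    refine le_trans (card_le_card fun r hr => ?_) (card_overlap_le_two S hE T T' hnext)
    rw [mem_inter, mem_touching, mem_touching, mem_compl] at hr
    simp only [mem_filter, mem_univ, true_and]
    exact ⟨hr.1.1, hr.1.2, hr.2.2⟩
  have e7 : (touching B X'ᶜ Y ∩ touching B X'ᶜ (Y' \ Y)).card ≤ (touching B X'ᶜ Y).card :=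
    card_le_card inter_subset_left
  have e8 : (touching B X'ᶜ Y).card ≤ (touching B X'ᶜ Y').card := by
    rw [hY'u, touching_union_right]
    exact card_le_card subset_union_left
  by_cases hF : edgesOn B X'ᶜ (Y' \ Y) = 0
  · omega
  have e9 := T'.edgesOn_add_one_le S hE (P := X'ᶜ) (Q := Y' \ Y) Subset.rfl sdiff_subset hF
  omega

theorem EdgeDeletion.edgesOn_eq (S : EdgeDeletion A B a b) :
    edgesOn A univ univ = edgesOn B univ univ + 1 := by
  unfold edgesOn
  have : (univ ×ˢ univ : Finset (R × C)).filter (fun p => A p.1 p.2 ≠ 0) =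
      insert (a, b) ((univ ×ˢ univ : Finset (R × C)).filter (fun p => B p.1 p.2 ≠ 0)) := by
    ext ⟨i, j⟩
    simp only [mem_filter, mem_product, mem_univ, true_and, mem_insert, Prod.mk.injEq, S.eq_ite]
    by_cases h : i = a ∧ j = b
    · simp [h, S.ne_zero]
    · simp [h]
  rw [this, card_insert_of_notMem]
  simp [S.apply_self]

theorem EdgeDeletion.edgesOn_le (S : EdgeDeletion A B a b) (hR : 3 ≤ Fintype.card R)
    (hN : ∀ M < Fintype.card R, EdgeBound.{u} M) (hT : ∃ X Y, Tight B X Y) :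
    edgesOn A univ univ + 4 ≤ 4 * Fintype.card R := by
  have hRC := S.card_eq
  have hE := S.expB hR
  have hEt := hE.transpose (by simp [hRC])
  obtain ⟨X, Y, T, hmin⟩ : ∃ X Y, Tight B X Y ∧ ∀ X' Y', Tight B X' Y' → X.card ≤ X'.card := by
    classical
    have hne : (univ.filter fun Z : Finset R => ∃ W, Tight B Z W).Nonempty := by
      obtain ⟨Z, W, h1⟩ := hT
      exact ⟨Z, by simpa using ⟨W, h1⟩⟩
    obtain ⟨Z, hZ, hmin⟩ := exists_min_image _ card hne
    simp only [mem_filter, mem_univ, true_and] at hZ hmin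
    obtain ⟨W, hW⟩ := hZ
    exact ⟨Z, W, hW, fun X' Y' h => hmin X' ⟨Y', h⟩⟩
  have hXpos := card_pos.2 T.nonempty
  have hXc : Xᶜ.card + X.card = Fintype.card R := by
    rw [card_compl]; have := card_le_univ X; omega
  have hc1 := T.card_add_two_le hRC
  have hc2 := T.card_eq
  have e1 := T.residual_le S hE hN
  have e2 := (T.symm hRC).residual_le_of_maximal S.symm hEt (by
    intro P Q hPQ hlt
    have h1 := hPQ.symm hRC.symm
    have h2 := hmin _ _ h1
    have h3 := card_lt_card hlt
    have h4 := hPQ.card_eq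
    have h5 := card_le_univ Q
    have h6 := card_le_univ Y
    rw [card_compl] at h2 h3
    omega) (hN _ (by rw [compl_compl]; omega))
  simp only [compl_compl] at e2
  rw [edgesOn_transpose] at e2
  have e3 : edgesOn B univ univ = edgesOn B X Y + edgesOn B Xᶜ Y + edgesOn B Xᶜ Yᶜ := by
    rw [← union_compl X, ← union_compl Y, edgesOn_union_left _ _ disjoint_compl_right,
      edgesOn_union_right _ _ disjoint_compl_right, edgesOn_union_right _ _ disjoint_compl_right,
      edgesOn_eq_zero (P := X) (Q := Yᶜ)]
    · ring
    · intro i hi j hj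
      exact T.eq_zero i hi j (mem_compl.1 hj)
  have e4 := S.edgesOn_eq
  have hF : edgesOn B Xᶜ Y ≠ 0 := by
    intro h0
    have h1 := hE Xᶜ (subset_univ _) Y (subset_univ _) (by rw [← card_pos]; omega)
      (by rw [← card_pos]; omega) (by
        intro i hi j hj
        by_contra hij
        unfold edgesOn at h0
        rw [card_eq_zero, filter_eq_empty_iff] at h0
        exact h0 (mem_product.2 ⟨hi, hj⟩ : (i, j) ∈ _) hij)
    rw [card_univ] at h1
    omega
  have e5 := T.edgesOn_add_one_le S hE (P := Xᶜ) (Q := Y) Subset.rfl Subset.rfl hF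
  omega

end Counting

theorem edgesOn_eq_sum {R C : Type u} [Fintype R] [Fintype C] [DecidableEq R] [DecidableEq C]
    (A : R → C → ℝ) (P : Finset R) (Q : Finset C) :
    edgesOn A P Q = ∑ i ∈ P, (Q.filter fun j => A i j ≠ 0).card := by
  induction P using Finset.induction_on with
  | empty => simp [edgesOn]
  | insert t P ht ih => rw [sum_insert ht, ← ih, edgesOn_insert_left _ _ ht]

theorem edgeBound (N : ℕ) : EdgeBound.{u} N := by
  induction N using Nat.strong_induction_on with
  | _ N ihN =>
  suffices H : ∀ (e : ℕ) (R C : Type u) [Fintype R] [Fintype C] [DecidableEq R] [DecidableEq C]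
      (A : R → C → ℝ), Fintype.card R = N → Fintype.card C = N → 2 ≤ N → SNSOn A univ univ →
      ExpOn 2 A univ univ → edgesOn A univ univ = e → edgesOn A univ univ + 4 ≤ 4 * N by
    intro R C _ _ _ _ A hR hC h2 hA hE
    exact H _ R C A hR hC h2 hA hE rfl
  intro e
  induction e with
  | zero =>
    intro R C _ _ _ _ A hR hC h2 hA hE he
    omega
  | succ e ih =>
    intro R C _ _ _ _ A hR hC h2 hA hE he
    by_contra hlt
    by_cases h3 : N = 2
    · have : edgesOn A univ univ ≤ 2 * 2 := by
        unfold edgesOn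
        refine (card_filter_le _ _).trans ?_
        rw [card_product, card_univ, card_univ, hR, hC, h3]
      omega
    have h3 : 3 ≤ Fintype.card R := by omega
    have hdel : ∀ a b, A a b ≠ 0 → ∃ B, EdgeDeletion A B a b ∧ ExpOn 2 B univ univ := by
      intro a b hab
      let B : R → C → ℝ := fun i j => if i = a ∧ j = b then 0 else A i j
      have S : EdgeDeletion A B a b := ⟨by omega, hA, hE, hab, fun i j => rfl⟩
      refine ⟨B, S, ?_⟩
      intro P _ Q _ hP hQ h0
      by_contra hc
      rw [card_univ] at hc
      have := S.edgesOn_le h3 (by rwa [hR]) ⟨P, Qᶜ,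
        Tight.of_zero_block (S.expB h3) S.card_eq hP hQ h0 (by omega)⟩
      omega
    have hne : ∀ i, ∃ j, A i j ≠ 0 := by
      intro i
      by_contra h
      push Not at h
      have := hE {i} (subset_univ _) univ (subset_univ _) (singleton_nonempty _)
        (by rw [← card_pos, card_univ]; omega) (by intro i' hi' j _; rw [mem_singleton.1 hi']; exact h j)
      simp only [card_univ, card_singleton] at this
      omega
    have hup : edgesOn A univ univ < 4 * N := by
      obtain ⟨i⟩ : Nonempty R := Fintype.card_pos_iff.1 (by omega)
      obtain ⟨j, hij⟩ := hne i
      obtain ⟨B, S, hB⟩ := hdel i j hij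
      have e1 := S.edgesOn_eq
      have := ih R C B hR hC h2 S.snsB hB (by omega)
      omega
    obtain ⟨i, hi⟩ : ∃ i : R, (univ.filter fun j => A i j ≠ 0).card < 4 := by
      by_contra h
      push Not at h
      have := sum_le_sum (s := (univ : Finset R)) fun i _ => h i
      rw [← edgesOn_eq_sum, sum_const, card_univ, smul_eq_mul, hR] at this
      omega
    obtain ⟨j, hij⟩ := hne i
    obtain ⟨B, S, hB⟩ := hdel i j hij
    have h4 : (univ.filter fun k => A i k = 0).card + (univ.filter fun k => A i k ≠ 0).card =
        Fintype.card C := by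
      rw [card_filter_add_card_filter_not, card_univ]
    have h5 : ((univ.filter fun k => B i k = 0)).card =
        (univ.filter fun k => A i k = 0).card + 1 := by
      rw [← card_insert_of_notMem (a := j) (s := univ.filter fun k => A i k = 0) (by simp [hij])]
      congr 1
      ext k
      simp only [mem_filter, mem_univ, true_and, mem_insert, S.eq_ite]
      by_cases hk : k = j <;> simp [hk]
    have := hB {i} (subset_univ _) (univ.filter fun k => B i k = 0) (subset_univ _)
      (singleton_nonempty _) (by rw [← card_pos]; omega)
      (by intro i' hi' k hk; rw [mem_singleton.1 hi']; exact (mem_filter.1 hk).2)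
    rw [card_singleton, card_univ] at this
    omega

section Regular

variable {R C : Type u} [Fintype R] [Fintype C] [DecidableEq R] [DecidableEq C]
variable {A : R → C → ℝ} {X : Finset R} {Y : Finset C}

theorem Tight.false_of_minimal (hA : SNSOn A univ univ) (hE : ExpOn 1 A univ univ)
    (hRC : Fintype.card R = Fintype.card C) (T : Tight A X Y)
    (hmin : ∀ X' Y', Tight A X' Y' → Yᶜ.card ≤ X'.card ∧ Yᶜ.card ≤ Y'ᶜ.card)
    (hdeg : ∀ j, 4 ≤ (univ.filter fun i => A i j ≠ 0).card) : False := by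
  obtain ⟨f, h, V⟩ := exists_halfVec hA hE hRC T T.nonempty.choose
  obtain ⟨s, hs⟩ : Y.Nonempty := by rw [← card_pos, T.card_eq]; omega
  have hsY : s ∉ Yᶜ := by simpa using hs
  have hc1 := T.card_add_two_le hRC
  have hc2 := T.card_eq
  have hXc : Xᶜ.card + X.card = Fintype.card R := by
    rw [card_compl]; have := card_le_univ X; omega
  have hYc : Yᶜ.card + Y.card = Fintype.card R := by
    rw [card_compl]; have := card_le_univ Y; omega
  have hexp : ExpOn 2 (colHub A s f) Xᶜ (insert s Yᶜ) := by
    intro P hP Q hQ hPn hQn h0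
    by_contra hlt
    have hdXP : Disjoint X P := Finset.disjoint_left.2 fun i hi hi' => (mem_compl.1 (hP hi')) hi
    have hPpos := card_pos.2 hPn
    have hQpos := card_pos.2 hQn
    by_cases hsQ : s ∈ Q
    · have hdYQ : Disjoint (Q.erase s) Y := Finset.disjoint_left.2 fun j hj hj' => by
        have h1 := hQ (mem_of_mem_erase hj)
        rw [mem_insert, mem_compl] at h1
        exact h1.elim (ne_of_mem_erase hj) (fun h => h hj')
      have hcard := card_union_of_disjoint hdYQ
      rw [card_erase_of_mem hsQ] at hcard
      have T' := Tight.of_zero_block hE hRC hPn (D := Q.erase s ∪ Y) ⟨s, mem_union_right _ hs⟩ (by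
        intro i hi j hj
        rw [mem_union] at hj
        rcases hj with hj | hj
        · rw [← colHub_apply_of_ne A f i (ne_of_mem_erase hj)]
          exact h0 i hi j (mem_of_mem_erase hj)
        · by_contra hij
          refine T.sum_ne_zero hA hE hRC V.f_supp V.f_ne_zero V.f_kernel (mem_compl.1 (hP hi)) hj
            hij ?_
          rw [← colHub_apply_self A s]
          exact h0 i hi s hsQ) (by omega)
      have h1 := (hmin _ _ T').1
      have h2 := T'.card_eq
      have h3 := card_le_univ (Q.erase s ∪ Y)
      rw [card_compl] at h2
      omega
    · have hsn : ∀ j ∈ Q, j ≠ s := fun j hj h => hsQ (h ▸ hj)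
      have hcard := card_union_of_disjoint hdXP
      have T' := Tight.of_zero_block hE hRC (S := X ∪ P) (D := Q) (hPn.mono subset_union_right)
        hQn (by
          intro i hi j hj
          rw [mem_union] at hi
          rcases hi with hi | hi
          · have := mem_compl.1 ((mem_insert.1 (hQ hj)).resolve_left (hsn j hj))
            exact T.eq_zero i hi j this
          · rw [← colHub_apply_of_ne A f i (hsn j hj)]
            exact h0 i hi j hj) (by omega)
      have h1 := (hmin _ _ T').2
      have h2 := T'.card_eq
      have h3 := card_le_univ Q
      rw [compl_compl] at h1
      rw [card_compl] at h2
      omega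
  have hle := (edgeBound Xᶜ.card).edgesOn_le (by rw [card_insert_of_notMem hsY]; omega)
    (by omega) (T.colHub_sns hA hE hRC V.f_supp V.f_ne_zero V.f_kernel hs) hexp
  rw [edgesOn_insert_right _ _ hsY] at hle
  have h1 : edgesOn (colHub A s f) Xᶜ Yᶜ = edgesOn A Xᶜ Yᶜ := edgesOn_congr fun i _ j hj => by
    rw [colHub_apply_of_ne _ _ _ (ne_of_mem_of_not_mem hj hsY)]
  have h2 : 0 < (Xᶜ.filter fun i => colHub A s f i s ≠ 0).card := by
    rw [card_pos]
    by_contra hne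
    rw [not_nonempty_iff_eq_empty, filter_eq_empty_iff] at hne
    have := hE Xᶜ (subset_univ _) Y (subset_univ _) (by rw [← card_pos]; omega)
      (by rw [← card_pos]; omega) (by
        intro i hi j hj
        by_contra hij
        refine hne hi ?_
        rw [colHub_apply_self]
        exact T.sum_ne_zero hA hE hRC V.f_supp V.f_ne_zero V.f_kernel (mem_compl.1 hi) hj hij)
    rw [card_univ] at this
    omega
  have h3 : 4 * Yᶜ.card ≤ edgesOn A Xᶜ Yᶜ := by
    rw [← edgesOn_transpose, edgesOn_eq_sum, mul_comm, ← smul_eq_mul, ← sum_const]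
    refine sum_le_sum fun j hj => (hdeg j).trans (card_le_card fun i hi => ?_)
    rw [mem_filter] at hi ⊢
    exact ⟨mem_compl.2 fun hiX => hi.2 (T.eq_zero i hiX j (mem_compl.1 hj)), hi.2⟩
  omega

theorem false_of_four_le_degree (hA : SNSOn A univ univ) (hE : ExpOn 1 A univ univ)
    (hRC : Fintype.card R = Fintype.card C) (h2 : 2 ≤ Fintype.card R)
    (hrow : ∀ i, 4 ≤ (univ.filter fun j => A i j ≠ 0).card)
    (hcol : ∀ j, 4 ≤ (univ.filter fun i => A i j ≠ 0).card) : False := by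
  by_cases hT : ∃ n X Y, Tight A X Y ∧ (X.card = n ∨ Yᶜ.card = n)
  · classical
    obtain ⟨X, Y, T, hn⟩ := Nat.find_spec hT
    have hmin : ∀ X' Y', Tight A X' Y' → Nat.find hT ≤ X'.card ∧ Nat.find hT ≤ Y'ᶜ.card :=
      fun X' Y' T' => ⟨Nat.find_min' hT ⟨X', Y', T', Or.inl rfl⟩,
        Nat.find_min' hT ⟨X', Y', T', Or.inr rfl⟩⟩
    rcases hn with hn | hn
    · refine (T.symm hRC).false_of_minimal (hA.transpose (by simp [hRC]))
        (hE.transpose (by simp [hRC])) hRC.symm (fun P Q T' => ?_) hrow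
      have := hmin _ _ (T'.symm hRC.symm)
      rw [compl_compl] at this
      rw [compl_compl, hn]
      exact this.symm
    · refine T.false_of_minimal hA hE hRC (fun X' Y' T' => ?_) hcol
      rw [hn]
      exact hmin X' Y' T'
  · have hE2 : ExpOn 2 A univ univ := by
      intro P _ Q _ hP hQ h0
      by_contra hlt
      rw [card_univ] at hlt
      exact hT ⟨_, P, Qᶜ, Tight.of_zero_block hE hRC hP hQ h0 (by omega), Or.inl rfl⟩
    have h3 := edgeBound _ R C A rfl hRC.symm h2 hA hE2
    have h4 : 4 * Fintype.card R ≤ edgesOn A univ univ := by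
      rw [edgesOn_eq_sum, mul_comm, ← smul_eq_mul, ← card_univ, ← sum_const]
      exact sum_le_sum fun i _ => hrow i
    omega

end Regular

section Hypergraph

variable {V : Type u} [Fintype V] [DecidableEq V]

/-- The incidence matrix of hyperedges against vertices. -/
def incidence (f : Finset V) (v : V) : ℝ := if v ∈ f then 1 else 0

theorem incidence_ne_zero {f : Finset V} {v : V} : incidence f v ≠ 0 ↔ v ∈ f := by
  simp [incidence]

theorem mixed_incidence {x : V → ℝ} {f : Finset V} :
    Mixed incidence x f ↔ (∃ v ∈ f, 0 < x v) ∧ ∃ v ∈ f, x v < 0 := by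
  have h : ∀ v, incidence f v * x v = if v ∈ f then x v else 0 := fun v => by
    simp [incidence]
  unfold Mixed
  simp only [h]
  constructor
  · rintro ⟨⟨v, hv⟩, w, hw⟩
    split_ifs at hv hw with h1 h2
    · exact ⟨⟨v, h1, hv⟩, w, h2, hw⟩
    all_goals simp at *
  · rintro ⟨⟨v, h1, hv⟩, w, h2, hw⟩
    exact ⟨⟨v, by rwa [if_pos h1]⟩, w, by rwa [if_pos h2]⟩

/-- A hypergraph that is not 2-colorable but all of whose proper subfamilies are. -/
structure IsCritical (H : Finset (Finset V)) : Prop where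
  not_colorable : ∀ c, ¬ IsProper2Coloring H c
  colorable : ∀ H' ⊂ H, ∃ c, IsProper2Coloring H' c

theorem exists_isCritical {H : Finset (Finset V)} (h : ∀ c, ¬ IsProper2Coloring H c) :
    ∃ H' ⊆ H, IsCritical H' := by
  induction H using Finset.strongInduction with
  | H H ih =>
  by_cases hc : ∀ H' ⊂ H, ∃ c, IsProper2Coloring H' c
  · exact ⟨H, Subset.rfl, h, hc⟩
  · push Not at hc
    obtain ⟨H', hH', hc⟩ := hc
    obtain ⟨H'', h1, h2⟩ := ih H' hH' hc
    exact ⟨H'', h1.trans hH'.1, h2⟩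

/-- The vertices covered by the hyperedges of `H`. -/
def cover (H : Finset (Finset V)) : Finset V := H.biUnion id

theorem subset_cover {H : Finset (Finset V)} {f : Finset V} (hf : f ∈ H) : f ⊆ cover H :=
  subset_biUnion_of_mem id hf

variable {H : Finset (Finset V)}

theorem IsCritical.exists_not_mixed (hH : IsCritical H) {x : V → ℝ} {v : V} (hv : v ∈ cover H)
    (hxv : x v ≠ 0) : ∃ f ∈ H, (∃ w ∈ f, x w ≠ 0) ∧ ¬ Mixed incidence x f := by
  by_contra hcon
  push Not at hcon
  obtain ⟨f₀, hf₀, hvf⟩ := mem_biUnion.1 hv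
  classical
  obtain ⟨c₀, hc₀⟩ := hH.colorable (H.filter fun f => ∀ w ∈ f, x w = 0)
    ⟨filter_subset _ _, fun h => hxv ((mem_filter.1 (h hf₀)).2 v hvf)⟩
  refine hH.not_colorable (fun w => if 0 < x w then true else if x w < 0 then false else c₀ w) ?_
  intro f hf
  by_cases hx : ∀ w ∈ f, x w = 0
  · obtain ⟨u, hu, w, hw, huw⟩ := hc₀ f (mem_filter.2 ⟨hf, hx⟩)
    exact ⟨u, hu, w, hw, by simpa [hx u hu, hx w hw] using huw⟩
  · push Not at hx
    obtain ⟨w, hw, hxw⟩ := hx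
    obtain ⟨⟨u, hu, hxu⟩, w, hw, hxw⟩ := mixed_incidence.1 (hcon f hf ⟨w, hw, hxw⟩)
    exact ⟨u, hu, w, hw, by simp [hxu, hxw, hxw.le]⟩

theorem IsCritical.snsOn (hH : IsCritical H) : SNSOn incidence H (cover H) := by
  intro σ hσ x hxQ hx0
  obtain ⟨v, hv⟩ := Function.ne_iff.1 hx0
  have hvQ : v ∈ cover H := by
    by_contra h
    exact hv (hxQ v h)
  clear hxQ hx0
  by_contra hcon
  push Not at hcon
  induction hn : (univ.filter fun w => x w = 0).card using Nat.strong_induction_on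
    generalizing x with
  | _ n ih =>
  subst hn
  obtain ⟨f, hf, ⟨w, hw, hxw⟩, hmix⟩ := hH.exists_not_mixed hvQ hv
  have hσf : x (σ f) = 0 := by
    by_contra h
    exact hmix (hcon f hf h)
  have hσm : σ f ∈ f := incidence_ne_zero.1 (hσ.ne_zero f hf)
  have hne : ∀ u, x u ≠ 0 → Function.update x (σ f) (-x w) u = x u := fun u hu =>
    Function.update_of_ne (fun h : u = σ f => hu (by rw [h, hσf])) _ _
  have hself : Function.update x (σ f) (-x w) (σ f) = -x w := Function.update_self _ _ _
  refine ih _ ?_ (Function.update x (σ f) (-x w)) (by rw [hne v hv]; exact hv) ?_ rfl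
  · refine card_lt_card ⟨fun u hu => ?_, fun h => ?_⟩
    · simp only [mem_filter, mem_univ, true_and] at hu ⊢
      by_contra hxu
      exact hxu (by rw [← hne u hxu]; exact hu)
    · have := h (mem_filter.2 ⟨mem_univ _, hσf⟩ : σ f ∈ univ.filter fun u => x u = 0)
      rw [mem_filter, hself] at this
      exact hxw (neg_eq_zero.1 this.2)
  · intro f' hf' hx'
    rw [mixed_incidence]
    by_cases hff : σ f' = σ f
    · obtain rfl := hσ.injOn f' hf' f hf hff
      rcases lt_or_gt_of_ne hxw with h | h
      · exact ⟨⟨σ f', hσm, by rw [hself]; linarith⟩, w, hw, by rw [hne w hxw]; exact h⟩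
      · exact ⟨⟨w, hw, by rw [hne w hxw]; exact h⟩, σ f', hσm, by rw [hself]; linarith⟩
    · rw [Function.update_of_ne hff] at hx'
      obtain ⟨⟨p, hp, hxp⟩, q, hq, hxq⟩ := mixed_incidence.1 (hcon f' hf' hx')
      exact ⟨⟨p, hp, by rw [hne p hxp.ne']; exact hxp⟩, q, hq, by rw [hne q hxq.ne]; exact hxq⟩

theorem IsCritical.card_cover_le (hH : IsCritical H) : (cover H).card ≤ H.card := by
  by_contra hlt
  let φ : (cover H → ℝ) →ₗ[ℝ] (H → ℝ) :=
    Matrix.mulVecLin (Matrix.of (block incidence H (cover H)))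
  have hker : LinearMap.ker φ ≠ ⊥ := by
    refine LinearMap.ker_ne_bot_of_finrank_lt ?_
    simpa using hlt
  obtain ⟨x, hx, hx0⟩ := (Submodule.ne_bot_iff _).1 hker
  obtain ⟨⟨v, hv⟩, hxv⟩ := Function.ne_iff.1 hx0
  let y : V → ℝ := fun j => if h : j ∈ cover H then x ⟨j, h⟩ else 0
  obtain ⟨f, hf, ⟨w, hw, hyw⟩, hmix⟩ := hH.exists_not_mixed (x := y) hv (by simpa [y, hv] using hxv)
  refine hmix (mixed_of_sum_eq_zero (k := w) ?_ (mul_ne_zero (incidence_ne_zero.2 hw) hyw))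
  have h1 : ∑ j : cover H, incidence f j * x j = 0 := congrFun (LinearMap.mem_ker.1 hx) ⟨f, hf⟩
  rw [← sum_subset (subset_univ (cover H)) (fun j _ hj => by simp [y, hj]),
    ← sum_coe_sort (cover H), ← h1]
  exact sum_congr rfl fun j _ => by simp [y]

theorem sum_hyperDegree {S : Finset (Finset V)} {W : Finset V} (h : ∀ f ∈ S, f ⊆ W) :
    ∑ v ∈ W, hyperDegree S v = ∑ f ∈ S, f.card := by
  unfold hyperDegree
  simp only [card_filter]
  rw [sum_comm]
  refine sum_congr rfl fun f hf => ?_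
  rw [← card_filter, filter_mem_eq_inter, inter_eq_right.2 (h f hf)]

variable {k : ℕ}

theorem IsCritical.card_cover (hH : IsCritical H) (hk : 0 < k) (hu : ∀ f ∈ H, f.card = k)
    (hd : ∀ v, hyperDegree H v ≤ k) : H.card = (cover H).card := by
  refine le_antisymm ?_ hH.card_cover_le
  have h1 := sum_hyperDegree (S := H) fun f hf => subset_cover hf
  rw [sum_congr rfl hu, sum_const, smul_eq_mul] at h1
  have h2 := sum_le_sum (s := cover H) fun v _ => hd v
  rw [h1, sum_const, smul_eq_mul] at h2
  exact Nat.le_of_mul_le_mul_right h2 hk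

theorem IsCritical.hyperDegree_eq (hH : IsCritical H) (hk : 0 < k) (hu : ∀ f ∈ H, f.card = k)
    (hd : ∀ v, hyperDegree H v ≤ k) {v : V} (hv : v ∈ cover H) : hyperDegree H v = k := by
  have h1 := sum_hyperDegree (S := H) fun f hf => subset_cover hf
  rw [sum_congr rfl hu, sum_const, hH.card_cover hk hu hd, ← sum_const] at h1
  exact (sum_eq_sum_iff_of_le fun v _ => hd v).1 h1 v hv

theorem hyperDegree_mono {S : Finset (Finset V)} (h : S ⊆ H) (v : V) :
    hyperDegree S v ≤ hyperDegree H v :=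
  card_le_card (filter_subset_filter _ h)

theorem IsCritical.expOn (hH : IsCritical H) (hk : 0 < k) (hu : ∀ f ∈ H, f.card = k)
    (hd : ∀ v, hyperDegree H v ≤ k) : ExpOn 1 incidence H (cover H) := by
  intro S hS T hT hSn hTn h0
  by_contra hlt
  have hcard := hH.card_cover hk hu hd
  have hdis : ∀ f ∈ S, ∀ v ∈ T, v ∉ f := fun f hf v hv h => incidence_ne_zero.2 h (h0 f hf v hv)
  have hW : (cover H \ T).card ≤ S.card := by
    rw [card_sdiff_of_subset hT]
    omega
  have hsum := sum_hyperDegree (S := S) (W := cover H \ T) fun f hf v hv =>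
    mem_sdiff.2 ⟨subset_cover (hS hf) hv, fun h => hdis f hf v h hv⟩
  rw [sum_congr rfl fun f hf => hu f (hS hf), sum_const, smul_eq_mul] at hsum
  have hle : ∀ v ∈ cover H \ T, hyperDegree S v ≤ k := fun v _ => (hyperDegree_mono hS v).trans (hd v)
  have heq : ∀ v ∈ cover H \ T, hyperDegree S v = k := by
    refine (sum_eq_sum_iff_of_le hle).1 (le_antisymm (sum_le_sum hle) ?_)
    rw [hsum, sum_const, smul_eq_mul]
    exact Nat.mul_le_mul_right k hW
  have hsub : ∀ f ∈ H, f ∉ S → f ⊆ T := by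
    intro f hf hfS v hv
    by_contra hvT
    have h1 := heq v (mem_sdiff.2 ⟨subset_cover hf hv, hvT⟩)
    have h2 : hyperDegree S v < hyperDegree H v := card_lt_card
      ⟨filter_subset_filter _ hS, fun h => hfS (mem_filter.1 (h (mem_filter.2 ⟨hf, hv⟩))).1⟩
    have := hd v
    omega
  obtain ⟨v, hv⟩ := hTn
  obtain ⟨f₁, hf₁, hvf⟩ := mem_biUnion.1 (hT hv)
  obtain ⟨f₂, hf₂⟩ := hSn
  obtain ⟨c₁, hc₁⟩ := hH.colorable S ⟨hS, fun h => hdis f₁ (h hf₁) v hv hvf⟩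
  obtain ⟨c₂, hc₂⟩ := hH.colorable (H \ S)
    ⟨sdiff_subset, fun h => (mem_sdiff.1 (h (hS hf₂))).2 hf₂⟩
  refine hH.not_colorable (fun v => if v ∈ T then c₂ v else c₁ v) fun f hf => ?_
  by_cases hfS : f ∈ S
  · obtain ⟨u, hu, w, hw, h⟩ := hc₁ f hfS
    have h1 : ∀ v ∈ f, v ∉ T := fun v hv h => hdis f hfS v h hv
    exact ⟨u, hu, w, hw, by simpa [h1 u hu, h1 w hw] using h⟩
  · obtain ⟨u, hu, w, hw, h⟩ := hc₂ f (mem_sdiff.2 ⟨hf, hfS⟩)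
    have h1 := hsub f hf hfS
    exact ⟨u, hu, w, hw, by simpa [h1 hu, h1 hw] using h⟩

theorem card_filter_coe {α : Type*} [DecidableEq α] {P : Finset α} (p : α → Prop) [DecidablePred p] :
    (univ.filter fun i : P => p i).card = (P.filter p).card := by
  simp only [card_filter]
  exact sum_coe_sort P fun i => if p i then 1 else 0

theorem IsCritical.false_of_regular (hH : IsCritical H) (hk : 4 ≤ k) (hu : ∀ f ∈ H, f.card = k)
    (hd : ∀ v, hyperDegree H v ≤ k) : False := by
  have hk0 : 0 < k := by omega
  have hcard := hH.card_cover hk0 hu hd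
  obtain ⟨f, hf⟩ : H.Nonempty := by
    by_contra h
    rw [not_nonempty_iff_eq_empty] at h
    exact hH.not_colorable (fun _ => true) (by simp [h, IsProper2Coloring])
  have h4 : 4 ≤ (cover H).card := hk.trans ((hu f hf).symm.le.trans (card_le_card (subset_cover hf)))
  refine false_of_four_le_degree hH.snsOn.block (hH.expOn hk0 hu hd).block (by simpa using hcard)
    (by simp; omega) (fun i => ?_) (fun j => ?_)
  · have := card_filter_coe (P := cover H) (fun v => incidence i.1 v ≠ 0)
    unfold block
    rw [this]
    simp only [incidence_ne_zero, filter_mem_eq_inter]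
    rw [inter_eq_right.2 (subset_cover i.2), hu _ i.2]
    exact hk
  · have := card_filter_coe (P := H) (fun f => incidence f j.1 ≠ 0)
    unfold block
    rw [this]
    simp only [incidence_ne_zero]
    exact hk.trans (hH.hyperDegree_eq hk0 hu hd j.2).symm.le

end Hypergraph
end SignPattern

/-- Every `k`-uniform hypergraph (`k ≥ 4`) in which every vertex lies in at most `k`
hyperedges is 2-colorable. -/
theorem kUniform_maxDegree_le_two_colorable {V : Type*} [DecidableEq V] [Fintype V]
    (H : Finset (Finset V)) (k : ℕ) (hk : 4 ≤ k)
    (huniform : ∀ f ∈ H, f.card = k)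
    (hdeg : ∀ v : V, hyperDegree H v ≤ k) :
    ∃ c : V → Bool, IsProper2Coloring H c := by
  by_contra h
  push Not at h
  obtain ⟨H', hsub, hH'⟩ := SignPattern.exists_isCritical h
  exact hH'.false_of_regular hk (fun f hf => huniform f (hsub hf))
    fun v => (SignPattern.hyperDegree_mono hsub v).trans (hdeg v)
end

section
/- Let G be a finite simple graph with maximum degree Δ and minimum degree δ satisfying e·Δ² ≤ 2^{δ−1} (where e is Euler's number), and suppose G has a total dominating set T that is a proper subset of V(G). Then χ_d(G) ≤ χ(G[V∖T]) + 2·χ(G[T]), where G[S] denotes the subgraph of G induced on a vertex set S. -/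
open SimpleGraph Set

def IsDynamicColoring {V : Type*} (G : SimpleGraph V) {n : ℕ} (c : V → Fin n) : Prop :=
  (∀ ⦃u v⦄, G.Adj u v → c u ≠ c v) ∧
  ∀ v : V, 2 ≤ (G.neighborSet v).ncard →
    ∃ u w, u ∈ G.neighborSet v ∧ w ∈ G.neighborSet v ∧ c u ≠ c w

def DynColorable {V : Type*} (G : SimpleGraph V) (n : ℕ) : Prop :=
  ∃ c : V → Fin n, IsDynamicColoring G c

noncomputable def dynChromNum {V : Type*} (G : SimpleGraph V) : ℕ :=
  sInf {n | DynColorable G n}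

noncomputable def chromNum {V : Type*} (G : SimpleGraph V) : ℕ :=
  sInf {n | G.Colorable n}

/-- The vertex set `A` contains some but not all vertices of the edge `e`. -/
def Splits {α : Type*} (A e : Finset α) : Prop :=
  (∃ x ∈ e, x ∈ A) ∧ ∃ x ∈ e, x ∉ A

open Classical in
/-- The subsets of `S` that split every edge of the hypergraph `E` contained in `S`, that is, the
proper 2-colorings of the sub-hypergraph induced on `S`. -/
noncomputable def splitters {α : Type*} (E : Finset (Finset α)) (S : Finset α) :
    Finset (Finset α) :=
  S.powerset.filter fun A => ∀ e ∈ E, e ⊆ S → Splits A e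

section Hypergraph

variable {α : Type*} {E : Finset (Finset α)} {S : Finset α}

theorem mem_splitters {A : Finset α} :
    A ∈ splitters E S ↔ A ⊆ S ∧ ∀ e ∈ E, e ⊆ S → Splits A e := by
  simp [splitters]

theorem Splits.congr {A B e : Finset α} (hA : Splits A e) (h : ∀ x ∈ e, x ∈ A ↔ x ∈ B) :
    Splits B e := by
  obtain ⟨⟨x, hx, hxA⟩, y, hy, hyA⟩ := hA
  exact ⟨⟨x, hx, (h x hx).1 hxA⟩, y, hy, fun hyB => hyA ((h y hy).2 hyB)⟩

theorem pow_mul_card_splitters_le [DecidableEq α] {β : ℝ} (hβ : 0 ≤ β)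
    (hS : ∀ R ⊂ S, ∀ v ∉ R,
      β * (splitters E R).card ≤ (splitters E (insert v R)).card)
    {R : Finset α} (D : Finset α) (hD : Disjoint R D) (hRD : R ∪ D ⊆ S) :
    β ^ D.card * (splitters E R).card ≤ (splitters E (R ∪ D)).card := by
  induction D using Finset.induction_on with
  | empty => simp
  | insert v D hv ih =>
    rw [Finset.disjoint_insert_right] at hD
    have hvS : v ∈ S := hRD (by simp)
    have hsub : R ∪ D ⊆ S := (Finset.union_subset_union_right (Finset.subset_insert v D)).trans hRD
    have hvRD : v ∉ R ∪ D := by simp [hD.1, hv]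
    have hstep := hS (R ∪ D) ⟨hsub, fun h => hvRD (h hvS)⟩ v hvRD
    rw [Finset.card_insert_of_notMem hv, Finset.union_insert, pow_succ']
    calc β * β ^ D.card * (splitters E R).card
        = β * (β ^ D.card * (splitters E R).card) := by ring
      _ ≤ β * (splitters E (R ∪ D)).card := mul_le_mul_of_nonneg_left (ih hD.2 hsub) hβ
      _ ≤ _ := hstep

/-- Sets that fail to split an edge `e ∋ w` are determined by their trace outside `e \ {w}`. -/
theorem card_le_card_splitters_of_not_splits [DecidableEq α] {v w : α} {e : Finset α}
    (hve : v ∈ e) (hwe : w ∈ e) (hwv : w ≠ v) {B : Finset (Finset α)}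
    (hB : ∀ A ∈ B, A ⊆ insert v S ∧ (∀ f ∈ E, f ⊆ S → Splits A f) ∧ ¬ Splits A e) :
    B.card ≤ (splitters E (S \ e.erase w)).card := by
  refine Finset.card_le_card_of_injOn (fun A => A \ e.erase w) ?_ ?_
  · intro A hA
    obtain ⟨hAS, hsplit, -⟩ := hB A hA
    refine mem_splitters.2 ⟨fun x hx => ?_, fun f hf hfS => ?_⟩
    · obtain ⟨hxA, hxe⟩ := Finset.mem_sdiff.1 hx
      refine Finset.mem_sdiff.2 ⟨?_, hxe⟩
      rcases Finset.mem_insert.1 (hAS hxA) with rfl | hxS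
      · exact absurd (Finset.mem_erase.2 ⟨hwv.symm, hve⟩) hxe
      · exact hxS
    · refine (hsplit f hf (hfS.trans Finset.sdiff_subset)).congr fun x hx => ?_
      have := (Finset.mem_sdiff.1 (hfS hx)).2
      simp only [Finset.mem_sdiff, this, not_false_eq_true, and_true]
  · have key : ∀ A ∈ B, ∀ x ∈ e, x ∈ A ↔ w ∈ A := by
      intro A hA x hx
      have hns := (hB A hA).2.2
      constructor
      · intro hxA
        by_contra hwA
        exact hns ⟨⟨x, hx, hxA⟩, w, hwe, hwA⟩
      · intro hwA
        by_contra hxA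
        exact hns ⟨⟨w, hwe, hwA⟩, x, hx, hxA⟩
    intro A hA A' hA' hAA'
    have hx : ∀ x, x ∉ e.erase w → (x ∈ A ↔ x ∈ A') := by
      intro x hx
      have := Finset.ext_iff.1 hAA' x
      simpa only [Finset.mem_sdiff, hx, not_false_eq_true, and_true] using this
    ext x
    by_cases hxe : x ∈ e
    · rw [key A hA x hxe, key A' hA' x hxe]
      exact hx w (by simp)
    · exact hx x fun h => hxe (Finset.mem_of_mem_erase h)

theorem mul_card_splitters_le_card_insert [DecidableEq α] {β d : ℝ} {k : ℕ} (hβ : 1 ≤ β)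
    (hE : ∀ e ∈ E, k + 2 ≤ e.card) (hdeg : ∀ v, ((E.filter (v ∈ ·)).card : ℝ) ≤ d)
    (hd : d ≤ (2 - β) * β ^ k) (S : Finset α) (v : α) (hv : v ∉ S) :
    β * (splitters E S).card ≤ (splitters E (insert v S)).card := by
  classical
  induction S using Finset.strongInduction generalizing v with
  | H S ih =>
  have hβ0 : 0 < β := by linarith
  set Q := splitters E S ∪ (splitters E S).image (insert v) with hQ
  set bad : Finset α → Finset (Finset α) := fun e =>
    Q.filter fun A => e ⊆ insert v S ∧ ¬ Splits A e with hbad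
  have hvA : ∀ A ∈ splitters E S, v ∉ A := fun A hA h => hv ((mem_splitters.1 hA).1 h)
  have hQcard : Q.card = 2 * (splitters E S).card := by
    rw [hQ, Finset.card_union_of_disjoint, Finset.card_image_of_injOn]
    · ring
    · intro A hA A' hA' h
      rw [← Finset.erase_insert (hvA A hA), ← Finset.erase_insert (hvA A' hA')]
      exact congrArg (Finset.erase · v) h
    · rw [Finset.disjoint_left]
      intro A hA hA'
      obtain ⟨A', -, rfl⟩ := Finset.mem_image.1 hA'
      exact hvA _ hA (Finset.mem_insert_self _ _)
  have hQmem : ∀ A ∈ Q, A ⊆ insert v S ∧ ∀ f ∈ E, f ⊆ S → Splits A f := by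
    intro A hA
    rcases Finset.mem_union.1 hA with hA | hA
    · obtain ⟨hAS, h⟩ := mem_splitters.1 hA
      exact ⟨hAS.trans (Finset.subset_insert _ _), h⟩
    · obtain ⟨A', hA', rfl⟩ := Finset.mem_image.1 hA
      obtain ⟨hAS, h⟩ := mem_splitters.1 hA'
      refine ⟨Finset.insert_subset_insert _ hAS, fun f hf hfS => (h f hf hfS).congr fun x hx => ?_⟩
      have : x ≠ v := fun h => hv (h ▸ hfS hx)
      simp [this]
  have hcover : Q ⊆ splitters E (insert v S) ∪ (E.filter (v ∈ ·)).biUnion bad := by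
    intro A hA
    by_cases hAm : A ∈ splitters E (insert v S)
    · exact Finset.mem_union_left _ hAm
    refine Finset.mem_union_right _ ?_
    obtain ⟨hAS, hsplit⟩ := hQmem A hA
    rw [mem_splitters] at hAm
    push Not at hAm
    obtain ⟨e, he, heS, hns⟩ := hAm hAS
    have hve : v ∈ e := by
      by_contra hve
      exact hns (hsplit e he ((Finset.subset_insert_iff_of_notMem hve).1 heS))
    exact Finset.mem_biUnion.2 ⟨e, Finset.mem_filter.2 ⟨he, hve⟩,
      Finset.mem_filter.2 ⟨hA, heS, hns⟩⟩
  have hbadcard : ∀ e ∈ E.filter (v ∈ ·), β ^ k * ((bad e).card : ℝ) ≤ (splitters E S).card := by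
    intro e he
    obtain ⟨he, hve⟩ := Finset.mem_filter.1 he
    by_cases heS : e ⊆ insert v S
    swap
    · simp [hbad, heS]
    obtain ⟨w, hwe, hwv⟩ : ∃ w ∈ e, w ≠ v :=
      Finset.exists_mem_ne (by have := hE e he; omega) v
    have h1 : (bad e).card ≤ (splitters E (S \ e.erase w)).card :=
      card_le_card_splitters_of_not_splits hve hwe hwv fun A hA =>
        have hA' := Finset.mem_filter.1 hA
        ⟨(hQmem A hA'.1).1, (hQmem A hA'.1).2, hA'.2.2⟩
    set D := (e.erase w).erase v with hD
    have hDS : D ⊆ S := by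
      intro x hx
      simp only [hD, Finset.mem_erase] at hx
      exact (Finset.mem_insert.1 (heS hx.2.2)).resolve_left hx.1
    have hSD : S \ e.erase w = S \ D := by
      ext x
      simp only [hD, Finset.mem_sdiff, Finset.mem_erase]
      grind
    have hDcard : k ≤ D.card := by
      have := hE e he
      rw [hD, Finset.card_erase_of_mem (Finset.mem_erase.2 ⟨hwv.symm, hve⟩),
        Finset.card_erase_of_mem hwe]
      omega
    have h2 := pow_mul_card_splitters_le hβ0.le ih D (R := S \ D) Finset.sdiff_disjoint
      (by rw [Finset.sdiff_union_of_subset hDS])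
    rw [Finset.sdiff_union_of_subset hDS] at h2
    rw [hSD] at h1
    calc β ^ k * ((bad e).card : ℝ) ≤ β ^ D.card * (splitters E (S \ D)).card := by
          gcongr
      _ ≤ _ := h2
  have hcount : (2 * (splitters E S).card : ℝ) ≤
      (splitters E (insert v S)).card + ∑ e ∈ E.filter (v ∈ ·), ((bad e).card : ℝ) := by
    have := (Finset.card_le_card hcover).trans ((Finset.card_union_le _ _).trans
      (Nat.add_le_add_left Finset.card_biUnion_le _))
    rw [hQcard] at this
    exact_mod_cast this
  have hsum : β ^ k * ∑ e ∈ E.filter (v ∈ ·), ((bad e).card : ℝ) ≤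
      (2 - β) * β ^ k * (splitters E S).card := by
    rw [Finset.mul_sum]
    refine (Finset.sum_le_card_nsmul _ _ _ hbadcard).trans ?_
    rw [nsmul_eq_mul]
    gcongr
    exact (hdeg v).trans hd
  have hpow : 0 < β ^ k := pow_pos hβ0 k
  refine le_of_mul_le_mul_left ?_ hpow
  have := mul_le_mul_of_nonneg_left hcount hpow.le
  linarith

/-- A finite hypergraph with edges of size at least `k + 2` and maximum degree at most
`(2 - β) * β ^ k` for some `β ≥ 1` is 2-colorable. -/
theorem exists_forall_splits {β d : ℝ} {k : ℕ} [Fintype α] [DecidableEq α] (hβ : 1 ≤ β)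
    (hE : ∀ e ∈ E, k + 2 ≤ e.card) (hdeg : ∀ v, ((E.filter (v ∈ ·)).card : ℝ) ≤ d)
    (hd : d ≤ (2 - β) * β ^ k) : ∃ A : Finset α, ∀ e ∈ E, Splits A e := by
  have hpos : ∀ S : Finset α, 0 < ((splitters E S).card : ℝ) := by
    intro S
    induction S using Finset.induction_on with
    | empty =>
      refine Nat.cast_pos.2 (Finset.card_pos.2 ⟨∅, mem_splitters.2 ⟨le_rfl, fun e he h => ?_⟩⟩)
      have := hE e he
      rw [Finset.subset_empty.1 h, Finset.card_empty] at this
      omega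
    | insert v S hv ih =>
      exact (mul_pos (by linarith) ih).trans_le
        (mul_card_splitters_le_card_insert hβ hE hdeg hd S v hv)
  obtain ⟨A, hA⟩ := Finset.card_pos.1 (Nat.cast_pos.1 (hpos Finset.univ))
  exact ⟨A, fun e he => (mem_splitters.1 hA).2 e he (Finset.subset_univ e)⟩

end Hypergraph

theorem le_two_div_mul_pow {m : ℕ} {d : ℝ} (hmd : (m : ℝ) + 2 ≤ d)
    (h : Real.exp 1 * d ^ 2 ≤ 2 ^ (m + 2)) :
    d ≤ (2 - 2 * ((m + 1) / (m + 2) : ℝ)) * (2 * ((m + 1) / (m + 2) : ℝ)) ^ (m + 1) := by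
  have hm : (0 : ℝ) ≤ m := m.cast_nonneg
  have hd : 0 < d := by linarith
  have hexp : ((m + 2) / (m + 1) : ℝ) ^ (m + 1) ≤ Real.exp 1 := by
    have h1 : ((m + 2) / (m + 1) : ℝ) ≤ Real.exp (1 / (m + 1)) := by
      have := Real.add_one_le_exp (1 / (m + 1) : ℝ)
      convert this using 1
      field_simp
      ring
    calc ((m + 2) / (m + 1) : ℝ) ^ (m + 1) ≤ Real.exp (1 / (m + 1)) ^ (m + 1) := by gcongr
      _ = Real.exp 1 := by
        rw [← Real.exp_nat_mul]
        congr 1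
        push_cast
        field_simp
  set q : ℝ := ((m + 1) / (m + 2) : ℝ) with hq
  have hinv : q ^ (m + 1) * ((m + 2) / (m + 1) : ℝ) ^ (m + 1) = 1 := by
    rw [← mul_pow, hq]
    rw [show ((m + 1) / (m + 2) : ℝ) * ((m + 2) / (m + 1)) = 1 by field_simp, one_pow]
  have hq0 : 0 < q := by positivity
  have hqe : 1 ≤ q ^ (m + 1) * Real.exp 1 := by
    calc 1 = q ^ (m + 1) * ((m + 2) / (m + 1) : ℝ) ^ (m + 1) := hinv.symm
      _ ≤ q ^ (m + 1) * Real.exp 1 := by gcongr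
  have hq2 : 2 - 2 * q = 2 / (m + 2) := by
    rw [hq]
    field_simp
    ring
  rw [hq2, mul_pow, div_mul_eq_mul_div, le_div_iff₀ (by positivity)]
  calc d * (m + 2) ≤ d * d := by gcongr
    _ = d ^ 2 * 1 := by ring
    _ ≤ d ^ 2 * (q ^ (m + 1) * Real.exp 1) := by gcongr
    _ = q ^ (m + 1) * (Real.exp 1 * d ^ 2) := by ring
    _ ≤ q ^ (m + 1) * 2 ^ (m + 2) := by gcongr
    _ = 2 * (2 ^ (m + 1) * q ^ (m + 1)) := by ring

/-- If `e·Δ² ≤ 2^(δ-1)` and `Δ ≥ 1`, the vertices can be 2-colored so that no neighborhood is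
monochromatic. -/
theorem exists_forall_splits_neighborFinset {V : Type*} [Fintype V] (G : SimpleGraph V)
    [DecidableRel G.Adj] (hΔ : 1 ≤ G.maxDegree)
    (h : Real.exp 1 * (G.maxDegree : ℝ) ^ 2 ≤ (2 : ℝ) ^ ((G.minDegree : ℝ) - 1)) :
    ∃ A : Finset V, ∀ v, Splits A (G.neighborFinset v) := by
  classical
  have hle : (G.minDegree : ℝ) ≤ G.maxDegree := by
    exact_mod_cast G.minDegree_le_maxDegree
  have hΔ' : (1 : ℝ) ≤ G.maxDegree := by exact_mod_cast hΔ
  have he : (2 : ℝ) < Real.exp 1 := by linarith [Real.exp_one_gt_d9]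
  have hδ : 3 ≤ G.minDegree := by
    by_contra hlt
    have h2 : (G.minDegree : ℝ) ≤ 2 := by exact_mod_cast (by omega : G.minDegree ≤ 2)
    have : (2 : ℝ) ^ ((G.minDegree : ℝ) - 1) ≤ 2 ^ (1 : ℝ) :=
      Real.rpow_le_rpow_of_exponent_le (by norm_num) (by linarith)
    rw [Real.rpow_one] at this
    have := le_mul_of_one_le_right (by linarith : 0 ≤ Real.exp 1)
      (one_le_pow₀ hΔ' : 1 ≤ (G.maxDegree : ℝ) ^ 2)
    linarith
  obtain ⟨m, hm⟩ := Nat.exists_eq_add_of_le hδ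
  have hpow : (2 : ℝ) ^ ((G.minDegree : ℝ) - 1) = 2 ^ (m + 2) := by
    rw [← Real.rpow_natCast, hm]
    congr 1
    push_cast
    ring
  rw [hpow] at h
  have hmd : (m : ℝ) + 2 ≤ G.maxDegree := by
    refine le_trans ?_ hle
    rw [hm]
    push_cast
    linarith
  have hβ : 1 ≤ 2 * ((m + 1) / (m + 2) : ℝ) := by
    rw [← mul_div_assoc, le_div_iff₀ (by positivity)]
    linarith [(m.cast_nonneg : (0 : ℝ) ≤ m)]
  set E := Finset.univ.image fun v => G.neighborFinset v
  have hcard : ∀ e ∈ E, m + 1 + 2 ≤ e.card := by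
    intro e he
    obtain ⟨v, -, rfl⟩ := Finset.mem_image.1 he
    rw [G.card_neighborFinset_eq_degree]
    have := G.minDegree_le_degree v
    omega
  have hdeg : ∀ v, ((E.filter (v ∈ ·)).card : ℝ) ≤ G.maxDegree := by
    intro v
    have hsub : E.filter (v ∈ ·) ⊆ (G.neighborFinset v).image fun u => G.neighborFinset u := by
      intro e he
      obtain ⟨he, hve⟩ := Finset.mem_filter.1 he
      obtain ⟨u, -, rfl⟩ := Finset.mem_image.1 he
      refine Finset.mem_image_of_mem _ ?_
      rw [mem_neighborFinset] at hve ⊢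
      exact hve.symm
    exact_mod_cast (Finset.card_le_card hsub).trans (Finset.card_image_le.trans
      (G.degree_le_maxDegree v))
  obtain ⟨A, hA⟩ := exists_forall_splits hβ hcard hdeg (le_two_div_mul_pow hmd h)
  exact ⟨A, fun v => hA _ (Finset.mem_image_of_mem _ (Finset.mem_univ v))⟩

theorem colorable_chromNum {V : Type*} [Finite V] (G : SimpleGraph V) :
    G.Colorable (chromNum G) := by
  have := Fintype.ofFinite V
  exact Nat.sInf_mem (s := {n | G.Colorable n}) ⟨_, G.colorable_of_fintype⟩

/-- If `e·Δ² ≤ 2^(δ-1)` and `G` has a total dominating set `T ⊊ V(G)`, then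
`χ_d(G) ≤ χ(G[V∖T]) + 2·χ(G[T])`. -/
theorem dynChromNum_le_of_total_dominating {V : Type*} [Fintype V] (G : SimpleGraph V)
    [DecidableRel G.Adj]
    (h : Real.exp 1 * (G.maxDegree : ℝ) ^ 2 ≤ (2 : ℝ) ^ ((G.minDegree : ℝ) - 1))
    (T : Set V) (hT : T ⊂ Set.univ)
    (hdom : ∀ v : V, ∃ u ∈ T, G.Adj v u) :
    dynChromNum G ≤ chromNum (G.induce Tᶜ) + 2 * chromNum (G.induce T) := by
  classical
  obtain ⟨v₀, -⟩ := Set.exists_of_ssubset hT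
  have hΔ : 1 ≤ G.maxDegree := by
    obtain ⟨u, -, hu⟩ := hdom v₀
    exact ((G.degree_pos_iff_exists_adj v₀).2 ⟨u, hu⟩).trans_le (G.degree_le_maxDegree v₀)
  obtain ⟨A, hA⟩ := exists_forall_splits_neighborFinset G hΔ h
  obtain ⟨c₁⟩ := colorable_chromNum (G.induce Tᶜ)
  obtain ⟨c₂⟩ := colorable_chromNum (G.induce T)
  let c : V → Fin (chromNum (G.induce Tᶜ)) ⊕ Fin 2 × Fin (chromNum (G.induce T)) := fun v =>
    if hv : v ∈ T then Sum.inr (if v ∈ A then 1 else 0, c₂ ⟨v, hv⟩) else Sum.inl (c₁ ⟨v, hv⟩)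
  have hproper : ∀ ⦃u v⦄, G.Adj u v → c u ≠ c v := by
    intro u v huv heq
    by_cases hu : u ∈ T <;> by_cases hv : v ∈ T <;>
      simp only [c, hu, hv, dif_pos, dif_neg, not_false_eq_true, Sum.inr.injEq, Sum.inl.injEq,
        Prod.mk.injEq, reduceCtorEq] at heq
    · exact c₂.valid (v := ⟨u, hu⟩) (w := ⟨v, hv⟩) huv heq.2
    · exact c₁.valid (v := ⟨u, hu⟩) (w := ⟨v, hv⟩) huv heq
  have hdyn : ∀ v, ∃ u w, u ∈ G.neighborSet v ∧ w ∈ G.neighborSet v ∧ c u ≠ c w := by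
    intro v
    obtain ⟨⟨x, hx, hxA⟩, y, hy, hyA⟩ := hA v
    rw [mem_neighborFinset] at hx hy
    obtain ⟨u, huT, hu⟩ := hdom v
    by_cases hxT : x ∈ T
    · by_cases hyT : y ∈ T
      · exact ⟨x, y, hx, hy, by simp [c, hxT, hyT, hxA, hyA]⟩
      · exact ⟨u, y, hu, hy, by simp [c, huT, hyT]⟩
    · exact ⟨u, x, hu, hx, by simp [c, huT, hxT]⟩
  let φ := (Equiv.sumCongr (Equiv.refl (Fin (chromNum (G.induce Tᶜ))))
    (finProdFinEquiv (m := 2) (n := chromNum (G.induce T)))).trans finSumFinEquiv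
  refine Nat.sInf_le ⟨φ ∘ c, fun u v huv => φ.injective.ne (hproper huv), fun v _ => ?_⟩
  obtain ⟨u, w, hu, hw, hne⟩ := hdyn v
  exact ⟨u, w, hu, hw, φ.injective.ne hne⟩
end

section
/- Let G be a finite simple graph and let T ⊆ V(G) be a double total dominating set, i.e., every vertex of G has at least one neighbor in T and at least one neighbor in V(G)∖T. Then χ_d(G) ≤ χ(G[V∖T]) + χ(G[T]), where G[S] denotes the subgraph of G induced on a vertex set S. -/
open SimpleGraph Set

/-- If `T` is a double total dominating set of the finite graph `G` (every vertex has a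
neighbor in `T` and a neighbor outside `T`), then `χ_d(G) ≤ χ(G[V∖T]) + χ(G[T])`. -/
theorem dynChromNum_le_of_double_total_dominating {V : Type*} [Fintype V] (G : SimpleGraph V)
    (T : Set V)
    (hdom : ∀ v : V, (∃ u ∈ T, G.Adj v u) ∧ (∃ u ∉ T, G.Adj v u)) :
    dynChromNum G ≤ chromNum (G.induce Tᶜ) + chromNum (G.induce T) := by
  classical
  obtain ⟨a⟩ := colorable_chromNum (G.induce Tᶜ)
  obtain ⟨b⟩ := colorable_chromNum (G.induce T)
  let c : V → Fin (chromNum (G.induce Tᶜ) + chromNum (G.induce T)) := fun v =>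
    if h : v ∈ T then Fin.natAdd _ (b ⟨v, h⟩) else Fin.castAdd _ (a ⟨v, h⟩)
  have c_of_mem {v : V} (h : v ∈ T) : c v = Fin.natAdd _ (b ⟨v, h⟩) := dif_pos h
  have c_of_notMem {v : V} (h : v ∉ T) : c v = Fin.castAdd _ (a ⟨v, h⟩) := dif_neg h
  have c_ne {u v : V} (hu : u ∈ T) (hv : v ∉ T) : c u ≠ c v := by
    rw [c_of_mem hu, c_of_notMem hv, Ne, Fin.ext_iff, Fin.val_natAdd, Fin.val_castAdd]
    have := (a ⟨v, hv⟩).isLt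
    omega
  refine Nat.sInf_le ⟨c, fun u v huv => ?_, fun v _ => ?_⟩
  · by_cases hu : u ∈ T <;> by_cases hv : v ∈ T
    · rw [c_of_mem hu, c_of_mem hv]
      exact fun h => b.valid (v := ⟨u, hu⟩) (w := ⟨v, hv⟩) huv (Fin.natAdd_injective _ _ h)
    · exact c_ne hu hv
    · exact (c_ne hv hu).symm
    · rw [c_of_notMem hu, c_of_notMem hv]
      exact fun h => a.valid (v := ⟨u, hu⟩) (w := ⟨v, hv⟩) huv (Fin.castAdd_injective _ _ h)
  · obtain ⟨⟨u, hu, hvu⟩, w, hw, hvw⟩ := hdom v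
    exact ⟨u, w, hvu, hvw, c_ne hu hw⟩
end

section
/- Let G be a finite simple graph that has a double total dominating set T ⊊ V(G), i.e., every vertex of G has at least one neighbor in T and at least one neighbor in V(G)∖T. Then χ_d(G) ≤ 2·χ(G). -/
open SimpleGraph Set

/-- Splitting every color class of a proper coloring along a double total dominating set
yields a dynamic coloring. -/
theorem SimpleGraph.Colorable.dynColorable_two_mul {V : Type*} {G : SimpleGraph V} {n : ℕ}
    (hG : G.Colorable n) (T : Set V)
    (hdom : ∀ v : V, (∃ u ∈ T, G.Adj v u) ∧ (∃ u ∉ T, G.Adj v u)) :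
    DynColorable G (2 * n) := by
  classical
  obtain ⟨c⟩ := hG
  refine ⟨fun v => finProdFinEquiv ((if v ∈ T then 0 else 1 : Fin 2), c v), ?_, ?_⟩
  · intro u v huv h
    exact c.valid huv (Prod.ext_iff.1 (finProdFinEquiv.injective h)).2
  · intro v _
    obtain ⟨⟨u, hu, hvu⟩, w, hw, hvw⟩ := hdom v
    refine ⟨u, w, hvu, hvw, fun h => ?_⟩
    simpa [hu, hw] using (Prod.ext_iff.1 (finProdFinEquiv.injective h)).1

/-- If a finite graph `G` has a double total dominating set `T ⊊ V(G)`, then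
`χ_d(G) ≤ 2 χ(G)`. -/
theorem dynChromNum_le_two_mul_chromNum_of_double_total_dominating {V : Type*} [Fintype V]
    (G : SimpleGraph V) (T : Set V) (hT : T ⊂ Set.univ)
    (hdom : ∀ v : V, (∃ u ∈ T, G.Adj v u) ∧ (∃ u ∉ T, G.Adj v u)) :
    dynChromNum G ≤ 2 * chromNum G := by
  have hne : {n | G.Colorable n}.Nonempty := ⟨_, G.colorable_of_fintype⟩
  have hG : G.Colorable (chromNum G) := Nat.sInf_mem hne
  exact Nat.sInf_le (hG.dynColorable_two_mul T hdom)
end
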